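/- arXiv:1910.01429 — 2 statements merged into one kernel-verified Lean document; each statement's English description precedes it below -/
import Mathlib

section
/- Suppose the sampled-data system associated with T, B, and sampling period τ > 0 is exponentially stable with decay rate greater than ω, and let t₀ > 0 be arbitrary. Then there exists q ∈ (0,1) such that for every bounded linear operator D : X₁ → X satisfying ∫₀^{t₀} ‖D T(s)x‖ ds ≤ q‖x‖ for all x ∈ dom(A), the operator A + D (with domain dom(A)) generates a strongly continuous semigroup T_D on X, and the perturbed sampled-data system, obtained by replacing T with T_D in the solution formula, is exponentially stable with decay rate greater than ω. -/
open MeasureTheory Filter Set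
open scoped Topology Real

variable {X : Type*}

/-- A strongly continuous (C₀) semigroup on a Banach space `X`. -/
def IsC0Semigroup [NormedAddCommGroup X] [NormedSpace ℂ X]
    (T : ℝ → X →L[ℂ] X) : Prop :=
  T 0 = 1 ∧
  (∀ t s : ℝ, 0 ≤ t → 0 ≤ s → T (t + s) = (T t).comp (T s)) ∧
  (∀ x : X, ContinuousOn (fun t => T t x) (Set.Ici (0 : ℝ)))

/-- `A`, with domain `domA`, is the generator of the semigroup `T`. -/
def IsGenerator [NormedAddCommGroup X] [NormedSpace ℂ X]
    (T : ℝ → X →L[ℂ] X) (domA : Set X) (A : X → X) : Prop :=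
  (∀ x : X, x ∈ domA ↔ ∃ y : X,
      Tendsto (fun t : ℝ => t⁻¹ • (T t x - x)) (𝓝[>] (0 : ℝ)) (𝓝 y)) ∧
  (∀ x ∈ domA,
      Tendsto (fun t : ℝ => t⁻¹ • (T t x - x)) (𝓝[>] (0 : ℝ)) (𝓝 (A x)))

/-- Power stability of a bounded operator. -/
def PowerStable [NormedAddCommGroup X] [NormedSpace ℂ X] (Δ : X →L[ℂ] X) : Prop :=
  ∃ M : ℝ, 1 ≤ M ∧ ∃ θ : ℝ, θ ∈ Set.Ioo (0 : ℝ) 1 ∧ ∀ k : ℕ, ‖Δ ^ k‖ ≤ M * θ ^ k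

/-- `x` is the sampled-data solution with initial state `x0`. -/
def IsSdSolution [NormedAddCommGroup X] [NormedSpace ℂ X]
    (T : ℝ → X →L[ℂ] X) (B : X →L[ℂ] X) (τ : ℝ) (x0 : X) (x : ℝ → X) : Prop :=
  x 0 = x0 ∧
  ∀ (k : ℕ) (t : ℝ), 0 < t → t ≤ τ →
    x (k * τ + t) = T t (x (k * τ)) + ∫ s in (0 : ℝ)..t, T s (B (x (k * τ)))

/-- The sampled-data system is exponentially stable with decay rate greater than `ω`. -/
def SdExpStable [NormedAddCommGroup X] [NormedSpace ℂ X]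
    (T : ℝ → X →L[ℂ] X) (B : X →L[ℂ] X) (τ ω : ℝ) : Prop :=
  ∃ M : ℝ, 1 ≤ M ∧ ∃ ω' : ℝ, ω < ω' ∧
    ∀ (x0 : X) (x : ℝ → X), IsSdSolution T B τ x0 x →
      ∀ t : ℝ, 0 ≤ t → ‖x t‖ ≤ M * Real.exp (-ω' * t) * ‖x0‖

/-- `D` is a bounded linear operator from `X₁ = (dom A, ‖·‖ + ‖A ·‖)` to `X`,
represented as a function on `X` that is linear and graph-norm bounded on `dom A`. -/
def IsGraphBoundedOp [NormedAddCommGroup X] [NormedSpace ℂ X]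
    (domA : Set X) (A : X → X) (D : X → X) : Prop :=
  (∀ x ∈ domA, ∀ y ∈ domA, D (x + y) = D x + D y) ∧
  (∀ (c : ℂ), ∀ x ∈ domA, D (c • x) = c • D x) ∧
  (∃ C : ℝ, ∀ x ∈ domA, ‖D x‖ ≤ C * (‖x‖ + ‖A x‖))

section Volterra

open BoundedContinuousFunction

variable [NormedAddCommGroup X] [NormedSpace ℂ X]

theorem continuous_volterra_integrand (P : ℝ → X →L[ℂ] X) (hP : ∀ y, Continuous fun s => P s y)
    (F : X →L[ℂ] (ℝ →ᵇ X)) (y : X) :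
    Continuous fun p : ℝ × ℝ => F (P p.2 y) (p.1 - p.2) := by
  have h1 : Continuous fun p : ℝ × ℝ => F (P p.2 y) :=
    F.continuous.comp ((hP y).comp continuous_snd)
  exact h1.eval (continuous_fst.sub continuous_snd)

theorem continuous_volterra_section (P : ℝ → X →L[ℂ] X) (hP : ∀ y, Continuous fun s => P s y)
    (F : X →L[ℂ] (ℝ →ᵇ X)) (y : X) (t : ℝ) :
    Continuous fun s : ℝ => F (P s y) (t - s) :=
  (continuous_volterra_integrand P hP F y).comp (by fun_prop : Continuous fun s : ℝ => (t, s))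

theorem continuous_volterra_integral (P : ℝ → X →L[ℂ] X) (hP : ∀ y, Continuous fun s => P s y)
    (F : X →L[ℂ] (ℝ →ᵇ X)) (y : X) :
    Continuous fun t : ℝ => ∫ s in (0 : ℝ)..t, F (P s y) (t - s) :=
  intervalIntegral.continuous_parametric_intervalIntegral_of_continuous
    (f := fun t s => F (P s y) (t - s)) (continuous_volterra_integrand P hP F y) continuous_id

theorem norm_volterra_integral_le (P : ℝ → X →L[ℂ] X) (hP : ∀ y, Continuous fun s => P s y)
    (F : X →L[ℂ] (ℝ →ᵇ X)) (y : X) {c t : ℝ} (ht : 0 ≤ t)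
    (hc : (∫ s in (0 : ℝ)..t, ‖P s y‖) ≤ c) :
    ‖∫ s in (0 : ℝ)..t, F (P s y) (t - s)‖ ≤ ‖F‖ * c := by
  calc ‖∫ s in (0 : ℝ)..t, F (P s y) (t - s)‖
      ≤ ∫ s in (0 : ℝ)..t, ‖F (P s y) (t - s)‖ :=
        intervalIntegral.norm_integral_le_integral_norm ht
    _ ≤ ∫ s in (0 : ℝ)..t, ‖F‖ * ‖P s y‖ := by
        apply intervalIntegral.integral_mono_on ht
        · exact (continuous_volterra_section P hP F y t).norm.intervalIntegrable _ _
        · exact (continuous_const.mul (hP y).norm).intervalIntegrable _ _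
        · intro s _
          exact ((F (P s y)).norm_coe_le_norm _).trans (F.le_opNorm _)
    _ = ‖F‖ * ∫ s in (0 : ℝ)..t, ‖P s y‖ := by rw [intervalIntegral.integral_const_mul]
    _ ≤ ‖F‖ * c := by gcongr

/-- The Volterra integral `t ↦ ∫₀ᵗ F(P(s)y)(t - s) ds`, frozen at `0` for negative times, as a
linear function of `y`. -/
noncomputable def volterraLinear (P : ℝ → X →L[ℂ] X) (hP : ∀ y, Continuous fun s => P s y)
    (R : X →L[ℂ] X) (q : ℝ)
    (hq : ∀ y t, 0 ≤ t → (∫ s in (0 : ℝ)..t, ‖P s y‖) ≤ q * ‖R y‖)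
    (F : X →L[ℂ] (ℝ →ᵇ X)) : X →ₗ[ℂ] (ℝ →ᵇ X) where
  toFun y := BoundedContinuousFunction.ofNormedAddCommGroup
    (fun t => ∫ s in (0 : ℝ)..max t 0, F (P s y) (max t 0 - s))
    ((continuous_volterra_integral P hP F y).comp (by fun_prop : Continuous fun t : ℝ => max t 0))
    (‖F‖ * (q * ‖R y‖))
    (fun t => norm_volterra_integral_le P hP F y (le_max_right _ _) (hq y _ (le_max_right _ _)))
  map_add' y z := by
    ext t
    simp only [map_add, BoundedContinuousFunction.coe_add, Pi.add_apply,
      BoundedContinuousFunction.coe_ofNormedAddCommGroup]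
    exact intervalIntegral.integral_add
      ((continuous_volterra_section P hP F y _).intervalIntegrable _ _)
      ((continuous_volterra_section P hP F z _).intervalIntegrable _ _)
  map_smul' c y := by
    ext t
    simp only [map_smul, BoundedContinuousFunction.coe_smul, 
      BoundedContinuousFunction.coe_ofNormedAddCommGroup, RingHom.id_apply]
    exact intervalIntegral.integral_smul _ _

theorem norm_volterraLinear_le (P : ℝ → X →L[ℂ] X) (hP : ∀ y, Continuous fun s => P s y)
    (R : X →L[ℂ] X) (q : ℝ) (hq0 : 0 ≤ q)
    (hq : ∀ y t, 0 ≤ t → (∫ s in (0 : ℝ)..t, ‖P s y‖) ≤ q * ‖R y‖)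
    (F : X →L[ℂ] (ℝ →ᵇ X)) (y : X) :
    ‖volterraLinear P hP R q hq F y‖ ≤ (‖F‖ * q) * ‖R y‖ := by
  rw [BoundedContinuousFunction.norm_le (by positivity), mul_assoc]
  exact fun t => norm_volterra_integral_le P hP F y (le_max_right _ _) (hq y _ (le_max_right _ _))

theorem volterraLinear_sub (P : ℝ → X →L[ℂ] X) (hP : ∀ y, Continuous fun s => P s y)
    (R : X →L[ℂ] X) (q : ℝ)
    (hq : ∀ y t, 0 ≤ t → (∫ s in (0 : ℝ)..t, ‖P s y‖) ≤ q * ‖R y‖)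
    (F G : X →L[ℂ] (ℝ →ᵇ X)) (y : X) :
    volterraLinear P hP R q hq F y - volterraLinear P hP R q hq G y =
      volterraLinear P hP R q hq (F - G) y := by
  ext t
  exact (intervalIntegral.integral_sub
      ((continuous_volterra_section P hP F y _).intervalIntegrable _ _)
      ((continuous_volterra_section P hP G y _).intervalIntegrable _ _)).symm

variable [CompleteSpace X]

theorem exists_volterra_fixedPoint (P : ℝ → X →L[ℂ] X) (hP : ∀ y, Continuous fun s => P s y)
    (R : X →L[ℂ] X) (hR : DenseRange R) (q : ℝ) (hq0 : 0 ≤ q) (hq1 : q < 1)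
    (hq : ∀ y t, 0 ≤ t → (∫ s in (0 : ℝ)..t, ‖P s y‖) ≤ q * ‖R y‖)
    (G : X →L[ℂ] (ℝ →ᵇ X)) :
    ∃ F : X →L[ℂ] (ℝ →ᵇ X), ‖F‖ ≤ ‖G‖ / (1 - q) ∧ ‖F - G‖ ≤ q * (‖G‖ / (1 - q)) ∧
      ∀ y t, 0 ≤ t → F (R y) t = G (R y) t + ∫ s in (0 : ℝ)..t, F (P s y) (t - s) := by
  set V : (X →L[ℂ] (ℝ →ᵇ X)) → (X →L[ℂ] (ℝ →ᵇ X)) := fun F =>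
    (volterraLinear P hP R q hq F).extendOfNorm (R : X →ₗ[ℂ] X) with hV
  have hVeq : ∀ F y, V F (R y) = volterraLinear P hP R q hq F y := fun F y =>
    LinearMap.extendOfNorm_eq (e := (R : X →ₗ[ℂ] X)) hR
      ⟨_, norm_volterraLinear_le P hP R q hq0 hq F⟩ y
  have hVnorm : ∀ F, ‖V F‖ ≤ ‖F‖ * q := fun F =>
    LinearMap.opNorm_extendOfNorm_le (e := (R : X →ₗ[ℂ] X)) hR (by positivity)
      (norm_volterraLinear_le P hP R q hq0 hq F)
  have hVsub : ∀ F H, V F - V H = V (F - H) := by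
    intro F H
    ext1 x
    refine hR.induction_on (p := fun x => (V F - V H) x = V (F - H) x) x
      (isClosed_eq (by fun_prop) (by fun_prop)) fun y => ?_
    rw [_root_.sub_apply, hVeq, hVeq, hVeq, volterraLinear_sub]
  have hcontr : ContractingWith ⟨q, hq0⟩ fun F => G + V F := by
    refine ⟨by exact_mod_cast hq1, LipschitzWith.of_dist_le_mul fun F H => ?_⟩
    rw [dist_add_left, dist_eq_norm, dist_eq_norm, hVsub, mul_comm]
    exact hVnorm _
  obtain ⟨F, hF⟩ : ∃ F, G + V F = F := ⟨_, hcontr.fixedPoint_isFixedPt⟩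
  have hFn : ‖F‖ ≤ ‖G‖ / (1 - q) := by
    rw [le_div_iff₀ (by linarith)]
    have := norm_add_le G (V F)
    rw [hF] at this
    linarith [hVnorm F]
  refine ⟨F, hFn, ?_, fun y t ht => ?_⟩
  · have : F - G = V F := by rw [sub_eq_iff_eq_add, add_comm]; exact hF.symm
    rw [this]
    exact (hVnorm F).trans (by rw [mul_comm]; gcongr)
  · conv_lhs => rw [← hF]
    simp [hVeq, volterraLinear, max_eq_left ht]

end Volterra

section Semigroup

variable [NormedAddCommGroup X] [NormedSpace ℂ X]

namespace IsC0Semigroup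

theorem apply_zero {T : ℝ → X →L[ℂ] X} (hT : IsC0Semigroup T) (x : X) : T 0 x = x := by
  simp [hT.1]

theorem apply_add {T : ℝ → X →L[ℂ] X} (hT : IsC0Semigroup T) {t s : ℝ} (ht : 0 ≤ t) (hs : 0 ≤ s)
    (x : X) : T (t + s) x = T t (T s x) := by
  rw [hT.2.1 t s ht hs]; rfl

theorem apply_comm {T : ℝ → X →L[ℂ] X} (hT : IsC0Semigroup T) {t s : ℝ} (ht : 0 ≤ t) (hs : 0 ≤ s)
    (x : X) : T t (T s x) = T s (T t x) := by
  rw [← hT.apply_add ht hs, ← hT.apply_add hs ht, add_comm]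

theorem continuous_orbit {T : ℝ → X →L[ℂ] X} (hT : IsC0Semigroup T) (x : X) :
    Continuous fun t => T (max t 0) x :=
  (hT.2.2 x).comp_continuous (by fun_prop) fun t => le_max_right t 0

theorem continuousOn_orbit {T : ℝ → X →L[ℂ] X} (hT : IsC0Semigroup T) (x : X) {s : Set ℝ}
    (hs : s ⊆ Ici 0) : ContinuousOn (fun t => T t x) s :=
  (hT.2.2 x).mono hs

theorem intervalIntegrable_orbit {T : ℝ → X →L[ℂ] X} (hT : IsC0Semigroup T) (x : X) {a b : ℝ}
    (ha : 0 ≤ a) (hb : 0 ≤ b) : IntervalIntegrable (fun t => T t x) volume a b :=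
  (hT.continuousOn_orbit x fun _ ht => (le_min ha hb).trans ht.1).intervalIntegrable

theorem tendsto_orbit_zero {T : ℝ → X →L[ℂ] X} (hT : IsC0Semigroup T) (x : X) :
    Tendsto (fun t => T t x) (𝓝[>] (0 : ℝ)) (𝓝 x) := by
  have h := (hT.2.2 x 0 self_mem_Ici).mono Ioi_subset_Ici_self
  have hlim := h.tendsto
  rwa [hT.apply_zero] at hlim

/-- The operators `T t` are uniformly bounded on compact time intervals. -/
theorem exists_bound_Icc [CompleteSpace X] {T : ℝ → X →L[ℂ] X} (hT : IsC0Semigroup T) (L : ℝ) :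
    ∃ K : ℝ, 0 ≤ K ∧ ∀ t ∈ Icc 0 L, ‖T t‖ ≤ K := by
  obtain ⟨K, hK⟩ := banach_steinhaus (g := fun t : Icc (0 : ℝ) L => T t) fun x => by
    obtain ⟨C, hC⟩ := isCompact_Icc.exists_bound_of_continuousOn
      (hT.continuousOn_orbit x (s := Icc 0 L) fun _ ht => ht.1)
    exact ⟨C, fun i => hC i i.2⟩
  exact ⟨max K 0, le_max_right _ _, fun t ht => (hK ⟨t, ht⟩).trans (le_max_left _ _)⟩

/-- Every strongly continuous semigroup is exponentially bounded. -/
theorem exists_exp_bound [CompleteSpace X] {T : ℝ → X →L[ℂ] X} (hT : IsC0Semigroup T) :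
    ∃ M w : ℝ, 1 ≤ M ∧ 0 ≤ w ∧ ∀ t, 0 ≤ t → ‖T t‖ ≤ M * Real.exp (w * t) := by
  obtain ⟨K, hK0, hK⟩ := hT.exists_bound_Icc 1
  set M := max K 1 with hM
  have hM1 : 1 ≤ M := le_max_right _ _
  have hM0 : 0 < M := by linarith
  have hMK : ∀ t ∈ Icc (0 : ℝ) 1, ‖T t‖ ≤ M := fun t ht => (hK t ht).trans (le_max_left _ _)
  have key : ∀ (n : ℕ) (r : ℝ), r ∈ Icc (0 : ℝ) 1 → ‖T (n + r)‖ ≤ M * M ^ n := by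
    intro n r hr
    induction n with
    | zero => simpa using hMK r hr
    | succ n ih =>
      have : ((n + 1 : ℕ) : ℝ) + r = 1 + (n + r) := by push_cast; ring
      rw [this, hT.2.1 1 (n + r) zero_le_one (by have := hr.1; positivity)]
      calc _ ≤ ‖T 1‖ * ‖T (n + r)‖ := ContinuousLinearMap.opNorm_comp_le _ _
        _ ≤ M * (M * M ^ n) := by gcongr; exact hMK 1 (by simp)
        _ = _ := by ring
  refine ⟨M, Real.log M, hM1, Real.log_nonneg hM1, fun t ht => ?_⟩
  have h := key ⌊t⌋₊ (t - ⌊t⌋₊)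
    ⟨by linarith [Nat.floor_le ht], by linarith [Nat.lt_floor_add_one t]⟩
  rw [add_sub_cancel] at h
  refine h.trans ?_
  gcongr
  rw [← Real.rpow_natCast, Real.rpow_def_of_pos hM0]
  have := Real.log_nonneg hM1
  gcongr
  exact Nat.floor_le ht

theorem exp_smul {T : ℝ → X →L[ℂ] X} (hT : IsC0Semigroup T) (c : ℝ) :
    IsC0Semigroup fun t => Real.exp (c * t) • T t := by
  refine ⟨by simp [hT.1], fun t s ht hs => ?_, fun x => ?_⟩
  · ext x
    simp only [FunLike.coe_smul, Pi.smul_apply, ContinuousLinearMap.comp_apply,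
      hT.apply_add ht hs, ContinuousLinearMap.map_smul_of_tower, smul_smul, ← Real.exp_add]
    ring_nf
  · simp only [FunLike.coe_smul, Pi.smul_apply]
    exact (by fun_prop : Continuous fun t : ℝ => Real.exp (c * t)).continuousOn.smul (hT.2.2 x)

theorem tendsto_exp_smul_slope {T : ℝ → X →L[ℂ] X} (hT : IsC0Semigroup T) (c : ℝ) {x z : X}
    (h : Tendsto (fun t : ℝ => t⁻¹ • (T t x - x)) (𝓝[>] (0 : ℝ)) (𝓝 z)) :
    Tendsto (fun t : ℝ => t⁻¹ • ((Real.exp (c * t) • T t) x - x)) (𝓝[>] (0 : ℝ))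
      (𝓝 (z + c • x)) := by
  have h1 : Tendsto (fun t : ℝ => t⁻¹ • (Real.exp (c * t) - 1)) (𝓝[>] (0 : ℝ)) (𝓝 c) := by
    have hd : HasDerivAt (fun t : ℝ => Real.exp (c * t)) c 0 := by
      simpa using ((hasDerivAt_id (0 : ℝ)).const_mul c).exp
    simpa using hd.tendsto_slope_zero_right
  have h2 : Tendsto (fun t : ℝ => t⁻¹ • (T t x - x) + (t⁻¹ • (Real.exp (c * t) - 1)) • T t x)
      (𝓝[>] (0 : ℝ)) (𝓝 (z + c • x)) := h.add (h1.smul (hT.tendsto_orbit_zero x))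
  refine h2.congr fun t => ?_
  simp only [FunLike.coe_smul, Pi.smul_apply, smul_eq_mul, mul_smul, sub_smul,
    one_smul, ← smul_add]
  congr 1
  abel

theorem tendsto_smul_integral [CompleteSpace X] {T : ℝ → X →L[ℂ] X} (hT : IsC0Semigroup T) (x : X) :
    Tendsto (fun t : ℝ => t⁻¹ • ∫ s in (0 : ℝ)..t, T s x) (𝓝[>] (0 : ℝ)) (𝓝 x) := by
  have hc : Continuous fun t : ℝ => ∫ u in (0 : ℝ)..1, T (max (t * u) 0) x := by
    apply intervalIntegral.continuous_parametric_intervalIntegral_of_continuous'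
    exact (hT.continuous_orbit x).comp (by fun_prop : Continuous fun p : ℝ × ℝ => p.1 * p.2)
  have h := (hc.tendsto 0).mono_left (nhdsWithin_le_nhds (s := Ioi 0))
  simp only [zero_mul, max_self, hT.apply_zero, intervalIntegral.integral_const, sub_zero,
    one_smul] at h
  refine h.congr' (eventually_mem_nhdsWithin.mono fun t ht => ?_)
  rw [mem_Ioi] at ht
  rw [eq_inv_smul_iff₀ ht.ne',
    intervalIntegral.smul_integral_comp_mul_left (fun s => T (max s 0) x) t, mul_zero, mul_one]
  refine intervalIntegral.integral_congr fun s hs => ?_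
  rw [uIcc_of_le ht.le] at hs
  simp [max_eq_left hs.1]

/-- An eigenvector of the generator is an eigenvector of the semigroup. -/
theorem apply_eq_exp_smul {T : ℝ → X →L[ℂ] X} (hT : IsC0Semigroup T) {w : X} {c : ℝ}
    (h : Tendsto (fun t : ℝ => t⁻¹ • (T t w - w)) (𝓝[>] (0 : ℝ)) (𝓝 (c • w))) {t : ℝ}
    (ht : 0 ≤ t) : T t w = Real.exp (c * t) • w := by
  have hS := hT.exp_smul (-c)
  have hs := hT.tendsto_exp_smul_slope (-c) h
  rw [neg_smul, add_neg_cancel] at hs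
  set S : ℝ → X →L[ℂ] X := fun t => Real.exp (-c * t) • T t with hSdef
  have hderiv : ∀ s ∈ Ico 0 t, HasDerivWithinAt (fun s => S s w) 0 (Ici s) s := by
    intro s hs'
    rw [← hasDerivWithinAt_Ioi_iff_Ici, hasDerivWithinAt_iff_tendsto_slope' (by simp)]
    have h1 : Tendsto (fun r : ℝ => r - s) (𝓝[>] s) (𝓝[>] 0) := by
      refine tendsto_nhdsWithin_of_tendsto_nhds_of_eventually_within _ ?_ ?_
      · have : Tendsto (fun r : ℝ => r - s) (𝓝 s) (𝓝 (s - s)) :=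
          (continuous_id.sub continuous_const).tendsto s
        rw [sub_self] at this
        exact this.mono_left nhdsWithin_le_nhds
      · exact eventually_mem_nhdsWithin.mono fun r hr => mem_Ioi.2 (sub_pos.2 hr)
    have h2 := ((S s).continuous.tendsto _).comp (hs.comp h1)
    rw [map_zero] at h2
    refine h2.congr' (eventually_mem_nhdsWithin.mono fun r hr => ?_)
    have hr' : 0 ≤ r - s := (sub_pos.2 hr).le
    have e := hS.apply_add hs'.1 hr' w
    rw [add_sub_cancel] at e
    simp only [Function.comp_apply, ContinuousLinearMap.map_smul_of_tower, map_sub,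
      slope_def_module]
    rw [← e]
  have := constant_of_has_deriv_right_zero (hS.continuousOn_orbit w fun _ hr => hr.1) hderiv t
    ⟨ht, le_rfl⟩
  rw [hS.apply_zero] at this
  rw [hSdef, FunLike.coe_smul, Pi.smul_apply] at this
  conv_rhs => rw [← this]
  simp [smul_smul, ← Real.exp_add]

end IsC0Semigroup

end Semigroup

section Perturbation

open BoundedContinuousFunction

variable [NormedAddCommGroup X] [NormedSpace ℂ X]

/-- A bounded operator family solving the homogeneous Volterra equation with contractive kernel
vanishes. -/
theorem eq_zero_of_volterra_homogeneous (P : ℝ → X →L[ℂ] X) (hP : ∀ y, Continuous fun s => P s y)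
    (R : X →L[ℂ] X) (hR : DenseRange R) {q : ℝ} (hq0 : 0 ≤ q) (hq1 : q < 1)
    (hq : ∀ y t, 0 ≤ t → (∫ s in (0 : ℝ)..t, ‖P s y‖) ≤ q * ‖R y‖)
    (H : ℝ → X →L[ℂ] X) {C : ℝ} (hC : ∀ s, 0 ≤ s → ‖H s‖ ≤ C)
    (hH : ∀ s, 0 ≤ s → ∀ y, H s (R y) = ∫ r in (0 : ℝ)..s, H (s - r) (P r y)) {s : ℝ}
    (hs : 0 ≤ s) : H s = 0 := by
  have hC0 : 0 ≤ C := (norm_nonneg _).trans (hC 0 le_rfl)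
  have step : ∀ n : ℕ, ∀ s, 0 ≤ s → ‖H s‖ ≤ q ^ n * C := by
    intro n
    induction n with
    | zero => simpa using hC
    | succ n ih =>
      intro s hs
      refine ContinuousLinearMap.opNorm_le_bound _ (by positivity) fun x => ?_
      refine hR.induction_on (p := fun x => ‖H s x‖ ≤ q ^ (n + 1) * C * ‖x‖) x
        (isClosed_le (by fun_prop) (by fun_prop)) fun y => ?_
      rw [hH s hs y]
      calc _ ≤ ∫ r in (0 : ℝ)..s, q ^ n * C * ‖P r y‖ := by
            refine intervalIntegral.norm_integral_le_of_norm_le hs (ae_of_all _ fun r hr => ?_)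
              ((continuous_const.mul (hP y).norm).intervalIntegrable _ _)
            exact (H (s - r)).le_of_opNorm_le (ih _ (by linarith [hr.2])) _
        _ = q ^ n * C * ∫ r in (0 : ℝ)..s, ‖P r y‖ := intervalIntegral.integral_const_mul _ _
        _ ≤ q ^ n * C * (q * ‖R y‖) := by gcongr; exact hq y s hs
        _ = _ := by ring
  have hlim : Tendsto (fun n : ℕ => q ^ n * C) atTop (𝓝 (0 * C)) :=
    (tendsto_pow_atTop_nhds_zero_of_lt_one hq0 hq1).mul_const C
  rw [zero_mul] at hlim
  exact norm_le_zero_iff.1 (ge_of_tendsto' hlim fun n => step n s hs)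

/-- If `R` is surjective onto the domain of a restriction of the generator of a bounded semigroup
and `c - C` maps the range of `R` onto `X` for some `c > 0`, then the range of `R` is the whole
domain of the generator `C`. -/
theorem mem_range_of_tendsto_slope {U : ℝ → X →L[ℂ] X} (hU : IsC0Semigroup U) {K : ℝ}
    (hK : ∀ t, 0 ≤ t → ‖U t‖ ≤ K) (R Q : X →L[ℂ] X)
    (hgen : ∀ y, Tendsto (fun t : ℝ => t⁻¹ • (U t (R y) - R y)) (𝓝[>] (0 : ℝ)) (𝓝 (Q y)))
    {c : ℝ} (hc : 0 < c) (hsurj : ∀ v, ∃ y, c • R y - Q y = v) {x z : X}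
    (h : Tendsto (fun t : ℝ => t⁻¹ • (U t x - x)) (𝓝[>] (0 : ℝ)) (𝓝 z)) :
    x ∈ Set.range R := by
  obtain ⟨y, hy⟩ := hsurj (c • x - z)
  refine ⟨y, ?_⟩
  have hw : Tendsto (fun t : ℝ => t⁻¹ • (U t (x - R y) - (x - R y))) (𝓝[>] (0 : ℝ))
      (𝓝 (c • (x - R y))) := by
    have e : c • (x - R y) = z - Q y := by
      rw [smul_sub]
      have : c • x = c • R y - Q y + z := by rw [hy]; abel
      rw [this]; abel
    rw [e]
    refine (h.sub (hgen y)).congr fun t => ?_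
    rw [← smul_sub, map_sub]
    congr 1
    abel
  have hexp := fun t (ht : 0 ≤ t) => hU.apply_eq_exp_smul hw ht
  by_contra hne
  have hpos : 0 < ‖x - R y‖ := norm_pos_iff.2 (sub_ne_zero.2 (Ne.symm hne))
  have hb : ∀ t, 0 ≤ t → Real.exp (c * t) ≤ K := by
    intro t ht
    have := (U t).le_of_opNorm_le (hK t ht) (x - R y)
    rw [hexp t ht, norm_smul, Real.norm_eq_abs, Real.abs_exp] at this
    exact le_of_mul_le_mul_right this hpos
  have h1 := hb (max K 0 / c) (by positivity)
  rw [mul_div_cancel₀ _ hc.ne'] at h1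
  linarith [Real.add_one_le_exp (max K 0), le_max_left K 0]

variable [CompleteSpace X]

/-- The Miyadera–Voigt perturbation theorem for a bounded semigroup `S` with boundedly invertible
generator `-R⁻¹` and perturbation `E R⁻¹`. -/
theorem exists_perturbed_semigroup {S : ℝ → X →L[ℂ] X} (hS : IsC0Semigroup S) {M : ℝ}
    (hM : ∀ t, 0 ≤ t → ‖S t‖ ≤ M) (R E : X →L[ℂ] X) (hR : DenseRange R)
    (hcomm : ∀ t, 0 ≤ t → ∀ y, S t (R y) = R (S t y))
    (hgen : ∀ y, Tendsto (fun t : ℝ => t⁻¹ • (S t (R y) - R y)) (𝓝[>] (0 : ℝ)) (𝓝 (-y)))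
    {q : ℝ} (hq0 : 0 ≤ q) (hq1 : q < 1) (hE : ‖E‖ ≤ q)
    (hq : ∀ y t, 0 ≤ t → (∫ s in (0 : ℝ)..t, ‖E (S s y)‖) ≤ q * ‖R y‖) :
    ∃ U : ℝ → X →L[ℂ] X, IsC0Semigroup U ∧ (∀ t, 0 ≤ t → ‖U t‖ ≤ M / (1 - q)) ∧
      (∀ t, 0 ≤ t → ‖U t - S t‖ ≤ q * (M / (1 - q))) ∧
      (∀ y, Tendsto (fun t : ℝ => t⁻¹ • (U t (R y) - R y)) (𝓝[>] (0 : ℝ)) (𝓝 (E y - y))) ∧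
      ∀ x z, Tendsto (fun t : ℝ => t⁻¹ • (U t x - x)) (𝓝[>] (0 : ℝ)) (𝓝 z) →
        x ∈ Set.range R := by
  have hM0 : 0 ≤ M := (norm_nonneg _).trans (hM 0 le_rfl)
  have h1q : 0 < 1 - q := by linarith
  set P : ℝ → X →L[ℂ] X := fun s => E ∘L S (max s 0) with hPdef
  have hP : ∀ y, Continuous fun s => P s y := fun y => E.continuous.comp (hS.continuous_orbit y)
  have hPeq : ∀ s, 0 ≤ s → ∀ y, P s y = E (S s y) := fun s hs y => by
    simp [hPdef, max_eq_left hs]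
  have hPq : ∀ y t, 0 ≤ t → (∫ s in (0 : ℝ)..t, ‖P s y‖) ≤ q * ‖R y‖ := by
    intro y t ht
    rw [intervalIntegral.integral_congr (g := fun s => ‖E (S s y)‖)]
    · exact hq y t ht
    · intro s hs
      rw [uIcc_of_le ht] at hs
      simp only [hPeq s hs.1]
  have hGb : ∀ x t, ‖S (max t 0) x‖ ≤ M * ‖x‖ := fun x t =>
    (S _).le_of_opNorm_le (hM _ (le_max_right _ _)) x
  let G₀ : X →ₗ[ℂ] (ℝ →ᵇ X) :=
    { toFun := fun x => BoundedContinuousFunction.ofNormedAddCommGroup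
        (fun t => S (max t 0) x) (hS.continuous_orbit x) (M * ‖x‖) (hGb x)
      map_add' := fun x y => by ext t; simp
      map_smul' := fun c x => by ext t; simp }
  have hG₀ : ∀ x, ‖G₀ x‖ ≤ M * ‖x‖ := fun x => by
    rw [BoundedContinuousFunction.norm_le (by positivity)]
    exact hGb x
  set G : X →L[ℂ] (ℝ →ᵇ X) := G₀.mkContinuous M hG₀ with hGdef
  have hGeq : ∀ x t, 0 ≤ t → G x t = S t x := fun x t ht => by
    simp [hGdef, G₀, max_eq_left ht]
  have hGnorm : ‖G‖ ≤ M := LinearMap.mkContinuous_norm_le _ hM0 _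
  obtain ⟨F, hF1, hF2, hF3⟩ := exists_volterra_fixedPoint P hP R hR q hq0 hq1 hPq G
  obtain ⟨U, hUF⟩ : ∃ U : ℝ → X →L[ℂ] X, ∀ t x, U t x = F x t :=
    ⟨fun t => (BoundedContinuousFunction.evalCLM ℂ t).comp F, fun _ _ => rfl⟩
  have hUc : ∀ x, Continuous fun t => U t x := fun x => by
    simpa only [hUF] using (F x).continuous
  have hU : ∀ y t, 0 ≤ t → U t (R y) = S t (R y) + ∫ s in (0 : ℝ)..t, U (t - s) (P s y) := by
    intro y t ht
    simp only [hUF, hF3 y t ht, hGeq _ t ht]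
  have hUsec : ∀ y t, Continuous fun s => U (t - s) (P s y) := fun y t => by
    simpa only [hUF] using continuous_volterra_section P hP F y t
  have hUint : ∀ y t a b, IntervalIntegrable (fun s => U (t - s) (P s y)) volume a b :=
    fun y t a b => by
      simpa only [hUF] using (continuous_volterra_section P hP F y t).intervalIntegrable a b
  have hUn : ∀ t, ‖U t‖ ≤ M / (1 - q) := fun t =>
    ContinuousLinearMap.opNorm_le_bound _ (by positivity) fun x => (hUF t x).symm ▸
      ((F x).norm_coe_le_norm t).trans (F.le_of_opNorm_le (hF1.trans (by gcongr)) x)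
  have hUS : ∀ t, 0 ≤ t → ‖U t - S t‖ ≤ q * (M / (1 - q)) := fun t ht =>
    ContinuousLinearMap.opNorm_le_bound _ (by positivity) fun x => by
      have hFG : ‖F - G‖ ≤ q * (M / (1 - q)) := hF2.trans (by gcongr)
      have h := (((F - G) x).norm_coe_le_norm t).trans ((F - G).le_of_opNorm_le hFG x)
      rwa [_root_.sub_apply, BoundedContinuousFunction.sub_apply, hGeq x t ht, ← hUF,
        ← _root_.sub_apply] at h
  have hU0 : ∀ x, U 0 x = x := fun x =>
    hR.induction_on (p := fun x => U 0 x = x) x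
      (isClosed_eq (by fun_prop) (by fun_prop)) fun y => by
        rw [hU y 0 le_rfl, intervalIntegral.integral_same, add_zero, hS.apply_zero]
  have hUadd : ∀ t s, 0 ≤ t → 0 ≤ s → U (t + s) = (U t).comp (U s) := by
    intro t s ht hs
    rw [← sub_eq_zero]
    refine eq_zero_of_volterra_homogeneous P hP R hR hq0 hq1 hPq
      (fun s => U (t + s) - (U t).comp (U s))
      (C := M / (1 - q) + M / (1 - q) * (M / (1 - q))) (fun s _ => ?_) (fun s hs y => ?_) hs
    · refine (norm_sub_le _ _).trans (add_le_add (hUn _) ?_)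
      refine (ContinuousLinearMap.opNorm_comp_le _ _).trans ?_
      gcongr
      exacts [hUn _, hUn _]
    · have hUU : ∀ y s, IntervalIntegrable (fun r => U t (U (s - r) (P r y))) volume 0 s :=
        fun y s => ((U t).continuous.comp (hUsec y s)).intervalIntegrable _ _
      have e1 : U (t + s) (R y) = (∫ r in (0 : ℝ)..s, U (t + s - r) (P r y)) +
          U t (S s (R y)) := by
        rw [hU y _ (by positivity), hcomm s hs, hU (S s y) t ht,
          ← intervalIntegral.integral_add_adjacent_intervals (hUint y (t + s) 0 s)
            (hUint y (t + s) s (t + s))]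
        have e2 : ∫ r in (0 : ℝ)..t, U (t - r) (P r (S s y)) =
            ∫ r in s..(t + s), U (t + s - r) (P r y) := by
          have e := intervalIntegral.integral_comp_add_right (a := 0) (b := t)
            (fun r => U (t + s - r) (P r y)) s
          rw [zero_add] at e
          rw [← e]
          refine intervalIntegral.integral_congr fun r hr => ?_
          rw [uIcc_of_le ht] at hr
          simp only [hPeq _ hr.1, hPeq _ (add_nonneg hr.1 hs), hS.apply_add hr.1 hs,
            add_sub_add_right_eq_sub]
        rw [e2, hS.apply_add ht hs, hcomm s hs]
        abel
      have e3 : U t (U s (R y)) = U t (S s (R y)) +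
          ∫ r in (0 : ℝ)..s, U t (U (s - r) (P r y)) := by
        rw [hU y s hs, map_add, ContinuousLinearMap.intervalIntegral_comp_comm _ (hUint y s 0 s)]
      rw [_root_.sub_apply, ContinuousLinearMap.comp_apply, e1, e3, add_comm,
        add_sub_add_left_eq_sub,
        ← intervalIntegral.integral_sub (hUint y (t + s) 0 s)
          (hUU y s)]
      refine intervalIntegral.integral_congr fun r _ => ?_
      simp only [_root_.sub_apply, ContinuousLinearMap.comp_apply, add_sub_assoc]
  have hUsg : IsC0Semigroup U :=
    ⟨ContinuousLinearMap.ext hU0, hUadd, fun x => (hUc x).continuousOn⟩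
  have hUgen : ∀ y, Tendsto (fun t : ℝ => t⁻¹ • (U t (R y) - R y)) (𝓝[>] (0 : ℝ))
      (𝓝 (E y - y)) := by
    intro y
    have hc : Continuous fun t : ℝ => ∫ u in (0 : ℝ)..1, U (t - t * u) (P (t * u) y) := by
      apply intervalIntegral.continuous_parametric_intervalIntegral_of_continuous'
      have := (continuous_volterra_integrand P hP F y).comp
        (by fun_prop : Continuous fun p : ℝ × ℝ => (p.1, p.1 * p.2))
      simp only [hUF]
      exact this
    have h := (hc.tendsto 0).mono_left (nhdsWithin_le_nhds (s := Ioi 0))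
    simp only [zero_mul, sub_zero, hU0, hPeq 0 le_rfl, hS.apply_zero,
      intervalIntegral.integral_const, one_smul] at h
    have h2 := h.add (hgen y)
    rw [← sub_eq_add_neg] at h2
    refine h2.congr' (eventually_mem_nhdsWithin.mono fun t ht => ?_)
    rw [mem_Ioi] at ht
    beta_reduce
    rw [hU y t ht.le, add_sub_right_comm, smul_add, add_comm, add_right_inj,
      eq_inv_smul_iff₀ ht.ne',
      intervalIntegral.smul_integral_comp_mul_left (fun s => U (t - s) (P s y)) t, mul_zero,
      mul_one]
  refine ⟨U, hUsg, fun t _ => hUn t, hUS, hUgen, fun x z hxz => ?_⟩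
  obtain ⟨c, hc, hcR⟩ : ∃ c : ℝ, 0 < c ∧ c * ‖R‖ + q < 1 := by
    refine ⟨(1 - q) / (2 * (‖R‖ + 1)), by positivity, ?_⟩
    have : (1 - q) / (2 * (‖R‖ + 1)) * ‖R‖ ≤ (1 - q) / 2 := by
      rw [div_mul_eq_mul_div, div_le_div_iff₀ (by positivity) (by positivity)]
      nlinarith [norm_nonneg R]
    linarith
  refine mem_range_of_tendsto_slope hUsg (fun t _ => hUn t) R (E - 1) hUgen hc (fun v => ?_) hxz
  have hlt : ‖E - c • R‖ < 1 := by
    refine (norm_sub_le _ _).trans_lt ?_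
    rw [norm_smul, Real.norm_of_nonneg hc.le]
    linarith
  let u := Units.oneSub (E - c • R) hlt
  refine ⟨(↑u⁻¹ : X →L[ℂ] X) v, ?_⟩
  have h := congrArg (fun W : X →L[ℂ] X => W v) u.mul_inv
  simp only [u, Units.val_oneSub, mul_apply_eq_comp, one_apply_eq_self,
    _root_.sub_apply, FunLike.coe_smul, Pi.smul_apply] at h ⊢
  conv_rhs => rw [← h]
  abel

end Perturbation

section Generation

variable [NormedAddCommGroup X] [NormedSpace ℂ X]

/-- The generator of an exponentially stable semigroup has a bounded inverse `-R`, where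
`R = ∫₀^∞ S(s) ds`. -/
theorem exists_inverse_generator [CompleteSpace X] {S : ℝ → X →L[ℂ] X} (hS : IsC0Semigroup S)
    {M : ℝ} (hM : ∀ t, 0 ≤ t → ‖S t‖ ≤ M * Real.exp (-t)) :
    ∃ R : X →L[ℂ] X, DenseRange R ∧ (∀ t, 0 ≤ t → ∀ y, S t (R y) = R (S t y)) ∧
      (∀ y, Tendsto (fun t : ℝ => ∫ s in (0 : ℝ)..t, S s y) atTop (𝓝 (R y))) ∧
      (∀ y, Tendsto (fun t : ℝ => t⁻¹ • (S t (R y) - R y)) (𝓝[>] (0 : ℝ)) (𝓝 (-y))) ∧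
      ∀ x z, Tendsto (fun t : ℝ => t⁻¹ • (S t x - x)) (𝓝[>] (0 : ℝ)) (𝓝 z) → R (-z) = x := by
  have hbound : ∀ y s, 0 ≤ s → ‖S s y‖ ≤ Real.exp (-s) * (M * ‖y‖) := fun y s hs =>
    ((S s).le_of_opNorm_le (hM s hs) y).trans (le_of_eq (by ring))
  have hexp : ∀ y : X, IntegrableOn (fun s : ℝ => Real.exp (-s) * (M * ‖y‖)) (Ioi 0) := fun y =>
    (integrableOn_exp_neg_Ioi 0).mul_const _
  have hint : ∀ y, IntegrableOn (fun s => S s y) (Ioi 0) := fun y =>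
    (hexp y).mono' ((hS.continuousOn_orbit y Ioi_subset_Ici_self).aestronglyMeasurable
      measurableSet_Ioi) ((ae_restrict_mem measurableSet_Ioi).mono fun s hs =>
        hbound y s (le_of_lt hs))
  let R₀ : X →ₗ[ℂ] X :=
    { toFun := fun y => ∫ s in Ioi (0 : ℝ), S s y
      map_add' := fun y z => by
        simp only [map_add]
        exact integral_add (hint y) (hint z)
      map_smul' := fun c y => by
        simp only [map_smul, RingHom.id_apply]
        exact integral_smul _ _ }
  have hR₀ : ∀ y, ‖R₀ y‖ ≤ M * ‖y‖ := fun y => by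
    refine (norm_integral_le_of_norm_le (hexp y) ((ae_restrict_mem measurableSet_Ioi).mono
      fun s hs => hbound y s (le_of_lt hs))).trans (le_of_eq ?_)
    rw [integral_mul_const, integral_exp_neg_Ioi_zero, one_mul]
  obtain ⟨R, hR⟩ : ∃ R : X →L[ℂ] X, ∀ y, R y = ∫ s in Ioi (0 : ℝ), S s y :=
    ⟨R₀.mkContinuous M hR₀, fun y => rfl⟩
  have hlim : ∀ y, Tendsto (fun t : ℝ => ∫ s in (0 : ℝ)..t, S s y) atTop (𝓝 (R y)) := fun y => by
    rw [hR]
    exact intervalIntegral_tendsto_integral_Ioi 0 (hint y) tendsto_id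
  have hcomm : ∀ t, 0 ≤ t → ∀ y, S t (R y) = R (S t y) := fun t ht y => by
    rw [hR, hR, ← ContinuousLinearMap.integral_comp_comm _ (hint y)]
    exact setIntegral_congr_fun measurableSet_Ioi fun s hs => hS.apply_comm ht (le_of_lt hs) y
  have hdiff : ∀ t, 0 ≤ t → ∀ y, S t (R y) - R y = -∫ s in (0 : ℝ)..t, S s y := by
    intro t ht y
    have h1 := ((S t).continuous.tendsto _).comp (hlim y)
    have h2 := ((hlim y).comp (tendsto_atTop_add_const_right atTop t tendsto_id)).sub_const
      (∫ s in (0 : ℝ)..t, S s y)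
    have h3 := tendsto_nhds_unique (h1.congr' ?_) h2
    · rw [h3]; abel
    · filter_upwards [eventually_ge_atTop 0] with a ha
      have e := intervalIntegral.integral_comp_add_right (a := 0) (b := a) (fun s => S s y) t
      rw [zero_add] at e
      simp only [Function.comp_apply, id]
      rw [← ContinuousLinearMap.intervalIntegral_comp_comm _
        (hS.intervalIntegrable_orbit y le_rfl ha), eq_sub_iff_add_eq',
        ← intervalIntegral.integral_add_adjacent_intervals
          (hS.intervalIntegrable_orbit y le_rfl ht)
          (hS.intervalIntegrable_orbit y ht (add_nonneg ha ht)), ← e]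
      congr 1
      refine intervalIntegral.integral_congr fun s hs => ?_
      rw [uIcc_of_le ha] at hs
      simp only [add_comm s t, hS.apply_add ht hs.1]
  have hgen : ∀ y, Tendsto (fun t : ℝ => t⁻¹ • (S t (R y) - R y)) (𝓝[>] (0 : ℝ)) (𝓝 (-y)) := by
    intro y
    refine (hS.tendsto_smul_integral y).neg.congr' (eventually_mem_nhdsWithin.mono fun t ht => ?_)
    beta_reduce
    rw [hdiff t (le_of_lt ht), smul_neg]
  have hinv : ∀ x z, Tendsto (fun t : ℝ => t⁻¹ • (S t x - x)) (𝓝[>] (0 : ℝ)) (𝓝 z) →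
      R (-z) = x := by
    intro x z hz
    have h1 := (R.continuous.tendsto _).comp hz
    have h2 := tendsto_nhds_unique (h1.congr' (eventually_mem_nhdsWithin.mono fun t ht => ?_))
      (hgen x)
    · rw [map_neg, h2, neg_neg]
    · simp only [Function.comp_apply, ContinuousLinearMap.map_smul_of_tower, map_sub,
        hcomm t (le_of_lt ht)]
  refine ⟨R, fun y => ?_, hcomm, hlim, hgen, hinv⟩
  refine mem_closure_of_tendsto (hS.tendsto_smul_integral y)
    (eventually_mem_nhdsWithin.mono fun t ht => ?_)
  refine ⟨t⁻¹ • (y - S t y), ?_⟩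
  rw [ContinuousLinearMap.map_smul_of_tower, map_sub, ← hcomm t (le_of_lt ht), ← neg_sub,
    hdiff t (le_of_lt ht), neg_neg]

/-- A uniform bound over one period of length `t₀`, applied along an exponentially decaying
orbit, gives a bound on every time interval. -/
theorem integral_norm_orbit_le {S : ℝ → X →L[ℂ] X} (hS : IsC0Semigroup S) {M : ℝ}
    (hM : ∀ t, 0 ≤ t → ‖S t‖ ≤ M * Real.exp (-t)) (R E : X →L[ℂ] X)
    (hcomm : ∀ t, 0 ≤ t → ∀ y, S t (R y) = R (S t y)) {q t₀ : ℝ} (hq : 0 ≤ q) (ht₀ : 0 < t₀)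
    (h : ∀ y, (∫ s in (0 : ℝ)..t₀, ‖E (S s y)‖) ≤ q * ‖R y‖) (y : X) {t : ℝ} (ht : 0 ≤ t) :
    (∫ s in (0 : ℝ)..t, ‖E (S s y)‖) ≤ q * (M / (1 - Real.exp (-t₀))) * ‖R y‖ := by
  have hM0 : 0 ≤ M := by simpa using (norm_nonneg _).trans (hM 0 le_rfl)
  set ρ := Real.exp (-t₀) with hρ
  have hρ0 : 0 < ρ := Real.exp_pos _
  have hρ1 : 0 < 1 - ρ := sub_pos.2 (Real.exp_lt_one_iff.2 (by linarith))
  have hii : ∀ a b : ℝ, 0 ≤ a → 0 ≤ b →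
      IntervalIntegrable (fun s => ‖E (S s y)‖) volume a b := fun a b ha hb =>
    (E.continuous.comp_continuousOn
      (hS.continuousOn_orbit y fun _ hs => (le_min ha hb).trans hs.1)).norm.intervalIntegrable
  have key : ∀ n : ℕ, (∫ s in (0 : ℝ)..n * t₀, ‖E (S s y)‖) ≤
      q * (M * ((1 - ρ ^ n) / (1 - ρ))) * ‖R y‖ := by
    intro n
    induction n with
    | zero => simp
    | succ n ih =>
      have hn : 0 ≤ (n : ℝ) * t₀ := by positivity
      have e : (((n + 1 : ℕ) : ℝ)) * t₀ = t₀ + n * t₀ := by push_cast; ring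
      rw [e, ← intervalIntegral.integral_add_adjacent_intervals (hii _ _ le_rfl hn)
        (hii _ _ hn (by positivity))]
      have e2 := intervalIntegral.integral_comp_add_right (a := 0) (b := t₀)
        (fun s => ‖E (S s y)‖) (n * t₀)
      rw [zero_add] at e2
      have e3 : ∫ s in (0 : ℝ)..t₀, ‖E (S (s + n * t₀) y)‖ =
          ∫ s in (0 : ℝ)..t₀, ‖E (S s (S (n * t₀) y))‖ := by
        refine intervalIntegral.integral_congr fun s hs => ?_
        rw [uIcc_of_le ht₀.le] at hs
        simp only [hS.apply_add hs.1 hn]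
      have e4 : ‖R (S (n * t₀) y)‖ ≤ M * ρ ^ n * ‖R y‖ := by
        rw [← hcomm _ hn]
        refine (S _).le_of_opNorm_le ((hM _ hn).trans (le_of_eq ?_)) _
        rw [hρ, ← Real.exp_nat_mul]
        ring_nf
      rw [← e2, e3]
      calc _ ≤ q * (M * ((1 - ρ ^ n) / (1 - ρ))) * ‖R y‖ + q * (M * ρ ^ n * ‖R y‖) :=
            add_le_add ih ((h _).trans (by gcongr))
        _ = _ := by field_simp; ring
  obtain ⟨n, hn⟩ := exists_nat_ge (t / t₀)
  rw [div_le_iff₀ ht₀] at hn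
  calc (∫ s in (0 : ℝ)..t, ‖E (S s y)‖) ≤ ∫ s in (0 : ℝ)..n * t₀, ‖E (S s y)‖ :=
        intervalIntegral.integral_mono_interval le_rfl ht hn
          (ae_of_all _ fun _ => norm_nonneg _) (hii _ _ le_rfl (ht.trans hn))
    _ ≤ _ := key n
    _ ≤ _ := by
      rw [mul_div_assoc']
      have : M * (1 - ρ ^ n) ≤ M := mul_le_of_le_one_right hM0 (by linarith [pow_pos hρ0 n])
      gcongr

/-- The Miyadera–Voigt perturbation theorem, with a bound on the difference of the semigroups
that is proportional to the Miyadera–Voigt constant. -/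
theorem miyadera_voigt [CompleteSpace X] {T : ℝ → X →L[ℂ] X} (hT : IsC0Semigroup T)
    {domA : Set X} {A : X → X} (hA : IsGenerator T domA A) {t₀ : ℝ} (ht₀ : 0 < t₀) :
    ∃ K w q₀ : ℝ, 0 ≤ K ∧ 0 ≤ w ∧ 0 < q₀ ∧ ∀ q, 0 ≤ q → q ≤ q₀ → ∀ D : X → X,
      IsGraphBoundedOp domA A D →
      (∀ x ∈ domA, (∫ s in (0 : ℝ)..t₀, ‖D (T s x)‖) ≤ q * ‖x‖) →
      ∃ TD : ℝ → X →L[ℂ] X, IsC0Semigroup TD ∧ IsGenerator TD domA (fun x => A x + D x) ∧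
        ∀ t, 0 ≤ t → ‖TD t - T t‖ ≤ q * K * Real.exp (w * t) := by
  obtain ⟨M, w, hM1, hw, hTM⟩ := hT.exists_exp_bound
  set c := w + 1 with hc
  have hc0 : 0 ≤ c := by positivity
  obtain ⟨S, hSdef⟩ : ∃ S : ℝ → X →L[ℂ] X, S = fun t => Real.exp (-c * t) • T t := ⟨_, rfl⟩
  have hS : IsC0Semigroup S := hSdef ▸ hT.exp_smul (-c)
  have hTS : T = fun t => Real.exp (c * t) • S t := by
    funext t
    simp [hSdef, smul_smul, ← Real.exp_add]
  have hSM : ∀ t, 0 ≤ t → ‖S t‖ ≤ M * Real.exp (-t) := fun t ht => by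
    rw [hSdef, norm_smul, Real.norm_eq_abs, Real.abs_exp]
    calc _ ≤ Real.exp (-c * t) * (M * Real.exp (w * t)) := by gcongr; exact hTM t ht
      _ = M * Real.exp (-c * t + w * t) := by rw [Real.exp_add]; ring
      _ = _ := by rw [hc]; ring_nf
  have hSM' : ∀ t, 0 ≤ t → ‖S t‖ ≤ M := fun t ht => (hSM t ht).trans
    (mul_le_of_le_one_right (by linarith) (Real.exp_le_one_iff.2 (by linarith)))
  obtain ⟨R, hRd, hcomm, hlim, hgen, hinv⟩ := exists_inverse_generator hS hSM
  have hgenT : ∀ y, Tendsto (fun t : ℝ => t⁻¹ • (T t (R y) - R y)) (𝓝[>] (0 : ℝ))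
      (𝓝 (-y + c • R y)) := fun y => by
    rw [hTS]
    exact hS.tendsto_exp_smul_slope c (hgen y)
  have hRdom : ∀ y, R y ∈ domA := fun y => (hA.1 _).2 ⟨_, hgenT y⟩
  have hAR : ∀ y, A (R y) = -y + c • R y := fun y =>
    tendsto_nhds_unique (hA.2 _ (hRdom y)) (hgenT y)
  have hdomR : ∀ x ∈ domA, x ∈ Set.range R := fun x hx => by
    have h := hT.tendsto_exp_smul_slope (-c) (hA.2 x hx)
    exact ⟨_, hinv x _ (by rw [hSdef]; exact h)⟩
  have hρ1 : 0 < 1 - Real.exp (-t₀) := sub_pos.2 (Real.exp_lt_one_iff.2 (by linarith))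
  set N := M / (1 - Real.exp (-t₀)) with hN
  have hN0 : 0 < N := by positivity
  refine ⟨2 * M * N, c, 1 / (2 * N), by positivity, hc0, by positivity, ?_⟩
  intro q hq0 hq1 D hD hDq
  have hqN : q * N ≤ 1 / 2 := by
    rw [le_div_iff₀ (by positivity)] at hq1
    linarith
  have hqN0 : 0 ≤ q * N := by positivity
  let E₀ : X →ₗ[ℂ] X :=
    { toFun := fun y => D (R y)
      map_add' := fun y z => by rw [map_add, hD.1 _ (hRdom y) _ (hRdom z)]
      map_smul' := fun a y => by rw [map_smul, hD.2.1 a _ (hRdom y), RingHom.id_apply] }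
  have hE₀ : ∃ C, ∀ y, ‖E₀ y‖ ≤ C * ‖y‖ := by
    obtain ⟨C, hC⟩ := hD.2.2
    refine ⟨|C| * (‖R‖ + (1 + c * ‖R‖)), fun y => ?_⟩
    have h1 : ‖A (R y)‖ ≤ ‖y‖ + c * (‖R‖ * ‖y‖) := by
      rw [hAR]
      refine (norm_add_le _ _).trans ?_
      rw [norm_neg, norm_smul, Real.norm_of_nonneg hc0]
      gcongr
      exact R.le_opNorm y
    calc ‖E₀ y‖ ≤ C * (‖R y‖ + ‖A (R y)‖) := hC _ (hRdom y)
      _ ≤ |C| * (‖R‖ * ‖y‖ + (‖y‖ + c * (‖R‖ * ‖y‖))) := by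
        gcongr
        exacts [le_abs_self C, R.le_opNorm y]
      _ = _ := by ring
  obtain ⟨E, hER⟩ : ∃ E : X →L[ℂ] X, ∀ y, E y = D (R y) :=
    ⟨E₀.mkContinuousOfExistsBound hE₀, fun y => rfl⟩
  have hperiod : ∀ y, (∫ s in (0 : ℝ)..t₀, ‖E (S s y)‖) ≤ q * ‖R y‖ := by
    intro y
    have hcE : ContinuousOn (fun s => ‖E (S s y)‖) (uIcc 0 t₀) :=
      (E.continuous.comp_continuousOn (hS.continuousOn_orbit y fun s hs => by
        rw [uIcc_of_le ht₀.le] at hs; exact hs.1)).norm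
    have e : ∫ s in (0 : ℝ)..t₀, ‖D (T s (R y))‖ =
        ∫ s in (0 : ℝ)..t₀, Real.exp (c * s) * ‖E (S s y)‖ := by
      refine intervalIntegral.integral_congr fun s hs => ?_
      rw [uIcc_of_le ht₀.le] at hs
      have : T s (R y) = R (Real.exp (c * s) • S s y) := by
        rw [hTS, ContinuousLinearMap.map_smul_of_tower, ← hcomm s hs.1]
        rfl
      rw [this, ← hER, ContinuousLinearMap.map_smul_of_tower, norm_smul, Real.norm_eq_abs,
        Real.abs_exp]
    refine le_trans ?_ (hDq (R y) (hRdom y))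
    rw [e]
    refine intervalIntegral.integral_mono_on ht₀.le hcE.intervalIntegrable
      (ContinuousOn.intervalIntegrable ((by fun_prop :
        Continuous fun s : ℝ => Real.exp (c * s)).continuousOn.mul hcE)) fun s hs => ?_
    exact le_mul_of_one_le_left (norm_nonneg _)
      (Real.one_le_exp (mul_nonneg hc0 hs.1))
  have hall : ∀ y t, 0 ≤ t → (∫ s in (0 : ℝ)..t, ‖E (S s y)‖) ≤ q * N * ‖R y‖ := fun y t ht =>
    integral_norm_orbit_le hS hSM R E hcomm hq0 ht₀ hperiod y ht
  have hEnorm : ‖E‖ ≤ q * N := by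
    refine ContinuousLinearMap.opNorm_le_bound _ hqN0 fun x => ?_
    refine hRd.induction_on (p := fun x => ‖E x‖ ≤ q * N * ‖x‖) x
      (isClosed_le (by fun_prop) (by fun_prop)) fun y => ?_
    refine le_of_tendsto ((E.continuous.tendsto _).comp (hlim y)).norm ?_
    filter_upwards [eventually_ge_atTop 0] with a ha
    rw [Function.comp_apply, ← ContinuousLinearMap.intervalIntegral_comp_comm _
      (hS.intervalIntegrable_orbit y le_rfl ha)]
    exact (intervalIntegral.norm_integral_le_integral_norm ha).trans (hall y a ha)
  obtain ⟨U, hU, -, hUS, hUgen, hUdom⟩ := exists_perturbed_semigroup hS hSM' R E hRd hcomm hgen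
    hqN0 (by linarith) hEnorm hall
  have hgenTD : ∀ y, Tendsto (fun t : ℝ => t⁻¹ • ((Real.exp (c * t) • U t) (R y) - R y))
      (𝓝[>] (0 : ℝ)) (𝓝 (A (R y) + D (R y))) := fun y => by
    have h := hU.tendsto_exp_smul_slope c (hUgen y)
    have e : E y - y + c • R y = A (R y) + D (R y) := by rw [hAR, hER]; abel
    rwa [e] at h
  have hTD := hU.exp_smul c
  refine ⟨fun t => Real.exp (c * t) • U t, hTD, ⟨fun x => ⟨fun hx => ?_, ?_⟩, fun x hx => ?_⟩,
    fun t ht => ?_⟩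
  · obtain ⟨y, rfl⟩ := hdomR x hx
    exact ⟨_, hgenTD y⟩
  · rintro ⟨z, hz⟩
    have h := hTD.tendsto_exp_smul_slope (-c) hz
    have e : ∀ t, Real.exp (-c * t) • Real.exp (c * t) • U t = U t := fun t => by
      simp [smul_smul, ← Real.exp_add]
    simp only [e] at h
    obtain ⟨y, rfl⟩ := hUdom x _ h
    exact hRdom y
  · obtain ⟨y, rfl⟩ := hdomR x hx
    exact hgenTD y
  · have hM2 : M / (1 - q * N) ≤ 2 * M := by
      rw [div_le_iff₀ (by linarith)]
      nlinarith
    have e : T t = Real.exp (c * t) • S t := congrFun hTS t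
    rw [e, ← smul_sub, norm_smul, Real.norm_eq_abs, Real.abs_exp, mul_comm]
    gcongr
    refine (hUS t ht).trans ?_
    calc q * N * (M / (1 - q * N)) ≤ q * N * (2 * M) := by gcongr
      _ = _ := by ring

end Generation

section SampledData

variable [NormedAddCommGroup X] [NormedSpace ℂ X]

/-- The operator that maps the state at a sampling instant to the state of the sampled-data
system after time `t`. -/
theorem IsC0Semigroup.exists_sdOp [CompleteSpace X] {T : ℝ → X →L[ℂ] X} (hT : IsC0Semigroup T)
    (B : X →L[ℂ] X) :
    ∃ P : ℝ → X →L[ℂ] X, ∀ t, 0 ≤ t → ∀ x, P t x = T t x + ∫ s in (0 : ℝ)..t, T s (B x) := by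
  have h : ∀ t : ℝ, ∃ P : X →L[ℂ] X, 0 ≤ t →
      ∀ x, P x = T t x + ∫ s in (0 : ℝ)..t, T s (B x) := by
    intro t
    by_cases ht : 0 ≤ t
    · obtain ⟨K, hK0, hK⟩ := hT.exists_bound_Icc t
      let P₀ : X →ₗ[ℂ] X :=
        { toFun := fun x => T t x + ∫ s in (0 : ℝ)..t, T s (B x)
          map_add' := fun x y => by
            simp only [map_add]
            rw [intervalIntegral.integral_add (hT.intervalIntegrable_orbit _ le_rfl ht)
              (hT.intervalIntegrable_orbit _ le_rfl ht)]
            abel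
          map_smul' := fun c x => by
            simp only [map_smul, RingHom.id_apply, smul_add]
            rw [intervalIntegral.integral_smul] }
      have hP₀ : ∀ x, ‖P₀ x‖ ≤ (K + K * ‖B‖ * t) * ‖x‖ := fun x => by
        have h1 : ‖T t x‖ ≤ K * ‖x‖ := (T t).le_of_opNorm_le (hK t ⟨ht, le_rfl⟩) x
        have h2 : ‖∫ s in (0 : ℝ)..t, T s (B x)‖ ≤ K * (‖B‖ * ‖x‖) * |t - 0| := by
          refine intervalIntegral.norm_integral_le_of_norm_le_const fun s hs => ?_
          rw [uIoc_of_le ht] at hs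
          exact (T s).le_of_opNorm_le_of_le (hK s ⟨hs.1.le, hs.2⟩) (B.le_opNorm x)
        rw [sub_zero, abs_of_nonneg ht] at h2
        calc ‖P₀ x‖ ≤ _ := norm_add_le _ _
          _ ≤ K * ‖x‖ + K * (‖B‖ * ‖x‖) * t := add_le_add h1 h2
          _ = _ := by ring
      exact ⟨P₀.mkContinuous _ hP₀, fun _ x => rfl⟩
    · exact ⟨0, fun h => absurd h ht⟩
  choose P hP using h
  exact ⟨P, hP⟩

theorem norm_sdOp_sub_le {T S P Q : ℝ → X →L[ℂ] X} (hT : IsC0Semigroup T) (hS : IsC0Semigroup S)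
    {B : X →L[ℂ] X} (hP : ∀ t, 0 ≤ t → ∀ x, P t x = T t x + ∫ s in (0 : ℝ)..t, T s (B x))
    (hQ : ∀ t, 0 ≤ t → ∀ x, Q t x = S t x + ∫ s in (0 : ℝ)..t, S s (B x)) {τ δ : ℝ}
    (hδ : ∀ t ∈ Icc 0 τ, ‖S t - T t‖ ≤ δ) {t : ℝ} (ht : t ∈ Icc 0 τ) :
    ‖Q t - P t‖ ≤ δ * (1 + τ * ‖B‖) := by
  have hδ0 : 0 ≤ δ := (norm_nonneg _).trans (hδ t ht)
  have hτ : 0 ≤ τ := ht.1.trans ht.2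
  refine ContinuousLinearMap.opNorm_le_bound _ (by positivity) fun x => ?_
  have e : (Q t - P t) x = (S t - T t) x + ∫ s in (0 : ℝ)..t, (S s - T s) (B x) := by
    simp only [_root_.sub_apply, hP t ht.1, hQ t ht.1]
    rw [intervalIntegral.integral_sub (hS.intervalIntegrable_orbit _ le_rfl ht.1)
      (hT.intervalIntegrable_orbit _ le_rfl ht.1)]
    abel
  have h1 : ‖(S t - T t) x‖ ≤ δ * ‖x‖ := (S t - T t).le_of_opNorm_le (hδ t ht) x
  have h2 : ‖∫ s in (0 : ℝ)..t, (S s - T s) (B x)‖ ≤ δ * (‖B‖ * ‖x‖) * |t - 0| := by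
    refine intervalIntegral.norm_integral_le_of_norm_le_const fun s hs => ?_
    rw [uIoc_of_le ht.1] at hs
    exact (S s - T s).le_of_opNorm_le_of_le (hδ s ⟨hs.1.le, hs.2.trans ht.2⟩) (B.le_opNorm x)
  rw [sub_zero, abs_of_nonneg ht.1] at h2
  rw [e]
  calc _ ≤ δ * ‖x‖ + δ * (‖B‖ * ‖x‖) * t := (norm_add_le _ _).trans (add_le_add h1 h2)
    _ ≤ δ * ‖x‖ + δ * (‖B‖ * ‖x‖) * τ := by gcongr; exact ht.2
    _ = _ := by ring

theorem norm_sdOp_le {T P : ℝ → X →L[ℂ] X} {B : X →L[ℂ] X}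
    (hP : ∀ t, 0 ≤ t → ∀ x, P t x = T t x + ∫ s in (0 : ℝ)..t, T s (B x)) {τ K : ℝ}
    (hK : ∀ t ∈ Icc 0 τ, ‖T t‖ ≤ K) {t : ℝ} (ht : t ∈ Icc 0 τ) :
    ‖P t‖ ≤ K * (1 + τ * ‖B‖) := by
  have hK0 : 0 ≤ K := (norm_nonneg _).trans (hK t ht)
  have hτ : 0 ≤ τ := ht.1.trans ht.2
  refine ContinuousLinearMap.opNorm_le_bound _ (by positivity) fun x => ?_
  have h1 : ‖T t x‖ ≤ K * ‖x‖ := (T t).le_of_opNorm_le (hK t ht) x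
  have h2 : ‖∫ s in (0 : ℝ)..t, T s (B x)‖ ≤ K * (‖B‖ * ‖x‖) * |t - 0| := by
    refine intervalIntegral.norm_integral_le_of_norm_le_const fun s hs => ?_
    rw [uIoc_of_le ht.1] at hs
    exact (T s).le_of_opNorm_le_of_le (hK s ⟨hs.1.le, hs.2.trans ht.2⟩) (B.le_opNorm x)
  rw [sub_zero, abs_of_nonneg ht.1] at h2
  rw [hP t ht.1]
  calc _ ≤ K * ‖x‖ + K * (‖B‖ * ‖x‖) * t := (norm_add_le _ _).trans (add_le_add h1 h2)
    _ ≤ K * ‖x‖ + K * (‖B‖ * ‖x‖) * τ := by gcongr; exact ht.2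
    _ = _ := by ring

theorem ceil_div_sub_one_eq {τ : ℝ} (hτ : 0 < τ) (k : ℕ) {t : ℝ} (ht : t ∈ Ioc 0 τ) :
    ⌈(k * τ + t) / τ⌉₊ - 1 = k := by
  have h : ⌈(k * τ + t) / τ⌉₊ = k + 1 := by
    rw [Nat.ceil_eq_iff (by omega)]
    push_cast
    rw [lt_div_iff₀ hτ, div_le_iff₀ hτ]
    constructor <;> nlinarith [ht.1, ht.2]
  omega

/-- Every positive time lies in some sampling interval `(kτ, (k + 1)τ]`. -/
theorem exists_eq_natCast_mul_add {τ s : ℝ} (hτ : 0 < τ) (hs : 0 < s) :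
    ∃ (k : ℕ) (t : ℝ), t ∈ Ioc 0 τ ∧ s = k * τ + t := by
  obtain ⟨k, hk, -⟩ := existsUnique_add_zsmul_mem_Ioc hτ s 0
  refine ⟨(-k).toNat, s + k • τ, by simpa using hk, ?_⟩
  have hk0 : k ≤ 0 := by
    by_contra! h
    have h1 : (1 : ℝ) ≤ k := by exact_mod_cast h
    have h2 := hk.2
    rw [zsmul_eq_mul, zero_add] at h2
    nlinarith
  have e : (((-k).toNat : ℤ) : ℝ) = -k := by rw [Int.toNat_of_nonneg (by omega)]; push_cast; rfl
  rw [Int.cast_natCast] at e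
  rw [e, zsmul_eq_mul]
  ring

theorem IsSdSolution.apply_natCast_mul {T P : ℝ → X →L[ℂ] X} {B : X →L[ℂ] X}
    (hP : ∀ t, 0 ≤ t → ∀ x, P t x = T t x + ∫ s in (0 : ℝ)..t, T s (B x)) {τ : ℝ} (hτ : 0 < τ)
    {x0 : X} {x : ℝ → X} (hx : IsSdSolution T B τ x0 x) (k : ℕ) : x (k * τ) = (P τ ^ k) x0 := by
  induction k with
  | zero => simp [hx.1]
  | succ k ih =>
    have h := hx.2 k τ hτ le_rfl
    rw [← hP τ hτ.le, ih] at h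
    rw [pow_succ', mul_apply_eq_comp, ← h]
    push_cast
    ring_nf

theorem exists_isSdSolution {T P : ℝ → X →L[ℂ] X} {B : X →L[ℂ] X}
    (hP : ∀ t, 0 ≤ t → ∀ x, P t x = T t x + ∫ s in (0 : ℝ)..t, T s (B x)) {τ : ℝ} (hτ : 0 < τ)
    (x0 : X) : ∃ x, IsSdSolution T B τ x0 x := by
  obtain ⟨x, hx⟩ : ∃ x : ℝ → X, x = fun s => if s ≤ 0 then x0 else
      P (s - (⌈s / τ⌉₊ - 1 : ℕ) * τ) ((P τ ^ (⌈s / τ⌉₊ - 1)) x0) := ⟨_, rfl⟩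
  have hxt : ∀ (k : ℕ) (t : ℝ), t ∈ Ioc 0 τ → x (k * τ + t) = P t ((P τ ^ k) x0) := by
    intro k t ht
    have h : ¬ (k * τ + t ≤ 0) := not_le.2 (by have := ht.1; positivity)
    simp only [hx, if_neg h, ceil_div_sub_one_eq hτ k ht, add_sub_cancel_left]
  have hx0 : x 0 = x0 := by simp [hx]
  have hxk : ∀ k : ℕ, x (k * τ) = (P τ ^ k) x0 := by
    rintro (_ | k)
    · simp [hx0]
    · rw [pow_succ', mul_apply_eq_comp, ← hxt k τ ⟨hτ, le_rfl⟩]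
      push_cast
      ring_nf
  refine ⟨x, hx0, fun k t ht0 ht => ?_⟩
  rw [hxt k t ⟨ht0, ht⟩, hxk, hP t ht0.le]

/-- Exponential stability of the sampled-data system bounds the powers of the operator that
advances the state by one sampling period. -/
theorem norm_pow_sdOp_le {T P : ℝ → X →L[ℂ] X} {B : X →L[ℂ] X}
    (hP : ∀ t, 0 ≤ t → ∀ x, P t x = T t x + ∫ s in (0 : ℝ)..t, T s (B x)) {τ M ω' : ℝ}
    (hτ : 0 < τ) (hM : 1 ≤ M) (h : ∀ (x0 : X) (x : ℝ → X), IsSdSolution T B τ x0 x →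
      ∀ t : ℝ, 0 ≤ t → ‖x t‖ ≤ M * Real.exp (-ω' * t) * ‖x0‖) (k : ℕ) :
    ‖P τ ^ k‖ ≤ M * Real.exp (-ω' * τ) ^ k := by
  refine ContinuousLinearMap.opNorm_le_bound _ (by positivity) fun x0 => ?_
  obtain ⟨x, hx⟩ := exists_isSdSolution hP hτ x0
  have hk := h x0 x hx (k * τ) (by positivity)
  rw [hx.apply_natCast_mul hP hτ] at hk
  refine hk.trans (le_of_eq ?_)
  rw [← Real.exp_nat_mul]
  ring_nf

/-- A power bound `M * ρ ^ k` survives a perturbation `Q` with the rate `ρ` replaced by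
`ρ + M * ‖Q‖`. -/
theorem norm_add_pow_le {Δ Q : X →L[ℂ] X} {M ρ σ : ℝ} (hρ : 0 ≤ ρ) (hM : 1 ≤ M)
    (h : ∀ k : ℕ, ‖Δ ^ k‖ ≤ M * ρ ^ k) (hQ : M * ‖Q‖ ≤ σ - ρ) (k : ℕ) :
    ‖(Δ + Q) ^ k‖ ≤ M * σ ^ k := by
  have hσ : 0 ≤ σ := by nlinarith [norm_nonneg Q]
  have expand : ∀ n : ℕ, (Δ + Q) ^ (n + 1) =
      Δ ^ (n + 1) + ∑ j ∈ Finset.range (n + 1), Δ ^ j * Q * (Δ + Q) ^ (n - j) := by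
    intro n
    induction n with
    | zero => simp
    | succ n ih =>
      rw [Finset.sum_range_succ', pow_succ' (Δ + Q) (n + 1), add_mul]
      nth_rewrite 1 [ih]
      rw [mul_add, Finset.mul_sum, ← pow_succ', add_assoc]
      simp [pow_succ' Δ, mul_assoc]
  induction k using Nat.strong_induction_on with
  | _ k ih =>
    rcases k with _ | n
    · simpa using h 0
    rw [expand]
    have hterm : ∀ j ∈ Finset.range (n + 1),
        ‖Δ ^ j * Q * (Δ + Q) ^ (n - j)‖ ≤ (σ - ρ) * M * (ρ ^ j * σ ^ (n - j)) := by
      intro j hj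
      rw [Finset.mem_range] at hj
      calc _ ≤ ‖Δ ^ j‖ * ‖Q‖ * ‖(Δ + Q) ^ (n - j)‖ :=
            (norm_mul_le _ _).trans (by gcongr; exact norm_mul_le _ _)
        _ ≤ M * ρ ^ j * ‖Q‖ * (M * σ ^ (n - j)) := by
            gcongr
            exacts [h j, ih _ (by omega)]
        _ = (M * ‖Q‖) * M * (ρ ^ j * σ ^ (n - j)) := by ring
        _ ≤ _ := by gcongr
    have hgeom := (Commute.all ρ σ).mul_geom_sum₂ (n + 1)
    simp only [Nat.add_sub_cancel] at hgeom
    calc _ ≤ M * ρ ^ (n + 1) + ∑ j ∈ Finset.range (n + 1), (σ - ρ) * M * (ρ ^ j * σ ^ (n - j)) :=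
          (norm_add_le _ _).trans (add_le_add (h _) (norm_sum_le_of_le _ hterm))
      _ = M * ρ ^ (n + 1) -
          M * ((ρ - σ) * ∑ j ∈ Finset.range (n + 1), ρ ^ j * σ ^ (n - j)) := by
          rw [← Finset.mul_sum]; ring
      _ = _ := by rw [hgeom]; ring

/-- A power bound on the operator that advances the state by one sampling period gives
exponential stability of the sampled-data system. -/
theorem sdExpStable_of_norm_pow_le {T P : ℝ → X →L[ℂ] X} {B : X →L[ℂ] X}
    (hP : ∀ t, 0 ≤ t → ∀ x, P t x = T t x + ∫ s in (0 : ℝ)..t, T s (B x)) {τ ω ω' M L : ℝ}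
    (hτ : 0 < τ) (hω : ω < ω') (hL : ∀ t ∈ Icc 0 τ, ‖P t‖ ≤ L)
    (h : ∀ k : ℕ, ‖P τ ^ k‖ ≤ M * Real.exp (-ω' * τ) ^ k) : SdExpStable T B τ ω := by
  have hL0 : 0 ≤ L := (norm_nonneg _).trans (hL 0 ⟨le_rfl, hτ.le⟩)
  have hM0 : 0 ≤ M := by simpa using (norm_nonneg _).trans (h 0)
  refine ⟨max 1 (L * M * Real.exp (|ω'| * τ)), le_max_left _ _, ω', hω, fun x0 x hx s hs => ?_⟩
  rcases hs.eq_or_lt with rfl | hs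
  · simp [hx.1, le_mul_of_one_le_left]
  obtain ⟨k, t, ht, rfl⟩ := exists_eq_natCast_mul_add hτ hs
  rw [hx.2 k t ht.1 ht.2, ← hP t ht.1.le, hx.apply_natCast_mul hP hτ]
  have hexp : Real.exp (-ω' * τ) ^ k ≤ Real.exp (|ω'| * τ) * Real.exp (-ω' * (k * τ + t)) := by
    rw [← Real.exp_nat_mul, ← Real.exp_add, Real.exp_le_exp]
    have h1 : ω' * t ≤ |ω'| * τ := mul_le_mul (le_abs_self _) ht.2 ht.1.le (abs_nonneg _)
    linarith
  calc _ ≤ L * (M * Real.exp (-ω' * τ) ^ k * ‖x0‖) :=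
        (P t).le_of_opNorm_le_of_le (hL t ⟨ht.1.le, ht.2⟩) ((P τ ^ k).le_of_opNorm_le (h k) x0)
    _ ≤ L * (M * (Real.exp (|ω'| * τ) * Real.exp (-ω' * (k * τ + t))) * ‖x0‖) := by gcongr
    _ = L * M * Real.exp (|ω'| * τ) * Real.exp (-ω' * (k * τ + t)) * ‖x0‖ := by ring
    _ ≤ _ := by gcongr; exact le_max_right _ _

end SampledData

/-- Robustness of exponential stability of sampled-data systems under
Miyadera–Voigt perturbations. -/
theorem sd_stability_robust_MV
    [NormedAddCommGroup X] [NormedSpace ℂ X] [CompleteSpace X]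
    (T : ℝ → X →L[ℂ] X) (hT : IsC0Semigroup T)
    (domA : Set X) (A : X → X) (hA : IsGenerator T domA A)
    (B : X →L[ℂ] X) (τ ω : ℝ) (hτ : 0 < τ)
    (hstab : SdExpStable T B τ ω)
    (t₀ : ℝ) (ht₀ : 0 < t₀) :
    ∃ q : ℝ, q ∈ Set.Ioo (0 : ℝ) 1 ∧
      ∀ D : X → X, IsGraphBoundedOp domA A D →
        (∀ x ∈ domA, (∫ s in (0 : ℝ)..t₀, ‖D (T s x)‖) ≤ q * ‖x‖) →
        ∃ TD : ℝ → X →L[ℂ] X,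
          IsC0Semigroup TD ∧
          IsGenerator TD domA (fun x => A x + D x) ∧
          SdExpStable TD B τ ω := by
  obtain ⟨M, hM, ω', hω, hst⟩ := hstab
  obtain ⟨K, w, q₀, hK, hw, hq₀, hMV⟩ := miyadera_voigt hT hA ht₀
  obtain ⟨P, hP⟩ := hT.exists_sdOp B
  have hpow := norm_pow_sdOp_le hP hτ hM hst
  obtain ⟨σ, hωσ, hσω⟩ := exists_between hω
  have hgap : 0 < Real.exp (-σ * τ) - Real.exp (-ω' * τ) :=
    sub_pos.2 (Real.exp_lt_exp.2 (by nlinarith))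
  set c := M * (K * Real.exp (w * τ) * (1 + τ * ‖B‖)) with hc
  have hc0 : 0 ≤ c := by positivity
  set q := min (min (1 / 2) q₀) ((Real.exp (-σ * τ) - Real.exp (-ω' * τ)) / (c + 1)) with hq
  have hq0 : 0 < q := lt_min (lt_min (by norm_num) hq₀) (by positivity)
  have hqhalf : q ≤ 1 / 2 := (min_le_left _ _).trans (min_le_left _ _)
  have hqq₀ : q ≤ q₀ := (min_le_left _ _).trans (min_le_right _ _)
  have hqc : q * c ≤ Real.exp (-σ * τ) - Real.exp (-ω' * τ) := by
    have h : q ≤ _ := min_le_right _ _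
    rw [le_div_iff₀ (by positivity)] at h
    linarith
  refine ⟨q, ⟨hq0, by linarith⟩, fun D hD hDq => ?_⟩
  obtain ⟨TD, hTD, hAD, hdiff⟩ := hMV q hq0.le hqq₀ D hD hDq
  refine ⟨TD, hTD, hAD, ?_⟩
  obtain ⟨Q, hQ⟩ := hTD.exists_sdOp B
  obtain ⟨L, -, hL⟩ := hTD.exists_bound_Icc τ
  have hδ : ∀ t ∈ Icc 0 τ, ‖TD t - T t‖ ≤ q * K * Real.exp (w * τ) := fun t ht =>
    (hdiff t ht.1).trans (by gcongr; exact ht.2)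
  have hQP : M * ‖Q τ - P τ‖ ≤ Real.exp (-σ * τ) - Real.exp (-ω' * τ) :=
    calc _ ≤ M * (q * K * Real.exp (w * τ) * (1 + τ * ‖B‖)) := by
          gcongr
          exact norm_sdOp_sub_le hT hTD hP hQ hδ ⟨hτ.le, le_rfl⟩
      _ = q * c := by rw [hc]; ring
      _ ≤ _ := hqc
  have hQpow := norm_add_pow_le (Real.exp_nonneg _) hM hpow hQP
  simp only [add_sub_cancel] at hQpow
  exact sdExpStable_of_norm_pow_le hQ hτ hωσ (fun t ht => norm_sdOp_le hQ hL ht) hQpow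
end

section
/- Suppose the sampled-data system associated with T, B, and sampling period τ > 0 is exponentially stable with decay rate greater than ω, and that T extends to an analytic semigroup of angle δ ∈ (0, π/2]. Then there exist α, β > 0 such that for every linear operator D : dom(D) ⊆ X → X with dom(A) ⊆ dom(D) and ‖Dx‖ ≤ α‖Ax‖ + β‖x‖ for all x ∈ dom(A), the operator A + D (with domain dom(A)) generates a strongly continuous semigroup T_D on X, and the perturbed sampled-data system, obtained by replacing T with T_D in the solution formula, is exponentially stable with decay rate greater than ω. -/
open MeasureTheory Filter Set
open scoped Topology Real

variable {X : Type*}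

/-- The sector `Σ_δ = {z ∈ ℂ \ {0} : |arg z| ≤ δ}`. -/
def CSector (δ : ℝ) : Set ℂ := {z : ℂ | z ≠ 0 ∧ |Complex.arg z| ≤ δ}

/-- `S` is an analytic extension of the semigroup `T` making it an analytic
semigroup of angle `δ`. -/
def IsAnalyticSG [NormedAddCommGroup X] [NormedSpace ℂ X]
    (T : ℝ → X →L[ℂ] X) (δ : ℝ) (S : ℂ → X →L[ℂ] X) : Prop :=
  (∀ t : ℝ, 0 ≤ t → S (t : ℂ) = T t) ∧
  DifferentiableOn ℂ S {z : ℂ | z ≠ 0 ∧ |Complex.arg z| < δ} ∧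
  (∀ z ∈ CSector δ, ∀ w ∈ CSector δ, S (z + w) = (S z).comp (S w)) ∧
  (∀ δ' : ℝ, 0 < δ' → δ' < δ →
    (∃ C : ℝ, ∀ z ∈ CSector δ', ‖z‖ ≤ 1 → ‖S z‖ ≤ C) ∧
    (∀ x : X, Tendsto (fun z : ℂ => S z x) (𝓝[CSector δ'] (0 : ℂ)) (𝓝 x)))

/-- `D : dom D ⊆ X → X` is a relatively `A`-bounded perturbation with constants
`α, β`, i.e. `D ∈ P_{α,β}(A)`. -/
def RelABounded [NormedAddCommGroup X] [NormedSpace ℂ X]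
    (domA : Set X) (A : X → X) (α β : ℝ) (domD : Set X) (D : X → X) : Prop :=
  domA ⊆ domD ∧
  (∀ x ∈ domD, ∀ y ∈ domD, D (x + y) = D x + D y) ∧
  (∀ (c : ℂ), ∀ x ∈ domD, D (c • x) = c • D x) ∧
  (∀ x ∈ domA, ‖D x‖ ≤ α * ‖A x‖ + β * ‖x‖)

section InverseLaplace

variable {𝔸 : Type*} [NormedRing 𝔸] [NormedAlgebra ℂ 𝔸]

/-- A pseudo-resolvent on the open right half-plane which decays like `M / ‖z‖`. -/
structure IsSectorialResolvent (F : ℂ → 𝔸) (M : ℝ) : Prop where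
  resolvent : ∀ z w : ℂ, 0 < z.re → 0 < w.re → F z - F w = (w - z) • (F z * F w)
  bound : ∀ z : ℂ, 0 < z.re → ‖F z‖ ≤ M / ‖z‖

/-- The parametrization `u ↦ 1 + i u` of the vertical line through `1`. -/
noncomputable def vline (u : ℝ) : ℂ := 1 + u * Complex.I

lemma vline_re (u : ℝ) : (vline u).re = 1 := by simp [vline]

lemma vline_im (u : ℝ) : (vline u).im = u := by simp [vline]

lemma norm_vline_sq (u : ℝ) : ‖vline u‖ ^ 2 = 1 + u ^ 2 := by
  rw [Complex.sq_norm, Complex.normSq_apply, vline_re, vline_im]; ring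

lemma one_le_norm_vline (u : ℝ) : 1 ≤ ‖vline u‖ := by
  have := norm_vline_sq u
  nlinarith [norm_nonneg (vline u), sq_nonneg u]

lemma vline_ne_zero (u : ℝ) : vline u ≠ 0 := by
  have := one_le_norm_vline u
  intro h
  rw [h, norm_zero] at this
  linarith

lemma norm_exp_vline (u : ℝ) : ‖Complex.exp (vline u)‖ = Real.exp 1 := by
  rw [Complex.norm_exp, vline_re]

lemma continuous_vline : Continuous vline := by unfold vline; fun_prop

lemma hasDerivAt_vline (u : ℝ) : HasDerivAt vline Complex.I u := by
  unfold vline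
  simpa using ((Complex.ofRealCLM.hasDerivAt (x := u)).mul_const Complex.I).const_add 1

lemma vline_div_re (u : ℝ) {t : ℝ} (ht : 0 < t) : 0 < (vline u / (t : ℂ)).re := by
  rw [Complex.div_ofReal_re, vline_re]; positivity

lemma norm_vline_div (u : ℝ) {t : ℝ} (ht : 0 < t) : ‖vline u / (t : ℂ)‖ = ‖vline u‖ / t := by
  rw [norm_div, Complex.norm_real, Real.norm_of_nonneg ht.le]

lemma inv_norm_vline_pow_le {k : ℕ} (hk : 2 ≤ k) (u : ℝ) :
    (‖vline u‖ ^ k)⁻¹ ≤ (1 + u ^ 2)⁻¹ := by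
  rw [← norm_vline_sq]
  have h := one_le_norm_vline u
  exact inv_anti₀ (by positivity) (pow_le_pow_right₀ h hk)

variable {F : ℂ → 𝔸} {M : ℝ}

namespace IsSectorialResolvent

lemma nonneg (hF : IsSectorialResolvent F M) : 0 ≤ M := by
  have := (norm_nonneg _).trans (hF.bound 1 (by simp))
  simpa using this

lemma commute (hF : IsSectorialResolvent F M) {z w : ℂ} (hz : 0 < z.re) (hw : 0 < w.re) :
    F z * F w = F w * F z := by
  rcases eq_or_ne z w with rfl | hne
  · rfl
  have h1 := hF.resolvent z w hz hw
  have h2 := hF.resolvent w z hw hz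
  have h3 : (w - z) • (F z * F w) = (w - z) • (F w * F z) := by
    rw [← h1, ← neg_sub, h2, ← neg_smul, neg_sub]
  exact smul_right_injective 𝔸 (sub_ne_zero.mpr hne.symm) h3

lemma continuousAt (hF : IsSectorialResolvent F M) {w : ℂ} (hw : 0 < w.re) :
    ContinuousAt F w := by
  have hev : ∀ᶠ z : ℂ in 𝓝 w, w.re / 2 < z.re :=
    Complex.continuous_re.continuousAt.eventually (lt_mem_nhds (by linarith))
  rw [ContinuousAt, tendsto_iff_norm_sub_tendsto_zero]
  have hM := hF.nonneg
  refine squeeze_zero' (g := fun z => ‖w - z‖ * (M / (w.re / 2) * ‖F w‖))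
    (Eventually.of_forall fun z => norm_nonneg _) ?_ ?_
  · filter_upwards [hev] with z hz
    have hz0 : 0 < z.re := by linarith
    rw [hF.resolvent z w hz0 hw, norm_smul]
    refine mul_le_mul_of_nonneg_left ((norm_mul_le _ _).trans ?_) (norm_nonneg _)
    refine mul_le_mul_of_nonneg_right ((hF.bound z hz0).trans ?_) (norm_nonneg _)
    exact div_le_div_of_nonneg_left hM (by linarith)
      (hz.le.trans ((le_abs_self _).trans (Complex.abs_re_le_norm z)))
  · have : Tendsto (fun z : ℂ => ‖w - z‖ * (M / (w.re / 2) * ‖F w‖)) (𝓝 w)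
      (𝓝 (‖w - w‖ * (M / (w.re / 2) * ‖F w‖))) := Continuous.tendsto (by fun_prop) w
    simpa using this

lemma hasDerivAt (hF : IsSectorialResolvent F M) {w : ℂ} (hw : 0 < w.re) :
    HasDerivAt F (-(F w * F w)) w := by
  rw [hasDerivAt_iff_tendsto_slope]
  have h1 : Tendsto (fun z => -(F z * F w)) (𝓝[≠] w) (𝓝 (-(F w * F w))) :=
    (((hF.continuousAt hw).mul continuousAt_const).neg).tendsto.mono_left nhdsWithin_le_nhds
  refine h1.congr' ?_
  have hev : ∀ᶠ z : ℂ in 𝓝[≠] w, 0 < z.re :=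
    (Complex.continuous_re.continuousAt.eventually (lt_mem_nhds hw)).filter_mono
      nhdsWithin_le_nhds
  filter_upwards [hev, self_mem_nhdsWithin] with z hz hne
  rw [slope_def_module, hF.resolvent z w hz hw, smul_smul, ← neg_sub z w, mul_neg,
    inv_mul_cancel₀ (sub_ne_zero.mpr hne), neg_one_smul]

lemma hasDerivAt_pow_three (hF : IsSectorialResolvent F M) {w : ℂ} (hw : 0 < w.re) :
    HasDerivAt (fun z => F z ^ 3) (-((3 : ℂ) • F w ^ 4)) w := by
  have h := hF.hasDerivAt hw
  have h3 := (h.mul h).mul h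
  convert h3 using 1
  · ext z; simp [pow_succ]
  · rw [show (3 : ℂ) • F w ^ 4 = F w ^ 4 + F w ^ 4 + F w ^ 4 by
      rw [show (3 : ℂ) = 1 + 1 + 1 by norm_num, add_smul, add_smul, one_smul], Pi.mul_apply]
    noncomm_ring

lemma norm_pow_vline_le (hF : IsSectorialResolvent F M) (u : ℝ) {t : ℝ} (ht : 0 < t) {k : ℕ}
    (hk : 0 < k) : ‖F (vline u / t) ^ k‖ ≤ (M * t) ^ k * (‖vline u‖ ^ k)⁻¹ := by
  refine (norm_pow_le' _ hk).trans ?_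
  have h := hF.bound _ (vline_div_re u ht)
  rw [norm_vline_div u ht, div_div_eq_mul_div] at h
  rw [← div_eq_mul_inv, ← div_pow]
  exact pow_le_pow_left₀ (norm_nonneg _) h k

lemma continuous_vline_div (hF : IsSectorialResolvent F M) {t : ℝ} (ht : 0 < t) :
    Continuous fun u : ℝ => F (vline u / t) := by
  refine continuous_iff_continuousAt.mpr fun u => ?_
  exact ContinuousAt.comp (f := fun u : ℝ => vline u / (t : ℂ))
    (hF.continuousAt (vline_div_re u ht))
    (continuous_vline.div_const _).continuousAt

lemma continuous_integrand (hF : IsSectorialResolvent F M) {t : ℝ} (ht : 0 < t) (k : ℕ) :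
    Continuous fun u : ℝ => Complex.exp (vline u) • F (vline u / t) ^ k :=
  (Complex.continuous_exp.comp continuous_vline).smul ((hF.continuous_vline_div ht).pow k)

lemma norm_integrand_le (hF : IsSectorialResolvent F M) (u : ℝ) {t : ℝ} (ht : 0 < t) {k : ℕ}
    (hk : 2 ≤ k) : ‖Complex.exp (vline u) • F (vline u / t) ^ k‖ ≤
      Real.exp 1 * (M * t) ^ k * (1 + u ^ 2)⁻¹ := by
  have hM := hF.nonneg
  rw [norm_smul, norm_exp_vline, mul_assoc]
  refine mul_le_mul_of_nonneg_left ?_ (Real.exp_pos 1).le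
  refine (hF.norm_pow_vline_le u ht (by omega)).trans ?_
  exact mul_le_mul_of_nonneg_left (inv_norm_vline_pow_le hk u) (by positivity)

lemma integrable_integrand (hF : IsSectorialResolvent F M) {t : ℝ} (ht : 0 < t) {k : ℕ}
    (hk : 2 ≤ k) : Integrable fun u : ℝ => Complex.exp (vline u) • F (vline u / t) ^ k := by
  refine Integrable.mono' (integrable_inv_one_add_sq.const_mul (Real.exp 1 * (M * t) ^ k))
    (hF.continuous_integrand ht k).aestronglyMeasurable
    (Eventually.of_forall fun u => hF.norm_integrand_le u ht hk)

end IsSectorialResolvent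

/-- The inverse Laplace integral of `F ^ k`, rescaled to the vertical line through `1`. -/
noncomputable def lineIntegral (F : ℂ → 𝔸) (k : ℕ) (t : ℝ) : 𝔸 :=
  ∫ u : ℝ, Complex.exp (vline u) • F (vline u / t) ^ k

/-- The semigroup whose generator has resolvent `F`, as an inverse Laplace integral of `F ^ 3`. -/
noncomputable def laplaceSemigroup (F : ℂ → 𝔸) (t : ℝ) : 𝔸 :=
  if t = 0 then 1 else ((π * t ^ 3 : ℝ) : ℂ)⁻¹ • lineIntegral F 3 t

lemma laplaceSemigroup_zero (F : ℂ → 𝔸) : laplaceSemigroup F 0 = 1 := by simp [laplaceSemigroup]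

lemma laplaceSemigroup_of_pos (F : ℂ → 𝔸) {t : ℝ} (ht : 0 < t) :
    laplaceSemigroup F t = ((π * t ^ 3 : ℝ) : ℂ)⁻¹ • lineIntegral F 3 t := by
  simp [laplaceSemigroup, ht.ne']

namespace IsSectorialResolvent

lemma mul_lineIntegral [CompleteSpace 𝔸] (hF : IsSectorialResolvent F M) {t : ℝ} (ht : 0 < t)
    {k : ℕ} (hk : 2 ≤ k)
    (a : 𝔸) : a * lineIntegral F k t =
      ∫ u : ℝ, Complex.exp (vline u) • (a * F (vline u / t) ^ k) := by
  have := (ContinuousLinearMap.mul ℂ 𝔸 a).integral_comp_comm (hF.integrable_integrand ht hk)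
  simp only [ContinuousLinearMap.mul_apply'] at this
  rw [lineIntegral, ← this]
  simp only [mul_smul_comm]

lemma lineIntegral_mul [CompleteSpace 𝔸] (hF : IsSectorialResolvent F M) {t : ℝ} (ht : 0 < t)
    {k : ℕ} (hk : 2 ≤ k)
    (a : 𝔸) : lineIntegral F k t * a =
      ∫ u : ℝ, Complex.exp (vline u) • (F (vline u / t) ^ k * a) := by
  have := ((ContinuousLinearMap.mul ℂ 𝔸).flip a).integral_comp_comm
    (hF.integrable_integrand ht hk)
  simp only [ContinuousLinearMap.mul_apply', ContinuousLinearMap.flip_apply] at this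
  rw [lineIntegral, ← this]
  simp only [smul_mul_assoc]

lemma commute_laplaceSemigroup [CompleteSpace 𝔸] (hF : IsSectorialResolvent F M) {a : 𝔸}
    (ha : ∀ z : ℂ, 0 < z.re → a * F z = F z * a) {t : ℝ} (ht : 0 ≤ t) :
    a * laplaceSemigroup F t = laplaceSemigroup F t * a := by
  rcases ht.eq_or_lt with rfl | ht
  · simp [laplaceSemigroup_zero]
  rw [laplaceSemigroup_of_pos F ht, mul_smul_comm, smul_mul_assoc,
    hF.mul_lineIntegral ht (by norm_num), hF.lineIntegral_mul ht (by norm_num)]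
  congr 2
  ext u
  have : Commute a (F (vline u / t)) := ha _ (vline_div_re u ht)
  rw [(this.pow_right 3).eq]

lemma norm_laplaceSemigroup_le (hF : IsSectorialResolvent F M) {t : ℝ} (ht : 0 < t) :
    ‖laplaceSemigroup F t‖ ≤ Real.exp 1 * M ^ 3 := by
  have h : ‖lineIntegral F 3 t‖ ≤ Real.exp 1 * (M * t) ^ 3 * π := by
    rw [← integral_univ_inv_one_add_sq, ← integral_const_mul]
    exact norm_integral_le_of_norm_le (integrable_inv_one_add_sq.const_mul _)
      (Eventually.of_forall fun u => hF.norm_integrand_le u ht (by norm_num))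
  rw [laplaceSemigroup_of_pos F ht, norm_smul, norm_inv, Complex.norm_real,
    Real.norm_of_nonneg (by positivity), inv_mul_le_iff₀ (by positivity)]
  calc _ ≤ _ := h
    _ = _ := by ring

lemma norm_laplaceSemigroup_sub_le {F' : ℂ → 𝔸} (hF : IsSectorialResolvent F M)
    (hF' : IsSectorialResolvent F' M) {ε : ℝ}
    (h : ∀ z : ℂ, 0 < z.re → ‖F z - F' z‖ ≤ ε / ‖z‖) {t : ℝ} (ht : 0 < t) :
    ‖laplaceSemigroup F t - laplaceSemigroup F' t‖ ≤ Real.exp 1 * (3 * M ^ 2) * ε := by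
  have hε : 0 ≤ ε := by
    have := (norm_nonneg _).trans (h 1 (by simp))
    simpa using this
  have hM := hF.nonneg
  have hpt : ∀ u : ℝ, ‖Complex.exp (vline u) • F (vline u / t) ^ 3 -
      Complex.exp (vline u) • F' (vline u / t) ^ 3‖ ≤
      Real.exp 1 * (3 * M ^ 2) * ε * t ^ 3 * (1 + u ^ 2)⁻¹ := by
    intro u
    have hre := vline_div_re u ht
    set a := F (vline u / t)
    set b := F' (vline u / t)
    have ha : ‖a‖ ≤ M * t / ‖vline u‖ := by
      have := hF.bound _ hre
      rwa [norm_vline_div u ht, div_div_eq_mul_div] at this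
    have hb : ‖b‖ ≤ M * t / ‖vline u‖ := by
      have := hF'.bound _ hre
      rwa [norm_vline_div u ht, div_div_eq_mul_div] at this
    have hab : ‖a - b‖ ≤ ε * t / ‖vline u‖ := by
      have := h _ hre
      rwa [norm_vline_div u ht, div_div_eq_mul_div] at this
    have hn := one_le_norm_vline u
    have e : a ^ 3 - b ^ 3 = a * a * (a - b) + a * (a - b) * b + (a - b) * b * b := by
      noncomm_ring
    rw [← smul_sub, norm_smul, norm_exp_vline, e]
    have key : ‖a * a * (a - b) + a * (a - b) * b + (a - b) * b * b‖ ≤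
        3 * M ^ 2 * ε * t ^ 3 * (‖vline u‖ ^ 3)⁻¹ := by
      calc _ ≤ ‖a‖ * ‖a‖ * ‖a - b‖ + ‖a‖ * ‖a - b‖ * ‖b‖ + ‖a - b‖ * ‖b‖ * ‖b‖ :=
            norm_add₃_le.trans (by
              gcongr <;> exact (norm_mul_le _ _).trans (by gcongr; exact norm_mul_le _ _))
        _ ≤ (M * t / ‖vline u‖) * (M * t / ‖vline u‖) * (ε * t / ‖vline u‖) +
            (M * t / ‖vline u‖) * (ε * t / ‖vline u‖) * (M * t / ‖vline u‖) +
            (ε * t / ‖vline u‖) * (M * t / ‖vline u‖) * (M * t / ‖vline u‖) := by gcongr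
        _ = _ := by field_simp; ring
    calc _ ≤ Real.exp 1 * (3 * M ^ 2 * ε * t ^ 3 * (‖vline u‖ ^ 3)⁻¹) := by gcongr
      _ ≤ Real.exp 1 * (3 * M ^ 2 * ε * t ^ 3 * (1 + u ^ 2)⁻¹) := by
          gcongr ?_ * (?_ * ?_)
          exact inv_norm_vline_pow_le (by norm_num) u
      _ = _ := by ring
  have hdiff : ‖lineIntegral F 3 t - lineIntegral F' 3 t‖ ≤
      Real.exp 1 * (3 * M ^ 2) * ε * t ^ 3 * π := by
    rw [lineIntegral, lineIntegral, ← integral_sub (hF.integrable_integrand ht (by norm_num))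
      (hF'.integrable_integrand ht (by norm_num)), ← integral_univ_inv_one_add_sq,
      ← integral_const_mul]
    exact norm_integral_le_of_norm_le (integrable_inv_one_add_sq.const_mul _)
      (Eventually.of_forall hpt)
  rw [laplaceSemigroup_of_pos F ht, laplaceSemigroup_of_pos F' ht, ← smul_sub, norm_smul,
    norm_inv, Complex.norm_real, Real.norm_of_nonneg (by positivity),
    inv_mul_le_iff₀ (by positivity)]
  calc _ ≤ _ := hdiff
    _ = _ := by ring

end IsSectorialResolvent

end InverseLaplace

section ResolventEquation

variable {𝔸 : Type*} [NormedRing 𝔸] [NormedAlgebra ℂ 𝔸] {F : ℂ → 𝔸} {M : ℝ}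

namespace IsSectorialResolvent

lemma tendsto_integrand (hF : IsSectorialResolvent F M) {t : ℝ} (ht : 0 < t) {l : Filter ℝ}
    (hl : Tendsto (fun u : ℝ => (1 + u ^ 2)⁻¹) l (𝓝 0)) :
    Tendsto (fun u : ℝ => Complex.exp (vline u) • F (vline u / t) ^ 3) l (𝓝 0) := by
  refine squeeze_zero_norm (fun u => hF.norm_integrand_le u ht (by norm_num)) ?_
  simpa using hl.const_mul (Real.exp 1 * (M * t) ^ 3)

/-- Integration by parts along the vertical line. -/
lemma lineIntegral_three [CompleteSpace 𝔸] (hF : IsSectorialResolvent F M) {t : ℝ}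
    (ht : 0 < t) : lineIntegral F 3 t = ((3 : ℂ) / t) • lineIntegral F 4 t := by
  have ht' : (t : ℂ) ≠ 0 := by exact_mod_cast ht.ne'
  have hd : ∀ u : ℝ, HasDerivAt (fun u : ℝ => Complex.exp (vline u) • F (vline u / t) ^ 3)
      (Complex.I • (Complex.exp (vline u) • F (vline u / t) ^ 3) -
        (Complex.I * (3 / t)) • (Complex.exp (vline u) • F (vline u / t) ^ 4)) u := by
    intro u
    have h1 : HasDerivAt (fun u : ℝ => Complex.exp (vline u))
        (Complex.exp (vline u) * Complex.I) u := (hasDerivAt_vline u).cexp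
    have h2 : HasDerivAt (fun u : ℝ => F (vline u / t) ^ 3)
        ((Complex.I / t) • (-((3 : ℂ) • F (vline u / t) ^ 4))) u :=
      HasDerivAt.scomp u (h := fun u : ℝ => vline u / (t : ℂ))
        (hF.hasDerivAt_pow_three (vline_div_re u ht)) ((hasDerivAt_vline u).div_const _)
    refine (h1.smul h2).congr_deriv ?_
    module
  have hi3 := hF.integrable_integrand ht (k := 3) (by norm_num)
  have hi4 := hF.integrable_integrand ht (k := 4) (by norm_num)
  have hi3' : Integrable fun u : ℝ =>
      Complex.I • (Complex.exp (vline u) • F (vline u / t) ^ 3) := hi3.smul Complex.I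
  have hi4' : Integrable fun u : ℝ =>
      (Complex.I * (3 / t)) • (Complex.exp (vline u) • F (vline u / t) ^ 4) :=
    hi4.smul (Complex.I * (3 / (t : ℂ)))
  have hsq : Tendsto (fun u : ℝ => (1 + u ^ 2)) (cocompact ℝ) atTop := by
    refine tendsto_atTop_add_const_left _ _ ?_
    have := (tendsto_pow_atTop two_ne_zero).comp (tendsto_norm_cocompact_atTop (E := ℝ))
    simpa [Function.comp_def] using this
  have hz := tendsto_inv_atTop_zero.comp hsq
  have := integral_of_hasDerivAt_of_tendsto hd (hi3'.sub hi4')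
    (hF.tendsto_integrand ht (hz.mono_left atBot_le_cocompact))
    (hF.tendsto_integrand ht (hz.mono_left atTop_le_cocompact))
  rw [integral_sub hi3' hi4', integral_smul, integral_smul, sub_zero,
    sub_eq_zero, mul_smul] at this
  exact smul_right_injective 𝔸 Complex.I_ne_zero this

lemma hasDerivAt_lineIntegral [CompleteSpace 𝔸] (hF : IsSectorialResolvent F M) {t : ℝ}
    (ht : 0 < t) : HasDerivAt (lineIntegral F 3)
      (∫ u : ℝ, (Complex.exp (vline u) * (3 * vline u / t ^ 2)) • F (vline u / t) ^ 4) t := by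
  have hM := hF.nonneg
  have hc : ∀ {x : ℝ}, x ∈ Ioo (t / 2) (2 * t) → 0 < x := fun hx => by linarith [hx.1]
  refine (hasDerivAt_integral_of_dominated_loc_of_deriv_le (𝕜 := ℝ) (μ := volume)
    (F := fun (x : ℝ) (u : ℝ) => Complex.exp (vline u) • F (vline u / x) ^ 3)
    (F' := fun (x : ℝ) (u : ℝ) =>
      (Complex.exp (vline u) * (3 * vline u / x ^ 2)) • F (vline u / x) ^ 4)
    (bound := fun u => Real.exp 1 * (3 / (t / 2) ^ 2) * (M * (2 * t)) ^ 4 * (1 + u ^ 2)⁻¹)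
    (Ioo_mem_nhds (show t / 2 < t by linarith) (show t < 2 * t by linarith))
    ?_ (hF.integrable_integrand ht (by norm_num)) ?_ ?_
    (integrable_inv_one_add_sq.const_mul _) ?_).2
  · filter_upwards [lt_mem_nhds ht] with x hx
    exact (hF.continuous_integrand hx 3).aestronglyMeasurable
  · refine Continuous.aestronglyMeasurable (Continuous.smul ?_ ((hF.continuous_vline_div ht).pow 4))
    exact (Complex.continuous_exp.comp continuous_vline).mul
      ((continuous_const.mul continuous_vline).div_const _)
  · refine Eventually.of_forall fun u x hx => ?_
    have hx0 := hc hx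
    rw [norm_smul, norm_mul, norm_exp_vline, norm_div, norm_mul, norm_pow, Complex.norm_real,
      Real.norm_of_nonneg hx0.le, Complex.norm_ofNat]
    have h1 := hF.norm_pow_vline_le u hx0 (k := 4) (by norm_num)
    have hn := one_le_norm_vline u
    calc Real.exp 1 * (3 * ‖vline u‖ / x ^ 2) * ‖F (vline u / x) ^ 4‖
        ≤ Real.exp 1 * (3 * ‖vline u‖ / x ^ 2) * ((M * x) ^ 4 * (‖vline u‖ ^ 4)⁻¹) := by gcongr
      _ = Real.exp 1 * (3 / x ^ 2) * (M * x) ^ 4 * (‖vline u‖ ^ 3)⁻¹ := by field_simp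
      _ ≤ Real.exp 1 * (3 / (t / 2) ^ 2) * (M * (2 * t)) ^ 4 * (1 + u ^ 2)⁻¹ := by
          have := inv_norm_vline_pow_le (k := 3) (by norm_num) u
          gcongr
          · exact hx.1.le
          · exact hx.2.le
  · refine Eventually.of_forall fun u x hx => ?_
    have hx0 := hc hx
    have hx' : (x : ℂ) ≠ 0 := by exact_mod_cast hx0.ne'
    have h1 : HasDerivAt (fun x : ℝ => vline u / (x : ℂ)) (-(vline u / x ^ 2)) x := by
      have := ((hasDerivAt_inv hx').const_mul (vline u)).comp_ofReal
      simpa [div_eq_mul_inv] using this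
    have h2 := (HasDerivAt.scomp x (h := fun x : ℝ => vline u / (x : ℂ))
        (hF.hasDerivAt_pow_three (vline_div_re u hx0)) h1).const_smul (Complex.exp (vline u))
    refine h2.congr_deriv ?_
    module

/-- The derivative of `t ↦ T(t) F(w)` is `A T(t) F(w) = w T(t) F(w) - T(t)`. -/
lemma hasDerivAt_laplaceSemigroup_mul [CompleteSpace 𝔸] (hF : IsSectorialResolvent F M) {w : ℂ}
    (hw : 0 < w.re) {t : ℝ} (ht : 0 < t) :
    HasDerivAt (fun t => laplaceSemigroup F t * F w)
      (w • (laplaceSemigroup F t * F w) - laplaceSemigroup F t) t := by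
  have ht' : (t : ℂ) ≠ 0 := by exact_mod_cast ht.ne'
  have hπ : (π : ℂ) ≠ 0 := by exact_mod_cast Real.pi_ne_zero
  have hM := hF.nonneg
  have hi3 := hF.integrable_integrand ht (k := 3) (by norm_num)
  have hi4 := hF.integrable_integrand ht (k := 4) (by norm_num)
  have hmul : ∀ (k : ℕ), 2 ≤ k → Integrable (fun u : ℝ =>
      Complex.exp (vline u) • (F (vline u / t) ^ k * F w)) := by
    intro k hk
    have := ((ContinuousLinearMap.mul ℂ 𝔸).flip (F w)).integrable_comp
      (hF.integrable_integrand ht hk)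
    simpa [smul_mul_assoc] using this
  have hpt : ∀ u : ℝ, (Complex.exp (vline u) * (3 * vline u / t ^ 2)) •
      (F (vline u / t) ^ 4 * F w) = (3 / t : ℂ) •
        (Complex.exp (vline u) • (F (vline u / t) ^ 3 * F w) -
        Complex.exp (vline u) • F (vline u / t) ^ 4 +
        w • (Complex.exp (vline u) • (F (vline u / t) ^ 4 * F w))) := by
    intro u
    have hres := hF.resolvent (vline u / t) w (vline_div_re u ht) hw
    set a := F (vline u / t)
    have e1 : (vline u / t) • (a * F w) = F w - a + w • (a * F w) := by
      linear_combination (norm := module) hres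
    have e2 : (vline u / t) • (a ^ 4 * F w) = a ^ 3 * F w - a ^ 4 + w • (a ^ 4 * F w) := by
      have := congrArg (fun b => a ^ 3 * b) e1
      simp only [mul_add, mul_sub, mul_smul_comm, ← mul_assoc, ← pow_succ] at this
      exact this
    rw [show Complex.exp (vline u) * (3 * vline u / t ^ 2) =
      (3 / t * Complex.exp (vline u)) * (vline u / t) by field_simp, mul_smul, e2]
    module
  have hder := (hF.hasDerivAt_lineIntegral ht).mul_const (F w)
  have hi5 : Integrable (fun u : ℝ =>
      (Complex.exp (vline u) * (3 * vline u / t ^ 2)) • F (vline u / t) ^ 4) := by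
    refine Integrable.mono' (integrable_inv_one_add_sq.const_mul
      (Real.exp 1 * (3 / t ^ 2) * (M * t) ^ 4)) ?_ (Eventually.of_forall fun u => ?_)
    · refine Continuous.aestronglyMeasurable
        (Continuous.smul ?_ ((hF.continuous_vline_div ht).pow 4))
      exact (Complex.continuous_exp.comp continuous_vline).mul
        ((continuous_const.mul continuous_vline).div_const _)
    · rw [norm_smul, norm_mul, norm_exp_vline, norm_div, norm_mul, norm_pow, Complex.norm_real,
        Real.norm_of_nonneg ht.le, Complex.norm_ofNat]
      have h1 := hF.norm_pow_vline_le u ht (k := 4) (by norm_num)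
      have hn := one_le_norm_vline u
      calc Real.exp 1 * (3 * ‖vline u‖ / t ^ 2) * ‖F (vline u / t) ^ 4‖
          ≤ Real.exp 1 * (3 * ‖vline u‖ / t ^ 2) * ((M * t) ^ 4 * (‖vline u‖ ^ 4)⁻¹) := by gcongr
        _ = Real.exp 1 * (3 / t ^ 2) * (M * t) ^ 4 * (‖vline u‖ ^ 3)⁻¹ := by field_simp
        _ ≤ Real.exp 1 * (3 / t ^ 2) * (M * t) ^ 4 * (1 + u ^ 2)⁻¹ := by
            have := inv_norm_vline_pow_le (k := 3) (by norm_num) u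
            gcongr
  have hInt : (∫ u : ℝ, (Complex.exp (vline u) * (3 * vline u / t ^ 2)) •
      F (vline u / t) ^ 4) * F w = (3 / t : ℂ) • (lineIntegral F 3 t * F w) -
        lineIntegral F 3 t + w • (lineIntegral F 3 t * F w) := by
    have e := ((ContinuousLinearMap.mul ℂ 𝔸).flip (F w)).integral_comp_comm hi5
    simp only [ContinuousLinearMap.mul_apply', ContinuousLinearMap.flip_apply,
      smul_mul_assoc] at e
    rw [← e]
    simp_rw [hpt]
    have hi6 : Integrable (fun u : ℝ => Complex.exp (vline u) • (F (vline u / t) ^ 3 * F w) -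
        Complex.exp (vline u) • F (vline u / t) ^ 4) := (hmul 3 (by norm_num)).sub hi4
    have hi7 : Integrable (fun u : ℝ => w • Complex.exp (vline u) • (F (vline u / t) ^ 4 * F w)) :=
      (hmul 4 (by norm_num)).smul w
    rw [integral_smul, integral_add hi6 hi7,
      integral_sub (hmul 3 (by norm_num)) hi4, integral_smul,
      ← hF.lineIntegral_mul ht (by norm_num), ← hF.lineIntegral_mul ht (by norm_num)]
    change (3 / t : ℂ) • (lineIntegral F 3 t * F w - lineIntegral F 4 t +
      w • (lineIntegral F 4 t * F w)) = _
    rw [hF.lineIntegral_three ht]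
    simp only [smul_mul_assoc]
    module
  have hpre : HasDerivAt (fun t : ℝ => ((π * t ^ 3 : ℝ) : ℂ)⁻¹)
      (-(3 / t) * ((π * t ^ 3 : ℝ) : ℂ)⁻¹) t := by
    have h1 : HasDerivAt (fun z : ℂ => (π * z ^ 3 : ℂ)⁻¹)
        (-(3 / t) * (π * t ^ 3 : ℂ)⁻¹) (t : ℂ) := by
      have h2 := (((hasDerivAt_id (t : ℂ)).fun_pow 3).const_mul (π : ℂ)).fun_inv
        (by simp [ht', hπ])
      refine h2.congr_deriv ?_
      simp
      field_simp
    simpa using h1.comp_ofReal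
  have hfin := hpre.smul hder
  rw [hInt] at hfin
  refine (hfin.congr_deriv ?_).congr_of_eventuallyEq ?_
  · rw [laplaceSemigroup_of_pos F ht]
    simp only [smul_mul_assoc]
    module
  · filter_upwards [lt_mem_nhds ht] with x hx
    rw [laplaceSemigroup_of_pos F hx, smul_mul_assoc]
    rfl

lemma continuousAt_laplaceSemigroup [CompleteSpace 𝔸] (hF : IsSectorialResolvent F M) {t : ℝ}
    (ht : 0 < t) : ContinuousAt (laplaceSemigroup F) t := by
  have h1 : ContinuousAt (fun t : ℝ => ((π * t ^ 3 : ℝ) : ℂ)⁻¹ • lineIntegral F 3 t) t := by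
    refine ContinuousAt.smul (ContinuousAt.inv₀ (by fun_prop) ?_)
      (hF.hasDerivAt_lineIntegral ht).continuousAt
    have : π * t ^ 3 ≠ 0 := by positivity
    exact_mod_cast this
  refine h1.congr ?_
  filter_upwards [lt_mem_nhds ht] with x hx
  rw [laplaceSemigroup_of_pos F hx]

end IsSectorialResolvent

end ResolventEquation

section Normalization

lemma integrable_max_sq_mul_exp :
    Integrable fun t : ℝ => (((max t 0) ^ 2 * Real.exp (-t) : ℝ) : ℂ) := by
  have h1 : IntegrableOn (fun t : ℝ => (max t 0) ^ 2 * Real.exp (-t)) (Ioi 0) := by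
    refine (Real.GammaIntegral_convergent (s := 3) (by norm_num)).congr_fun ?_ measurableSet_Ioi
    intro t ht
    have ht' : (0 : ℝ) < t := ht
    simp only [max_eq_left ht'.le]
    rw [show (3 : ℝ) - 1 = (2 : ℕ) by norm_num, Real.rpow_natCast, mul_comm]
  refine Integrable.ofReal ?_
  rw [← integrableOn_univ, ← Iic_union_Ioi (a := (0 : ℝ)), integrableOn_union]
  refine ⟨(integrableOn_zero (μ := volume)).congr_fun ?_ measurableSet_Iic, h1⟩
  intro t ht
  change (0 : ℝ) = max t 0 ^ 2 * Real.exp (-t)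
  rw [max_eq_right (show t ≤ 0 from ht)]
  ring

lemma integral_sq_mul_exp_neg_vline (y : ℝ) :
    ∫ t : ℝ in Ioi 0, Complex.exp (-(vline y * t)) * (t : ℂ) ^ 2 = 2 * (vline y ^ 3)⁻¹ := by
  have hz := vline_ne_zero y
  have hnorm : ∀ t : ℝ, ‖Complex.exp (-(vline y * t))‖ = Real.exp (-t) := by
    intro t
    rw [Complex.norm_exp]
    simp [vline]
  have hd : ∀ t : ℝ, HasDerivAt (fun t : ℝ => -(Complex.exp (-(vline y * t)) *
      ((t : ℂ) ^ 2 / vline y + 2 * t / vline y ^ 2 + 2 / vline y ^ 3)))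
      (Complex.exp (-(vline y * t)) * (t : ℂ) ^ 2) t := by
    intro t
    have h : HasDerivAt (fun z : ℂ => -(Complex.exp (-(vline y * z)) *
      (z ^ 2 / vline y + 2 * z / vline y ^ 2 + 2 / vline y ^ 3)))
      (Complex.exp (-(vline y * t)) * (t : ℂ) ^ 2) (t : ℂ) := by
      have h1 := (((hasDerivAt_id (t : ℂ)).const_mul (vline y)).fun_neg).cexp
      have h2 := ((((hasDerivAt_id (t : ℂ)).fun_pow 2).div_const (vline y)).fun_add
        (((hasDerivAt_id (t : ℂ)).const_mul 2).div_const (vline y ^ 2))).add_const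
          (2 / vline y ^ 3)
      refine (h1.fun_mul h2).fun_neg.congr_deriv ?_
      simp
      field_simp
      ring
    exact h.comp_ofReal
  have htend : Tendsto (fun t : ℝ => -(Complex.exp (-(vline y * t)) *
      ((t : ℂ) ^ 2 / vline y + 2 * t / vline y ^ 2 + 2 / vline y ^ 3))) atTop (𝓝 0) := by
    have hk : ∀ k : ℕ, Tendsto (fun t : ℝ => Complex.exp (-(vline y * t)) * (t : ℂ) ^ k) atTop
        (𝓝 0) := by
      intro k
      rw [tendsto_zero_iff_norm_tendsto_zero]
      refine (Real.tendsto_pow_mul_exp_neg_atTop_nhds_zero k).congr' ?_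
      filter_upwards [eventually_ge_atTop 0] with t ht
      rw [norm_mul, hnorm, norm_pow, Complex.norm_real, Real.norm_of_nonneg ht, mul_comm]
    have := ((((hk 2).mul_const (vline y)⁻¹).add ((hk 1).mul_const (2 / vline y ^ 2))).add
      ((hk 0).mul_const (2 / vline y ^ 3))).neg
    simp only [zero_mul, add_zero, neg_zero] at this
    refine this.congr fun t => ?_
    ring
  have hInt : IntegrableOn (fun t : ℝ => Complex.exp (-(vline y * t)) * (t : ℂ) ^ 2) (Ioi 0) := by
    refine Integrable.mono' (integrable_max_sq_mul_exp.norm.integrableOn) ?_ ?_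
    · exact (by fun_prop : Continuous fun t : ℝ =>
        Complex.exp (-(vline y * t)) * (t : ℂ) ^ 2).aestronglyMeasurable
    · refine (ae_restrict_mem measurableSet_Ioi).mono fun t ht => ?_
      have ht' : (0 : ℝ) < t := ht
      rw [norm_mul, hnorm, norm_pow, Complex.norm_real, Complex.norm_real, max_eq_left ht'.le,
        Real.norm_of_nonneg ht'.le, Real.norm_of_nonneg (by positivity), mul_comm]
  rw [integral_Ioi_of_hasDerivAt_of_tendsto (hd 0).continuousAt.continuousWithinAt
    (fun t _ => hd t) hInt htend]
  simp
  field_simp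

lemma integrable_exp_vline_mul : Integrable fun u : ℝ =>
    Complex.exp (vline u) * (vline u ^ 3)⁻¹ := by
  refine Integrable.mono' (integrable_inv_one_add_sq.const_mul (Real.exp 1)) ?_
    (Eventually.of_forall fun u => ?_)
  · exact ((Complex.continuous_exp.comp continuous_vline).mul ((continuous_vline.pow 3).inv₀
      fun u => pow_ne_zero 3 (vline_ne_zero u))).aestronglyMeasurable
  · rw [norm_mul, norm_exp_vline, norm_inv, norm_pow]
    exact mul_le_mul_of_nonneg_left (inv_norm_vline_pow_le (by norm_num) u) (Real.exp_pos 1).le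

/-- The inverse Laplace transform of `z ↦ 2 / z ^ 3` at time `1`. -/
lemma integral_exp_vline_mul :
    ∫ u : ℝ, Complex.exp (vline u) * (vline u ^ 3)⁻¹ = π := by
  set g : ℝ → ℂ := fun t => (((max t 0) ^ 2 * Real.exp (-t) : ℝ) : ℂ) with hg
  have hgc : Continuous g := by fun_prop
  have hF : FourierTransform.fourier g = fun w : ℝ => 2 * (vline (2 * π * w) ^ 3)⁻¹ := by
    ext w
    rw [Real.fourier_eq', ← integral_sq_mul_exp_neg_vline, ← integral_indicator measurableSet_Ioi]
    congr 1
    ext t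
    by_cases ht : 0 < t
    · rw [indicator_of_mem (show t ∈ Ioi (0 : ℝ) from ht)]
      simp only [hg, max_eq_left ht.le, smul_eq_mul]
      push_cast
      rw [mul_comm (_ ^ 2), ← mul_assoc, ← Complex.exp_add]
      congr 2
      simp [vline]
      ring
    · rw [indicator_of_notMem (show t ∉ Ioi (0 : ℝ) from ht)]
      simp [hg, max_eq_right (not_lt.mp ht)]
  have hscale : ∀ f : ℝ → ℂ, ∫ w : ℝ, f (2 * π * w) = ((2 * π : ℝ)⁻¹ : ℂ) * ∫ u, f u := by
    intro f
    rw [Measure.integral_comp_mul_left f (2 * π), abs_of_pos (by positivity)]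
    simp
  have hFi : Integrable (FourierTransform.fourier g) := by
    rw [hF]
    have h3 : Integrable fun u : ℝ => (2 : ℂ) * (vline u ^ 3)⁻¹ := by
      refine Integrable.const_mul (Integrable.mono' integrable_inv_one_add_sq ?_
        (Eventually.of_forall fun u => ?_)) 2
      · exact ((continuous_vline.pow 3).inv₀
          fun u => pow_ne_zero 3 (vline_ne_zero u)).aestronglyMeasurable
      · rw [norm_inv, norm_pow]
        exact inv_norm_vline_pow_le (by norm_num) u
    exact h3.comp_mul_left' (by positivity)
  have hinv := congrFun (hgc.fourierInv_fourier_eq integrable_max_sq_mul_exp hFi) 1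
  rw [Real.fourierInv_eq', hF] at hinv
  have e1 : (∫ v : ℝ, Complex.exp (((2 * π * inner ℝ v 1 : ℝ) : ℂ) * Complex.I) •
      (2 * (vline (2 * π * v) ^ 3)⁻¹)) =
      ((2 * π : ℝ)⁻¹ : ℂ) * ∫ u : ℝ, Complex.exp (u * Complex.I) * (2 * (vline u ^ 3)⁻¹) := by
    rw [← hscale]
    congr 1
    ext v
    simp
  rw [e1] at hinv
  have e2 : ∫ u : ℝ, Complex.exp (vline u) * (vline u ^ 3)⁻¹ =
      Complex.exp 1 / 2 * ∫ u : ℝ, Complex.exp (u * Complex.I) * (2 * (vline u ^ 3)⁻¹) := by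
    rw [← integral_const_mul]
    congr 1
    ext u
    rw [vline, Complex.exp_add]
    ring
  have hπ : (π : ℂ) ≠ 0 := by exact_mod_cast Real.pi_ne_zero
  rw [e2]
  have e3 : ∫ u : ℝ, Complex.exp (u * Complex.I) * (2 * (vline u ^ 3)⁻¹) =
      2 * π * Complex.exp (-1) := by
    have : g 1 = Complex.exp (-1) := by simp [hg]
    rw [this] at hinv
    have h2π : (2 * π : ℂ) ≠ 0 := mul_ne_zero two_ne_zero hπ
    rw [← hinv, ← mul_assoc]
    push_cast
    rw [mul_inv_cancel₀ h2π, one_mul]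
  rw [e3]
  have : Complex.exp 1 * Complex.exp (-1) = 1 := by rw [← Complex.exp_add]; simp
  linear_combination (π : ℂ) * this

end Normalization

section InitialValue

variable {𝔸 : Type*} [NormedRing 𝔸] [NormedAlgebra ℂ 𝔸] {F : ℂ → 𝔸} {M : ℝ}

lemma IsSectorialResolvent.norm_laplaceSemigroup_mul_sub_le [CompleteSpace 𝔸]
    (hF : IsSectorialResolvent F M) {w : ℂ} (hw : 0 < w.re) {t : ℝ} (ht : 0 < t) :
    ‖laplaceSemigroup F t * F w - F w‖ ≤
      Real.exp 1 * ((M ^ 2 + M + 1) * (M + ‖w‖ * M * ‖F w‖)) * t := by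
  have hM := hF.nonneg
  have ht' : (t : ℂ) ≠ 0 := by exact_mod_cast ht.ne'
  have hπ : (π : ℂ) ≠ 0 := by exact_mod_cast Real.pi_ne_zero
  set C := (M ^ 2 + M + 1) * (M + ‖w‖ * M * ‖F w‖)
  have hi : Integrable (fun u : ℝ =>
      Complex.exp (vline u) • (F (vline u / t) ^ 3 * F w)) := by
    have := ((ContinuousLinearMap.mul ℂ 𝔸).flip (F w)).integrable_comp
      (hF.integrable_integrand ht (k := 3) (by norm_num))
    simpa [smul_mul_assoc] using this
  have hc : F w = ((π * t ^ 3 : ℝ) : ℂ)⁻¹ •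
      ∫ u : ℝ, ((t : ℂ) ^ 3 * (Complex.exp (vline u) * (vline u ^ 3)⁻¹)) • F w := by
    rw [integral_smul_const, integral_const_mul, integral_exp_vline_mul, smul_smul]
    have : ((π * t ^ 3 : ℝ) : ℂ)⁻¹ * ((t : ℂ) ^ 3 * π) = 1 := by
      push_cast; field_simp
    rw [this, one_smul]
  have hci : Integrable fun u : ℝ =>
      ((t : ℂ) ^ 3 * (Complex.exp (vline u) * (vline u ^ 3)⁻¹)) • F w :=
    (integrable_exp_vline_mul.const_mul _).smul_const _
  have hpt : ∀ u : ℝ, ‖Complex.exp (vline u) • (F (vline u / t) ^ 3 * F w) -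
      ((t : ℂ) ^ 3 * (Complex.exp (vline u) * (vline u ^ 3)⁻¹)) • F w‖ ≤
      Real.exp 1 * C * t ^ 4 * (1 + u ^ 2)⁻¹ := by
    intro u
    have hz := vline_ne_zero u
    have hn := one_le_norm_vline u
    have hre := vline_div_re u ht
    have hres := hF.resolvent _ w hre hw
    have hb := hF.bound _ hre
    have hl := norm_vline_div u ht
    set l := vline u / (t : ℂ) with hldef
    have hl0 : l ≠ 0 := div_ne_zero hz ht'
    set a := F l
    set q := l • a with hq
    have hqn : ‖q‖ ≤ M := by
      rw [hq, norm_smul]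
      rw [le_div_iff₀ (norm_pos_iff.mpr hl0)] at hb
      linarith
    set e := q * F w - F w with he
    have hee : e = -a + w • (a * F w) := by
      rw [he, hq, smul_mul_assoc]
      linear_combination (norm := module) hres
    have hen : ‖e‖ ≤ (M + ‖w‖ * M * ‖F w‖) / ‖l‖ := by
      rw [hee]
      calc _ ≤ ‖a‖ + ‖w‖ * (‖a‖ * ‖F w‖) := by
            refine (norm_add_le _ _).trans ?_
            rw [norm_neg, norm_smul]
            gcongr
            exact norm_mul_le _ _
        _ ≤ M / ‖l‖ + ‖w‖ * (M / ‖l‖ * ‖F w‖) := by gcongr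
        _ = _ := by ring
    have hid : q ^ 3 * F w - F w = q * (q * e) + q * e + e := by
      rw [he]; noncomm_ring
    have hid2 : Complex.exp (vline u) • (a ^ 3 * F w) -
        ((t : ℂ) ^ 3 * (Complex.exp (vline u) * (vline u ^ 3)⁻¹)) • F w =
        (Complex.exp (vline u) * (l ^ 3)⁻¹) • (q ^ 3 * F w - F w) := by
      rw [hq, smul_pow, smul_mul_assoc, smul_sub, smul_smul, mul_assoc,
        inv_mul_cancel₀ (pow_ne_zero 3 hl0), mul_one]
      congr 2
      rw [hldef]
      field_simp
    rw [hid2, hid, norm_smul, norm_mul, norm_exp_vline, norm_inv, norm_pow]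
    have h3 : ‖q * (q * e) + q * e + e‖ ≤ C / ‖l‖ := by
      calc _ ≤ ‖q‖ * (‖q‖ * ‖e‖) + ‖q‖ * ‖e‖ + ‖e‖ := norm_add₃_le.trans (by
              gcongr
              · exact (norm_mul_le _ _).trans (by gcongr; exact norm_mul_le _ _)
              · exact norm_mul_le _ _)
        _ = (‖q‖ ^ 2 + ‖q‖ + 1) * ‖e‖ := by ring
        _ ≤ (M ^ 2 + M + 1) * ((M + ‖w‖ * M * ‖F w‖) / ‖l‖) := by gcongr
        _ = _ := by rw [mul_div_assoc]
    have hC : 0 ≤ C := by positivity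
    calc _ ≤ Real.exp 1 * (‖l‖ ^ 3)⁻¹ * (C / ‖l‖) := by gcongr
      _ = Real.exp 1 * C * t ^ 4 * (‖vline u‖ ^ 4)⁻¹ := by
          rw [hl]; field_simp
      _ ≤ _ := by
          have := inv_norm_vline_pow_le (k := 4) (by norm_num) u
          gcongr
  have hdiff : laplaceSemigroup F t * F w - F w = ((π * t ^ 3 : ℝ) : ℂ)⁻¹ •
      ∫ u : ℝ, (Complex.exp (vline u) • (F (vline u / t) ^ 3 * F w) -
      ((t : ℂ) ^ 3 * (Complex.exp (vline u) * (vline u ^ 3)⁻¹)) • F w) := by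
    rw [integral_sub hi hci, smul_sub, ← hc, laplaceSemigroup_of_pos F ht, smul_mul_assoc,
      hF.lineIntegral_mul ht (by norm_num)]
  rw [hdiff, norm_smul, norm_inv, Complex.norm_real, Real.norm_of_nonneg (by positivity),
    inv_mul_le_iff₀ (by positivity)]
  calc _ ≤ Real.exp 1 * C * t ^ 4 * π := by
        rw [← integral_univ_inv_one_add_sq, ← integral_const_mul]
        exact norm_integral_le_of_norm_le (integrable_inv_one_add_sq.const_mul _)
          (Eventually.of_forall hpt)
    _ = _ := by ring

end InitialValue

section Generation

variable [NormedAddCommGroup X] [NormedSpace ℂ X]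

/-- `F` is the resolvent, on the open right half-plane, of the operator `A` with domain `domA`. -/
structure IsResolventOf (F : ℂ → X →L[ℂ] X) (domA : Set X) (A : X → X) : Prop where
  mem_dom : ∀ z : ℂ, 0 < z.re → ∀ y : X, F z y ∈ domA
  right_inv : ∀ z : ℂ, 0 < z.re → ∀ y : X, z • F z y - A (F z y) = y
  left_inv : ∀ z : ℂ, 0 < z.re → ∀ x ∈ domA, F z (z • x - A x) = x

namespace IsResolventOf

variable {F : ℂ → X →L[ℂ] X} {domA : Set X} {A : X → X}

lemma injective (h : IsResolventOf F domA A) {z : ℂ} (hz : 0 < z.re) :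
    Function.Injective (F z) := by
  intro x y hxy
  rw [← h.right_inv z hz x, ← h.right_inv z hz y, hxy]

lemma isSectorialResolvent (h : IsResolventOf F domA A) {M : ℝ}
    (hM : ∀ z : ℂ, 0 < z.re → ‖F z‖ ≤ M / ‖z‖) : IsSectorialResolvent F M := by
  refine ⟨fun z w hz hw => ?_, hM⟩
  ext y
  have h1 := h.left_inv z hz _ (h.mem_dom w hw y)
  have h2 := h.right_inv w hw y
  have h3 : z • F w y - A (F w y) = (z - w) • F w y + y := by
    linear_combination (norm := module) h2
  rw [h3, map_add, map_smul] at h1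
  simp only [sub_apply, smul_apply,
    mul_apply_eq_comp]
  linear_combination (norm := module) h1

end IsResolventOf

lemma IsSectorialResolvent.norm_laplaceSemigroup_le_max {F : ℂ → X →L[ℂ] X} {M : ℝ}
    (hF : IsSectorialResolvent F M) {t : ℝ} (ht : 0 ≤ t) :
    ‖laplaceSemigroup F t‖ ≤ max 1 (Real.exp 1 * M ^ 3) := by
  rcases ht.eq_or_lt with rfl | ht0
  · rw [laplaceSemigroup_zero]
    exact ContinuousLinearMap.norm_id_le.trans (le_max_left _ _)
  · exact (hF.norm_laplaceSemigroup_le ht0).trans (le_max_right _ _)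

variable [CompleteSpace X]

namespace IsSectorialResolvent

variable {F : ℂ → X →L[ℂ] X} {M : ℝ}

lemma commute_resolvent_laplaceSemigroup (hF : IsSectorialResolvent F M) {w : ℂ} (hw : 0 < w.re)
    {t : ℝ} (ht : 0 ≤ t) (x : X) :
    F w (laplaceSemigroup F t x) = laplaceSemigroup F t (F w x) := by
  have := hF.commute_laplaceSemigroup (a := F w) (fun z hz => hF.commute hw hz) ht
  exact congrArg (fun S : X →L[ℂ] X => S x) this

lemma continuousOn_laplaceSemigroup_mul (hF : IsSectorialResolvent F M) {w : ℂ}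
    (hw : 0 < w.re) :
    ContinuousOn (fun t => laplaceSemigroup F t * F w) (Ici 0) := by
  intro t ht
  rcases (show (0 : ℝ) ≤ t from ht).eq_or_lt with rfl | ht0
  · rw [ContinuousWithinAt, laplaceSemigroup_zero, one_mul, tendsto_iff_norm_sub_tendsto_zero]
    refine squeeze_zero' (Eventually.of_forall fun t => norm_nonneg _)
      (g := fun t => Real.exp 1 * ((M ^ 2 + M + 1) * (M + ‖w‖ * M * ‖F w‖)) * t) ?_ ?_
    · filter_upwards [self_mem_nhdsWithin] with t ht
      rcases (show (0 : ℝ) ≤ t from ht).eq_or_lt with rfl | ht0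
      · simp [laplaceSemigroup_zero]
      · exact hF.norm_laplaceSemigroup_mul_sub_le hw ht0
    · refine Tendsto.mono_left ?_ nhdsWithin_le_nhds
      exact Continuous.tendsto' (by fun_prop) _ _ (by simp)
  · exact (hF.hasDerivAt_laplaceSemigroup_mul hw ht0).continuousAt.continuousWithinAt

/-- Uniqueness of solutions of `y' = A y`, written in resolvent form. -/
lemma eq_laplaceSemigroup_apply (hF : IsSectorialResolvent F M)
    (hinj : Function.Injective (F 1)) {y : ℝ → X} (hy : ContinuousOn y (Ici 0))
    (hd : ∀ t : ℝ, 0 < t → HasDerivAt (fun t => F 1 (y t)) (F 1 (y t) - y t) t) {t : ℝ}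
    (ht : 0 ≤ t) : y t = laplaceSemigroup F t (y 0) := by
  rcases ht.eq_or_lt with rfl | ht0
  · simp [laplaceSemigroup_zero]
  have h1 : 0 < (1 : ℂ).re := by simp
  set P : ℝ → X →L[ℂ] X := fun t => laplaceSemigroup F t * F 1 with hP
  have hcont : ContinuousOn (fun s => P (t - s) (F 1 (y s))) (Icc 0 t) := by
    refine ContinuousOn.clm_apply ?_ ?_
    · exact (hF.continuousOn_laplaceSemigroup_mul h1).comp (by fun_prop)
        fun s hs => sub_nonneg.mpr hs.2
    · exact (F 1).continuous.comp_continuousOn (hy.mono Icc_subset_Ici_self)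
  have hderiv : ∀ s ∈ Ioo 0 t, HasDerivAt (fun s => P (t - s) (F 1 (y s))) 0 s := by
    intro s hs
    have hts : 0 < t - s := sub_pos.mpr hs.2
    have hPd : HasDerivAt (fun s => P (t - s)) (-((1 : ℂ) • P (t - s) - laplaceSemigroup F (t - s)))
        s := (hF.hasDerivAt_laplaceSemigroup_mul h1 hts).comp_const_sub t s
    have hyd := hd s hs.1
    have hPr : HasDerivAt (fun s => (P (t - s)).restrictScalars ℝ)
        ((-((1 : ℂ) • P (t - s) - laplaceSemigroup F (t - s))).restrictScalars ℝ) s :=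
      (ContinuousLinearMap.restrictScalarsL ℂ X X ℝ ℝ).hasFDerivAt.comp_hasDerivAt s hPd
    refine (hPr.clm_apply hyd).congr_deriv ?_
    simp [hP]
  have hInt := intervalIntegral.integral_eq_sub_of_hasDerivAt_of_le ht hcont hderiv (by simp)
  simp only [intervalIntegral.integral_zero, sub_self, sub_zero] at hInt
  have hfin : F 1 (F 1 (y t)) = F 1 (F 1 (laplaceSemigroup F t (y 0))) := by
    rw [hF.commute_resolvent_laplaceSemigroup h1 ht, hF.commute_resolvent_laplaceSemigroup h1 ht]
    have := sub_eq_zero.mp hInt.symm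
    simpa [hP, laplaceSemigroup_zero] using this
  exact hinj (hinj hfin)

lemma continuousOn_laplaceSemigroup_apply (hF : IsSectorialResolvent F M)
    (hdense : Dense (range (F 1))) (x : X) :
    ContinuousOn (fun t => laplaceSemigroup F t x) (Ici 0) := by
  intro t ht
  rcases (show (0 : ℝ) ≤ t from ht).eq_or_lt with rfl | ht0
  · rw [ContinuousWithinAt, laplaceSemigroup_zero, one_apply_eq_self,
      Metric.tendsto_nhds]
    intro ε hε
    set C := max 1 (Real.exp 1 * M ^ 3)
    have hC : 1 ≤ C := le_max_left _ _
    obtain ⟨_, ⟨y, rfl⟩, hy⟩ := hdense.exists_dist_lt x (show 0 < ε / (3 * C) by positivity)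
    have h1 : Tendsto (fun t => (laplaceSemigroup F t * F 1) y) (𝓝[Ici 0] 0) (𝓝 (F 1 y)) := by
      have : ContinuousOn (fun t => (laplaceSemigroup F t * F 1) y) (Ici 0) :=
        (hF.continuousOn_laplaceSemigroup_mul (w := 1) (by simp)).clm_apply continuousOn_const
      simpa [ContinuousWithinAt, laplaceSemigroup_zero] using this 0 self_mem_Ici
    filter_upwards [Metric.tendsto_nhds.mp h1 (ε / 3) (by positivity), self_mem_nhdsWithin]
      with t ht1 ht2
    have hyC : ‖x - F 1 y‖ < ε / (3 * C) := by rwa [← dist_eq_norm]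
    have e1 : ‖laplaceSemigroup F t (x - F 1 y)‖ ≤ ε / 3 := by
      calc _ ≤ C * (ε / (3 * C)) := (laplaceSemigroup F t).le_of_opNorm_le_of_le
            (hF.norm_laplaceSemigroup_le_max ht2) hyC.le
        _ = _ := by field_simp
    have e2 : ‖x - F 1 y‖ < ε / 3 := by
      refine hyC.trans_le (div_le_div_of_nonneg_left hε.le (by norm_num) (by linarith))
    rw [dist_eq_norm] at ht1 ⊢
    rw [show laplaceSemigroup F t x - x = laplaceSemigroup F t (x - F 1 y) +
      ((laplaceSemigroup F t * F 1) y - F 1 y) - (x - F 1 y) by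
        rw [map_sub, mul_apply_eq_comp]; abel]
    calc _ ≤ _ := norm_sub_le _ _
      _ ≤ _ := add_le_add_left (norm_add_le _ _) _
      _ < ε := by linarith
  · exact ((hF.continuousAt_laplaceSemigroup ht0).clm_apply
      continuousAt_const).continuousWithinAt

lemma isC0Semigroup (hF : IsSectorialResolvent F M) (hinj : Function.Injective (F 1))
    (hdense : Dense (range (F 1))) : IsC0Semigroup (laplaceSemigroup F) := by
  refine ⟨laplaceSemigroup_zero F, fun t s ht hs => ?_,
    hF.continuousOn_laplaceSemigroup_apply hdense⟩
  ext x
  have := hF.eq_laplaceSemigroup_apply hinj (y := fun r => laplaceSemigroup F (r + s) x)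
    ((hF.continuousOn_laplaceSemigroup_apply hdense x).comp (by fun_prop)
      fun r hr => add_nonneg hr hs) (fun r hr => ?_) ht
  · simpa using this
  · have hrs : 0 < r + s := add_pos_of_pos_of_nonneg hr hs
    have h1 := (hF.hasDerivAt_laplaceSemigroup_mul (w := 1) (by simp) hrs).comp_add_const r s
    have h2 : HasDerivAt (fun r => (laplaceSemigroup F (r + s) * F 1) x)
        (((1 : ℂ) • (laplaceSemigroup F (r + s) * F 1) - laplaceSemigroup F (r + s)) x) r :=
      ((ContinuousLinearMap.apply ℂ X x).restrictScalars ℝ).hasFDerivAt.comp_hasDerivAt r h1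
    rw [hF.commute_resolvent_laplaceSemigroup (by simp) hrs.le]
    refine (h2.congr_deriv (by simp)).congr_of_eventuallyEq ?_
    filter_upwards [lt_mem_nhds hr] with q hq
    rw [hF.commute_resolvent_laplaceSemigroup (by simp) (add_nonneg hq.le hs)]
    rfl

/-- A sectorial resolvent generates the semigroup given by the inverse Laplace integral. -/
lemma isGenerator (hF : IsSectorialResolvent F M) {domA : Set X} {A : X → X}
    (hA : IsResolventOf F domA A) (hdense : Dense domA) :
    IsC0Semigroup (laplaceSemigroup F) ∧ IsGenerator (laplaceSemigroup F) domA A := by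
  have hre : 0 < (1 : ℂ).re := by simp
  have hinj := hA.injective hre
  have hrange : range (F 1) = domA := by
    refine Subset.antisymm (range_subset_iff.mpr (hA.mem_dom 1 hre)) fun x hx => ?_
    exact ⟨_, hA.left_inv 1 hre x hx⟩
  rw [← hrange] at hdense
  have hdiff : ∀ y : X, Tendsto (fun t : ℝ => t⁻¹ • (laplaceSemigroup F t (F 1 y) - F 1 y))
      (𝓝[>] 0) (𝓝 (F 1 y - y)) := by
    intro y
    have hc := hF.continuousOn_laplaceSemigroup_apply hdense
    have hd : ∀ t : ℝ, 0 < t → HasDerivAt (fun t => laplaceSemigroup F t (F 1 y))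
        (laplaceSemigroup F t (F 1 y) - laplaceSemigroup F t y) t := by
      intro t ht
      have h2 : HasDerivAt (fun t => (laplaceSemigroup F t * F 1) y)
          (((1 : ℂ) • (laplaceSemigroup F t * F 1) - laplaceSemigroup F t) y) t :=
        ((ContinuousLinearMap.apply ℂ X y).restrictScalars ℝ).hasFDerivAt.comp_hasDerivAt t
          (hF.hasDerivAt_laplaceSemigroup_mul hre ht)
      simpa using h2
    have hlim : ∀ x : X, Tendsto (fun t => laplaceSemigroup F t x) (𝓝[>] 0) (𝓝 x) := by
      intro x
      have := (hc x 0 self_mem_Ici).mono_left (nhdsWithin_mono 0 Ioi_subset_Ici_self)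
      simpa [laplaceSemigroup_zero] using this
    have h0 := hasDerivWithinAt_Ici_of_tendsto_deriv (s := Ioi (0 : ℝ)) (a := 0)
      (f := fun t => laplaceSemigroup F t (F 1 y)) (e := F 1 y - y)
      (fun t ht => (hd t ht).differentiableAt.differentiableWithinAt)
      ((hc _ 0 self_mem_Ici).mono Ioi_subset_Ici_self) self_mem_nhdsWithin
      (((hlim (F 1 y)).sub (hlim y)).congr' (by
        filter_upwards [self_mem_nhdsWithin] with t ht
        exact (hd t ht).deriv.symm))
    have h1 := (hasDerivWithinAt_iff_tendsto_slope' (by simp)).mp h0.Ioi_of_Ici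
    refine h1.congr fun t => ?_
    simp [slope_def_module, laplaceSemigroup_zero]
  refine ⟨hF.isC0Semigroup hinj hdense, fun x => ⟨fun hx => ?_, fun ⟨z, hz⟩ => ?_⟩, fun x hx => ?_⟩
  · rw [← hrange] at hx
    obtain ⟨y, rfl⟩ := hx
    exact ⟨_, hdiff y⟩
  · have h1 : Tendsto (fun t : ℝ => F 1 (t⁻¹ • (laplaceSemigroup F t x - x))) (𝓝[>] 0)
      (𝓝 (F 1 z)) := ((F 1).continuous.tendsto z).comp hz
    have h2 := tendsto_nhds_unique (h1.congr' (by
      filter_upwards [self_mem_nhdsWithin] with t ht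
      rw [ContinuousLinearMap.map_smul_of_tower, map_sub,
        hF.commute_resolvent_laplaceSemigroup hre (le_of_lt ht)])) (hdiff x)
    rw [show x = F 1 (x - z) by rw [map_sub, h2]; abel]
    exact hA.mem_dom 1 hre _
  · have h1 := hA.left_inv 1 hre x hx
    have h2 := hdiff ((1 : ℂ) • x - A x)
    rw [h1] at h2
    simpa using h2

end IsSectorialResolvent

end Generation

section AnalyticBounds

/-- The bounds, uniform up to time zero and infinity, which a bounded analytic semigroup satisfies
along the positive half-line. -/
structure HasParabolicBounds {E : Type*} [NormedAddCommGroup E] [NormedSpace ℂ E]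
    (R R₁ R₂ : ℝ → E) (C : ℝ) : Prop where
  hasDerivAt : ∀ t : ℝ, 0 < t → HasDerivAt R (R₁ t) t
  hasDerivAt_deriv : ∀ t : ℝ, 0 < t → HasDerivAt R₁ (R₂ t) t
  continuousOn : ContinuousOn R₂ (Ioi 0)
  bound : ∀ t : ℝ, 0 < t → ‖R t‖ ≤ C
  bound_deriv : ∀ t : ℝ, 0 < t → ‖R₁ t‖ ≤ C / t
  bound_deriv_two : ∀ t : ℝ, 0 < t → ‖R₂ t‖ ≤ C / t ^ 2

lemma norm_one_le_one [NormedAddCommGroup X] [NormedSpace ℂ X] : ‖(1 : X →L[ℂ] X)‖ ≤ 1 :=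
  ContinuousLinearMap.norm_id_le

variable [NormedAddCommGroup X] [NormedSpace ℂ X]

lemma natCast_mul_mem_CSector {δ : ℝ} {z : ℂ} (hz : z ∈ CSector δ) {n : ℕ} (hn : 0 < n) :
    (n : ℂ) * z ∈ CSector δ := by
  refine ⟨mul_ne_zero (by exact_mod_cast hn.ne') hz.1, ?_⟩
  have := Complex.arg_real_mul z (show (0 : ℝ) < n by exact_mod_cast hn)
  rw [Complex.ofReal_natCast] at this
  rw [this]
  exact hz.2

lemma map_natCast_mul_of_sector {S : ℂ → X →L[ℂ] X} {δ : ℝ}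
    (h : ∀ z ∈ CSector δ, ∀ w ∈ CSector δ, S (z + w) = (S z).comp (S w)) {z : ℂ}
    (hz : z ∈ CSector δ) {n : ℕ} (hn : 0 < n) : S (n * z) = S z ^ n := by
  induction n, hn using Nat.le_induction with
  | base => simp
  | succ n hn ih =>
    rw [Nat.cast_succ, add_mul, one_mul, h _ (natCast_mul_mem_CSector hz hn) _ hz, ih, pow_succ]
    rfl

lemma exists_norm_le_exp_of_sector {S : ℂ → X →L[ℂ] X} {δ C : ℝ}
    (h : ∀ z ∈ CSector δ, ∀ w ∈ CSector δ, S (z + w) = (S z).comp (S w))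
    (hC : ∀ z ∈ CSector δ, ‖z‖ ≤ 1 → ‖S z‖ ≤ C) :
    ∃ c : ℝ, 0 ≤ c ∧ ∀ z ∈ CSector δ, ‖S z‖ ≤ Real.exp (c * (‖z‖ + 1)) := by
  set C' := max 1 C
  have hC' : 1 ≤ C' := le_max_left _ _
  refine ⟨Real.log C', Real.log_nonneg hC', fun z hz => ?_⟩
  set n := ⌈‖z‖⌉₊
  have hzn : 0 < ‖z‖ := norm_pos_iff.mpr hz.1
  have hn : 0 < n := Nat.ceil_pos.mpr hzn
  have hn0 : (0 : ℝ) < n := by exact_mod_cast hn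
  have hmem : z / n ∈ CSector δ := by
    refine ⟨div_ne_zero hz.1 (by exact_mod_cast hn.ne'), ?_⟩
    have := Complex.arg_real_mul z (inv_pos.mpr hn0)
    rw [Complex.ofReal_inv, Complex.ofReal_natCast, inv_mul_eq_div] at this
    rw [this]
    exact hz.2
  have hnorm : ‖z / n‖ ≤ 1 := by
    rw [norm_div, Complex.norm_natCast, div_le_one hn0]
    exact Nat.le_ceil _
  have hSz : S z = S (z / n) ^ n := by
    rw [← map_natCast_mul_of_sector h hmem hn, mul_div_cancel₀ _ (by exact_mod_cast hn.ne')]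
  rw [hSz]
  calc ‖S (z / n) ^ n‖ ≤ ‖S (z / n)‖ ^ n := norm_pow_le' _ hn
    _ ≤ C' ^ n := by gcongr; exact (hC _ hmem hnorm).trans (le_max_right _ _)
    _ = Real.exp (Real.log C' * n) := by
      rw [Real.exp_mul, Real.exp_log (by linarith), Real.rpow_natCast]
    _ ≤ _ := Real.exp_le_exp.mpr (mul_le_mul_of_nonneg_left (Nat.ceil_lt_add_one hzn.le).le
        (Real.log_nonneg hC'))

lemma exists_radius_mem_CSector {δ : ℝ} (hδ : 0 < δ) :
    ∃ r : ℝ, 0 < r ∧ r ≤ 1 / 2 ∧ ∀ t : ℝ, 0 < t → ∀ z : ℂ, ‖z - t‖ ≤ r * t →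
      z ∈ CSector δ ∧ ‖z‖ ≤ 3 * z.re := by
  have hc : ContinuousAt Complex.arg 1 := Complex.continuousAt_arg (by simp)
  obtain ⟨ρ, hρ, h⟩ := Metric.continuousAt_iff.mp hc δ hδ
  refine ⟨min (ρ / 2) (1 / 2), by positivity, min_le_right _ _, fun t ht z hz => ?_⟩
  have hz1 : ‖z - t‖ ≤ ρ / 2 * t := hz.trans (by gcongr; exact min_le_left _ _)
  have hz2 : ‖z - t‖ ≤ 1 / 2 * t := hz.trans (by gcongr; exact min_le_right _ _)
  have hre : t / 2 ≤ z.re := by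
    have := (abs_le.mp ((Complex.abs_re_le_norm (z - t)).trans hz2)).1
    rw [Complex.sub_re, Complex.ofReal_re] at this
    linarith
  have hnorm : ‖z‖ ≤ 3 / 2 * t := by
    have := norm_add_le (z - t) t
    rw [sub_add_cancel, Complex.norm_real, Real.norm_of_nonneg ht.le] at this
    linarith
  refine ⟨⟨fun h0 => ?_, ?_⟩, by linarith⟩
  · rw [h0, Complex.zero_re] at hre
    linarith
  · have ht' : (t : ℂ) ≠ 0 := by exact_mod_cast ht.ne'
    have h1 : dist (z / t) 1 < ρ := by
      rw [dist_eq_norm, div_sub_one ht', norm_div, Complex.norm_real, Real.norm_of_nonneg ht.le,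
        div_lt_iff₀ ht]
      nlinarith
    have h2 := h h1
    rw [Complex.arg_one, dist_zero_right, Real.norm_eq_abs] at h2
    have := Complex.arg_real_mul z (inv_pos.mpr ht)
    rw [Complex.ofReal_inv, inv_mul_eq_div] at this
    rw [this] at h2
    exact h2.le

variable [CompleteSpace X]

lemma IsAnalyticSG.exists_hasParabolicBounds {T : ℝ → X →L[ℂ] X} {S : ℂ → X →L[ℂ] X} {δ : ℝ}
    (hδ : 0 < δ) (hS : IsAnalyticSG T δ S) :
    ∃ w C : ℝ, ∃ R₁ R₂ : ℝ → X →L[ℂ] X,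
      HasParabolicBounds (fun t : ℝ => Complex.exp (-(w * t)) • T t) R₁ R₂ C := by
  obtain ⟨hST, hdiff, hmul, hbd⟩ := hS
  obtain ⟨⟨C₀, hC₀⟩, -⟩ := hbd (δ / 2) (by linarith) (by linarith)
  have hsub : CSector (δ / 2) ⊆ CSector δ := fun z hz => ⟨hz.1, hz.2.trans (by linarith)⟩
  obtain ⟨c, hc0, hc⟩ := exists_norm_le_exp_of_sector
    (fun z hz w hw => hmul z (hsub hz) w (hsub hw)) hC₀
  obtain ⟨r, hr0, hr1, hr⟩ := exists_radius_mem_CSector (show 0 < δ / 2 by linarith)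
  set U : Set ℂ := {z : ℂ | ∃ t : ℝ, 0 < t ∧ ‖z - t‖ < r * t} with hU
  have hUo : IsOpen U := by
    have : U = ⋃ t : {t : ℝ // 0 < t}, Metric.ball ((t : ℝ) : ℂ) (r * t) := by
      ext z
      simp [hU, dist_eq_norm]
    rw [this]
    exact isOpen_iUnion fun t => Metric.isOpen_ball
  set s : ℂ → X →L[ℂ] X := fun z => Complex.exp (-(((3 * c : ℝ) : ℂ) * z)) • S z with hs
  have hsec : ∀ z ∈ CSector (δ / 2), z ∈ {z : ℂ | z ≠ 0 ∧ |Complex.arg z| < δ} :=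
    fun z hz => ⟨hz.1, hz.2.trans_lt (by linarith)⟩
  have hsd : DifferentiableOn ℂ s {z : ℂ | z ≠ 0 ∧ |Complex.arg z| < δ} :=
    (show Differentiable ℂ fun z : ℂ => Complex.exp (-(((3 * c : ℝ) : ℂ) * z)) by
      fun_prop).differentiableOn.smul hdiff
  have hUs : U ⊆ {z : ℂ | z ≠ 0 ∧ |Complex.arg z| < δ} := by
    rintro z ⟨t, ht, hz⟩
    exact hsec z (hr t ht z hz.le).1
  have hsU : DifferentiableOn ℂ s U := hsd.mono hUs
  have hs1 : DifferentiableOn ℂ (deriv s) U := hsU.deriv hUo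
  have hs2 : DifferentiableOn ℂ (deriv (deriv s)) U := hs1.deriv hUo
  have hbound : ∀ t : ℝ, 0 < t → ∀ z : ℂ, ‖z - t‖ ≤ r * t → ‖s z‖ ≤ Real.exp c := by
    intro t ht z hz
    obtain ⟨h1, h2⟩ := hr t ht z hz
    rw [hs, norm_smul, Complex.norm_exp, Complex.neg_re, Complex.re_ofReal_mul]
    calc _ ≤ Real.exp (-(3 * c * z.re)) * Real.exp (c * (‖z‖ + 1)) := by gcongr; exact hc z h1
      _ = Real.exp (c + c * (‖z‖ - 3 * z.re)) := by rw [← Real.exp_add]; ring_nf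
      _ ≤ _ := Real.exp_le_exp.mpr (by nlinarith)
  have htU : ∀ t : ℝ, 0 < t → (t : ℂ) ∈ U := fun t ht => ⟨t, ht, by simp; positivity⟩
  have hdc : ∀ t : ℝ, 0 < t → DiffContOnCl ℂ s (Metric.ball (t : ℂ) (r * t)) := by
    intro t ht
    refine (hsd.mono ?_).diffContOnCl_ball (U := Metric.closedBall (t : ℂ) (r * t)) subset_rfl
    intro z hz
    rw [mem_closedBall_iff_norm] at hz
    exact hsec z (hr t ht z hz).1
  have hcauchy : ∀ (n : ℕ) (t : ℝ), 0 < t →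
      ‖iteratedDeriv n s t‖ ≤ n.factorial * Real.exp c / (r * t) ^ n := fun n t ht =>
    Complex.norm_iteratedDeriv_le_of_forall_mem_sphere_norm_le n (by positivity) (hdc t ht)
      fun z hz => hbound t ht z (mem_sphere_iff_norm.mp hz).le
  have hdat : ∀ {f : ℂ → X →L[ℂ] X}, DifferentiableOn ℂ f U → ∀ t : ℝ, 0 < t →
      HasDerivAt (fun t : ℝ => f t) (deriv f t) t := fun hf t ht => by
    have := (hf.differentiableAt (hUo.mem_nhds (htU t ht))).hasDerivAt.scomp t
      Complex.ofRealCLM.hasDerivAt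
    exact this.congr_deriv (one_smul _ _)
  have hr2 : r ^ 2 ≤ 1 := by nlinarith
  have hexp := Real.exp_pos c
  refine ⟨3 * c, 2 * Real.exp c / r ^ 2, fun t => deriv s t, fun t => deriv (deriv s) t,
    fun t ht => ?_, hdat hs1, ?_, fun t ht => ?_, fun t ht => ?_, fun t ht => ?_⟩
  · refine (hdat hsU t ht).congr_of_eventuallyEq ?_
    filter_upwards [lt_mem_nhds ht] with q hq
    simp only [hs, hST q hq.le]
  · exact hs2.continuousOn.comp (Complex.continuous_ofReal.continuousOn) fun t ht => htU t ht
  · have h1 := hbound t ht t (by simp; positivity)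
    simp only [hs, hST t ht.le] at h1
    refine h1.trans ?_
    rw [le_div_iff₀ (by positivity)]
    nlinarith
  · have h1 := hcauchy 1 t ht
    rw [iteratedDeriv_one, Nat.factorial_one, Nat.cast_one, one_mul, pow_one] at h1
    refine h1.trans ?_
    rw [div_div, div_le_div_iff₀ (by positivity) (by positivity)]
    have : r ^ 2 * t * Real.exp c ≤ 2 * (r * t) * Real.exp c := by
      refine mul_le_mul_of_nonneg_right ?_ hexp.le
      nlinarith [mul_pos hr0 ht]
    linarith
  · have h1 := hcauchy 2 t ht
    rw [iteratedDeriv_succ, iteratedDeriv_one] at h1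
    refine h1.trans (le_of_eq ?_)
    rw [mul_pow, div_div]
    norm_num [Nat.factorial]

end AnalyticBounds

section Laplace

lemma norm_exp_neg_mul_ofReal (μ : ℂ) (t : ℝ) :
    ‖Complex.exp (-(μ * t))‖ = Real.exp (-(μ.re * t)) := by
  rw [Complex.norm_exp, Complex.neg_re, Complex.re_mul_ofReal]

lemma norm_exp_neg_mul_ofReal_le_one {μ : ℂ} (hμ : 0 < μ.re) {t : ℝ} (ht : 0 < t) :
    ‖Complex.exp (-(μ * t))‖ ≤ 1 := by
  rw [norm_exp_neg_mul_ofReal, Real.exp_le_one_iff]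
  have := mul_pos hμ ht
  linarith

lemma hasDerivAt_exp_neg_mul_ofReal (μ : ℂ) (t : ℝ) :
    HasDerivAt (fun t : ℝ => Complex.exp (-(μ * t))) (-μ * Complex.exp (-(μ * t))) t := by
  have h : HasDerivAt (fun t : ℝ => -(μ * (t : ℂ))) (-(μ * 1)) t :=
    (Complex.ofRealCLM.hasDerivAt.const_mul μ).neg
  refine h.cexp.congr_deriv ?_
  ring

lemma integrableOn_exp_smul {E : Type*} [NormedAddCommGroup E] [NormedSpace ℂ E] {R : ℝ → E}
    {C : ℝ} {μ : ℂ} (hμ : 0 < μ.re) (hc : ContinuousOn R (Ioi 0))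
    (hb : ∀ t : ℝ, 0 < t → ‖R t‖ ≤ C) :
    IntegrableOn (fun t : ℝ => Complex.exp (-(μ * t)) • R t) (Ioi 0) := by
  refine Integrable.mono' (g := fun t => C * Real.exp (-(μ.re * t))) ?_ ?_ ?_
  · refine Integrable.const_mul ?_ C
    simpa [IntegrableOn] using exp_neg_integrableOn_Ioi 0 hμ
  · exact (ContinuousOn.smul (by fun_prop) hc).aestronglyMeasurable measurableSet_Ioi
  · filter_upwards [ae_restrict_mem measurableSet_Ioi] with t ht
    rw [norm_smul, norm_exp_neg_mul_ofReal, mul_comm]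
    gcongr
    exact hb t ht

lemma integral_Ioi_const_div_sq {C h : ℝ} (hh : 0 < h) :
    IntegrableOn (fun t : ℝ => C / t ^ 2) (Ioi h) ∧ ∫ t in Ioi h, C / t ^ 2 = C / h := by
  have h1 : IntegrableOn (fun t : ℝ => t ^ (-2 : ℝ)) (Ioi h) :=
    integrableOn_Ioi_rpow_of_lt (by norm_num) hh
  have h2 : ∫ t in Ioi h, t ^ (-2 : ℝ) = h⁻¹ := by
    rw [integral_Ioi_rpow_of_lt (by norm_num) hh]
    norm_num [Real.rpow_neg_one]
  have h3 : EqOn (fun t : ℝ => C * t ^ (-2 : ℝ)) (fun t : ℝ => C / t ^ 2) (Ioi h) := by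
    intro t ht
    have ht0 : 0 ≤ t := (hh.trans ht).le
    simp only [Real.rpow_neg ht0, Real.rpow_two, div_eq_mul_inv]
  refine ⟨IntegrableOn.congr_fun (h1.const_mul C) h3 measurableSet_Ioi, ?_⟩
  rw [← setIntegral_congr_fun measurableSet_Ioi h3, integral_const_mul, h2, div_eq_mul_inv]

lemma HasParabolicBounds.norm_laplace_le {E : Type*} [NormedAddCommGroup E] [NormedSpace ℂ E]
    [CompleteSpace E] {R R₁ R₂ : ℝ → E} {C : ℝ} (hR : HasParabolicBounds R R₁ R₂ C) {μ : ℂ}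
    (hμ : 0 < μ.re) : ‖∫ t in Ioi (0 : ℝ), Complex.exp (-(μ * t)) • R t‖ ≤ 4 * C / ‖μ‖ := by
  have hμ0 : μ ≠ 0 := by
    rintro rfl
    simp at hμ
  have hμn : 0 < ‖μ‖ := norm_pos_iff.mpr hμ0
  have hC : 0 ≤ C := (norm_nonneg _).trans (hR.bound 1 one_pos)
  set h := ‖μ‖⁻¹
  have hh : 0 < h := inv_pos.mpr hμn
  have hRc : ContinuousOn R (Ioi 0) := fun t ht =>
    (hR.hasDerivAt t ht).continuousAt.continuousWithinAt
  have hInt := integrableOn_exp_smul hμ hRc hR.bound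
  have hInt1 : IntegrableOn (fun t : ℝ => Complex.exp (-(μ * t)) • R t) (Ioi h) :=
    hInt.mono_set (Ioi_subset_Ioi hh.le)
  have hb2 : ∀ t ∈ Ioi h, ‖Complex.exp (-(μ * t)) • R₂ t‖ ≤ C / t ^ 2 := by
    intro t ht
    have ht0 : 0 < t := hh.trans ht
    rw [norm_smul]
    calc _ ≤ 1 * (C / t ^ 2) := by
          gcongr
          · exact norm_exp_neg_mul_ofReal_le_one hμ ht0
          · exact hR.bound_deriv_two t ht0
      _ = _ := one_mul _
  obtain ⟨hsq, hsqv⟩ := integral_Ioi_const_div_sq (C := C) hh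
  have hInt2 : IntegrableOn (fun t : ℝ => Complex.exp (-(μ * t)) • R₂ t) (Ioi h) := by
    refine Integrable.mono' hsq ?_ ?_
    · exact (ContinuousOn.smul (by fun_prop)
        (hR.continuousOn.mono (Ioi_subset_Ioi hh.le))).aestronglyMeasurable measurableSet_Ioi
    · filter_upwards [ae_restrict_mem measurableSet_Ioi] with t ht using hb2 t ht
  have hn2 : ‖∫ t in Ioi h, Complex.exp (-(μ * t)) • R₂ t‖ ≤ C / h := by
    rw [← hsqv]
    refine norm_integral_le_of_norm_le hsq ?_
    filter_upwards [ae_restrict_mem measurableSet_Ioi] with t ht using hb2 t ht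
  set G : ℝ → E := fun t => Complex.exp (-(μ * t)) • (R t + μ⁻¹ • R₁ t) with hG
  have hGd : ∀ t : ℝ, 0 < t → HasDerivAt G
      (-(μ • (Complex.exp (-(μ * t)) • R t)) + μ⁻¹ • (Complex.exp (-(μ * t)) • R₂ t)) t := by
    intro t ht
    refine ((hasDerivAt_exp_neg_mul_ofReal μ t).smul ((hR.hasDerivAt t ht).add
      ((hR.hasDerivAt_deriv t ht).const_smul μ⁻¹))).congr_deriv ?_
    have e : (-μ * Complex.exp (-(μ * t))) • μ⁻¹ • R₁ t = -(Complex.exp (-(μ * t)) • R₁ t) := by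
      rw [smul_smul, ← neg_smul]
      congr 1
      field_simp
    rw [smul_add, Pi.add_apply, Pi.smul_apply, smul_add, e]
    module
  have hGb : ∀ t ∈ Ici h, ‖G t‖ ≤ Real.exp (-(μ.re * t)) * (2 * C) := by
    intro t ht
    have ht0 : 0 < t := hh.trans_le ht
    rw [hG, norm_smul, norm_exp_neg_mul_ofReal]
    gcongr
    refine (norm_add_le _ _).trans ?_
    have h1 := hR.bound t ht0
    have h2 : ‖μ⁻¹ • R₁ t‖ ≤ C := by
      rw [norm_smul, norm_inv]
      calc h * ‖R₁ t‖ ≤ t * (C / t) := by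
            gcongr
            · exact ht
            · exact hR.bound_deriv t ht0
        _ = C := by field_simp
    linarith
  have hGt : Tendsto G atTop (𝓝 0) := by
    have hl : Tendsto (fun t : ℝ => Real.exp (-(μ.re * t)) * (2 * C)) atTop (𝓝 0) := by
      have := (Real.tendsto_exp_neg_atTop_nhds_zero.comp
        (tendsto_id.const_mul_atTop hμ)).mul_const (2 * C)
      simpa using this
    refine squeeze_zero_norm' ?_ hl
    filter_upwards [Ici_mem_atTop h] with t ht using hGb t ht
  have hftc := integral_Ioi_of_hasDerivAt_of_tendsto
    (hGd h hh).continuousAt.continuousWithinAt (fun t ht => hGd t (hh.trans ht))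
    ((hInt1.smul μ).neg.add (hInt2.smul μ⁻¹)) hGt
  have hi1 : IntegrableOn (fun t : ℝ => -(μ • (Complex.exp (-(μ * t)) • R t))) (Ioi h) :=
    (hInt1.smul μ).neg
  have hi2 : IntegrableOn (fun t : ℝ => μ⁻¹ • (Complex.exp (-(μ * t)) • R₂ t)) (Ioi h) :=
    hInt2.smul μ⁻¹
  rw [integral_add hi1 hi2, integral_neg, integral_smul,
    integral_smul] at hftc
  have hGh : ‖G h‖ ≤ 2 * C := by
    refine (hGb h self_mem_Ici).trans ?_
    have : Real.exp (-(μ.re * h)) ≤ 1 := by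
      rw [Real.exp_le_one_iff]
      have := mul_pos hμ hh
      linarith
    nlinarith
  have htail : ‖μ‖ * ‖∫ t in Ioi h, Complex.exp (-(μ * t)) • R t‖ ≤ 3 * C := by
    rw [← norm_smul]
    have e : μ • ∫ t in Ioi h, Complex.exp (-(μ * t)) • R t =
        μ⁻¹ • (∫ t in Ioi h, Complex.exp (-(μ * t)) • R₂ t) + G h := by
      linear_combination (norm := module) -hftc
    rw [e]
    refine (norm_add_le _ _).trans ?_
    rw [norm_smul, norm_inv]
    have : h * ‖∫ t in Ioi h, Complex.exp (-(μ * t)) • R₂ t‖ ≤ h * (C / h) := by gcongr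
    rw [mul_div_cancel₀ _ hh.ne'] at this
    linarith
  have hhead : ‖∫ t in Ioc 0 h, Complex.exp (-(μ * t)) • R t‖ ≤ C * h := by
    have := norm_setIntegral_le_of_norm_le_const (μ := volume) (s := Ioc 0 h) (C := C)
      (f := fun t : ℝ => Complex.exp (-(μ * t)) • R t) (by simp) (fun t ht => ?_)
    · simpa [hh.le] using this
    · rw [norm_smul]
      calc _ ≤ 1 * C := by
            gcongr
            · exact norm_exp_neg_mul_ofReal_le_one hμ ht.1
            · exact hR.bound t ht.1
        _ = C := one_mul _
  rw [← Ioc_union_Ioi_eq_Ioi hh.le, setIntegral_union (Ioc_disjoint_Ioi le_rfl) measurableSet_Ioi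
    (hInt.mono_set Ioc_subset_Ioi_self) hInt1, le_div_iff₀ hμn]
  have hhμ : h * ‖μ‖ = 1 := inv_mul_cancel₀ hμn.ne'
  calc _ ≤ (C * h + ‖∫ t in Ioi h, Complex.exp (-(μ * t)) • R t‖) * ‖μ‖ := by
        gcongr
        exact (norm_add_le _ _).trans (by gcongr)
    _ ≤ _ := by linear_combination htail + C * hhμ

end Laplace

section SemigroupResolvent

variable [NormedAddCommGroup X] [NormedSpace ℂ X]

lemma IsC0Semigroup.rescale {T : ℝ → X →L[ℂ] X} (hT : IsC0Semigroup T) (a : ℂ) :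
    IsC0Semigroup fun t : ℝ => Complex.exp (-(a * t)) • T t := by
  obtain ⟨h0, hadd, hc⟩ := hT
  refine ⟨by simp [h0], fun t s ht hs => ?_, fun x => ?_⟩
  · ext x
    simp only [hadd t s ht hs, smul_apply, ContinuousLinearMap.comp_apply, map_smul, smul_smul,
      ← Complex.exp_add]
    congr 2
    push_cast
    ring
  · exact ContinuousOn.smul (by fun_prop) (hc x)

lemma tendsto_slope_rescale {f : ℝ → X} {x y : X} (a : ℂ)
    (h : Tendsto (fun t : ℝ => t⁻¹ • (f t - x)) (𝓝[>] 0) (𝓝 y)) :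
    Tendsto (fun t : ℝ => t⁻¹ • (Complex.exp (-(a * t)) • f t - x)) (𝓝[>] 0)
      (𝓝 (y - a • x)) := by
  have h1 : Tendsto (fun t : ℝ => Complex.exp (-(a * t))) (𝓝[>] 0) (𝓝 1) :=
    (Continuous.tendsto' (by fun_prop) _ _ (by simp)).mono_left nhdsWithin_le_nhds
  have h2 : Tendsto (fun t : ℝ => t⁻¹ • (Complex.exp (-(a * t)) - 1)) (𝓝[>] 0) (𝓝 (-a)) := by
    have := (hasDerivAt_exp_neg_mul_ofReal a 0).tendsto_slope_zero_right
    simpa using this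
  have h3 := (h1.smul h).add (h2.smul (tendsto_const_nhds (x := x)))
  rw [one_smul, neg_smul, ← sub_eq_add_neg] at h3
  refine h3.congr fun t => ?_
  rw [smul_comm, smul_assoc, ← smul_add]
  congr 1
  module

lemma IsGenerator.rescale {T : ℝ → X →L[ℂ] X} {domA : Set X} {A : X → X}
    (hA : IsGenerator T domA A) (a : ℂ) :
    IsGenerator (fun t : ℝ => Complex.exp (-(a * t)) • T t) domA fun x => A x - a • x := by
  refine ⟨fun x => ?_, fun x hx => tendsto_slope_rescale a (hA.2 x hx)⟩
  rw [hA.1 x]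
  refine ⟨fun ⟨y, hy⟩ => ⟨_, tendsto_slope_rescale a hy⟩, fun ⟨y, hy⟩ => ?_⟩
  refine ⟨_, (tendsto_slope_rescale (-a) hy).congr fun t => ?_⟩
  rw [smul_apply, smul_smul, ← Complex.exp_add]
  simp

lemma IsC0Semigroup.commute {V : ℝ → X →L[ℂ] X} (hV : IsC0Semigroup V) {t s : ℝ} (ht : 0 ≤ t)
    (hs : 0 ≤ s) (x : X) : V t (V s x) = V s (V t x) := by
  have h1 := hV.2.1 t s ht hs
  rw [add_comm, hV.2.1 s t hs ht] at h1
  exact (congrArg (fun S : X →L[ℂ] X => S x) h1).symm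

/-- The Laplace transform of an operator family. -/
noncomputable def laplaceResolvent (V : ℝ → X →L[ℂ] X) (z : ℂ) : X →L[ℂ] X :=
  ∫ t in Ioi (0 : ℝ), Complex.exp (-(z * t)) • V t

/-- A bounded strongly continuous semigroup which is norm continuous at positive times. -/
structure IsBoundedImmediatelyContinuous (V : ℝ → X →L[ℂ] X) (C : ℝ) : Prop where
  isC0Semigroup : IsC0Semigroup V
  continuousOn : ContinuousOn V (Ioi 0)
  bound : ∀ t : ℝ, 0 < t → ‖V t‖ ≤ C

namespace IsBoundedImmediatelyContinuous

variable {V : ℝ → X →L[ℂ] X} {C : ℝ}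

lemma integrableOn_apply (hV : IsBoundedImmediatelyContinuous V C) {z : ℂ} (hz : 0 < z.re)
    (x : X) : IntegrableOn (fun t : ℝ => Complex.exp (-(z * t)) • V t x) (Ioi 0) := by
  have := (integrableOn_exp_smul hz hV.continuousOn hV.bound).integrable.apply_continuousLinearMap x
  simpa [IntegrableOn] using this

lemma laplaceResolvent_apply (hV : IsBoundedImmediatelyContinuous V C) {z : ℂ} (hz : 0 < z.re)
    (x : X) : laplaceResolvent V z x = ∫ t in Ioi (0 : ℝ), Complex.exp (-(z * t)) • V t x := by
  rw [laplaceResolvent,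
    ContinuousLinearMap.integral_apply (integrableOn_exp_smul hz hV.continuousOn hV.bound)]
  rfl

variable [CompleteSpace X]

lemma commute_laplaceResolvent (hV : IsBoundedImmediatelyContinuous V C) {z : ℂ} (hz : 0 < z.re)
    {h : ℝ} (hh : 0 ≤ h) (x : X) :
    laplaceResolvent V z (V h x) = V h (laplaceResolvent V z x) := by
  rw [hV.laplaceResolvent_apply hz, hV.laplaceResolvent_apply hz,
    ← (V h).integral_comp_comm (hV.integrableOn_apply hz x)]
  refine setIntegral_congr_fun measurableSet_Ioi fun t ht => ?_
  simp only [map_smul, hV.isC0Semigroup.commute hh (le_of_lt ht)]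

lemma apply_laplaceResolvent (hV : IsBoundedImmediatelyContinuous V C) {z : ℂ} (hz : 0 < z.re)
    {h : ℝ} (hh : 0 ≤ h) (x : X) :
    V h (laplaceResolvent V z x) = Complex.exp (z * h) •
      (laplaceResolvent V z x - ∫ t in (0 : ℝ)..h, Complex.exp (-(z * t)) • V t x) := by
  have hInt := hV.integrableOn_apply hz x
  rw [hV.laplaceResolvent_apply hz, ← intervalIntegral.integral_Ioi_sub_Ioi hInt hh, sub_sub_cancel,
    ← (V h).integral_comp_comm hInt, ← integral_smul]
  have := (measurePreserving_add_right volume h).setIntegral_preimage_emb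
    (measurableEmbedding_addRight h)
    (fun t : ℝ => Complex.exp (z * h) • Complex.exp (-(z * t)) • V t x) (Ioi h)
  rw [preimage_add_const_Ioi, sub_self] at this
  rw [← this]
  refine setIntegral_congr_fun measurableSet_Ioi fun t ht => ?_
  simp only [map_smul, add_comm t h, hV.isC0Semigroup.2.1 h t hh (le_of_lt ht),
    ContinuousLinearMap.comp_apply, smul_smul, ← Complex.exp_add]
  congr 2
  push_cast
  ring

lemma exists_primitive (hV : IsBoundedImmediatelyContinuous V C) (z : ℂ) (x : X) :
    ∃ G : ℝ → X, (∀ h : ℝ, 0 ≤ h → G h = ∫ t in (0 : ℝ)..h, Complex.exp (-(z * t)) • V t x) ∧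
      ∀ h : ℝ, 0 ≤ h → HasDerivAt G (Complex.exp (-(z * h)) • V h x) h := by
  have hcont : Continuous fun t : ℝ => Complex.exp (-(z * t)) • V (max t 0) x := by
    refine Continuous.smul (by fun_prop) ?_
    exact (hV.isC0Semigroup.2.2 x).comp_continuous (by fun_prop) fun t => le_max_right t 0
  refine ⟨fun h => ∫ t in (0 : ℝ)..h, Complex.exp (-(z * t)) • V (max t 0) x, fun h hh => ?_,
    fun h hh => ?_⟩
  · refine intervalIntegral.integral_congr fun t ht => ?_
    rw [uIcc_of_le hh] at ht
    simp only [max_eq_left ht.1]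
  · have := (hcont.integral_hasStrictDerivAt 0 h).hasDerivAt
    rwa [max_eq_left hh] at this

lemma tendsto_slope_laplaceResolvent (hV : IsBoundedImmediatelyContinuous V C) {z : ℂ}
    (hz : 0 < z.re) (x : X) :
    Tendsto (fun t : ℝ => t⁻¹ • (V t (laplaceResolvent V z x) - laplaceResolvent V z x))
      (𝓝[>] 0) (𝓝 (z • laplaceResolvent V z x - x)) := by
  obtain ⟨G, hG, hGd⟩ := hV.exists_primitive z x
  have hG0 : G 0 = 0 := by simp [hG 0 le_rfl]
  have h1 := hasDerivAt_exp_neg_mul_ofReal (-z) 0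
  have h2 := h1.smul ((hGd 0 le_rfl).const_sub (laplaceResolvent V z x))
  have h3 := h2.tendsto_slope_zero_right
  have e : Complex.exp (-(-z * (0 : ℝ))) • -(Complex.exp (-(z * (0 : ℝ))) • V 0 x) +
      (-(-z) * Complex.exp (-(-z * (0 : ℝ)))) • (laplaceResolvent V z x - G 0) =
      z • laplaceResolvent V z x - x := by
    simp [hG0, hV.isC0Semigroup.1]
    abel
  rw [e] at h3
  refine h3.congr' ?_
  filter_upwards [self_mem_nhdsWithin] with t ht
  have ht0 : 0 ≤ t := le_of_lt ht
  rw [hV.apply_laplaceResolvent hz ht0, ← hG t ht0]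
  simp [hG0]

/-- The Laplace transform is the resolvent of the generator. -/
lemma isResolventOf (hV : IsBoundedImmediatelyContinuous V C) {domA : Set X} {A : X → X}
    (hA : IsGenerator V domA A) : IsResolventOf (laplaceResolvent V) domA A := by
  have hmem : ∀ z : ℂ, 0 < z.re → ∀ y : X, laplaceResolvent V z y ∈ domA := fun z hz y =>
    (hA.1 _).mpr ⟨_, hV.tendsto_slope_laplaceResolvent hz y⟩
  have heq : ∀ z : ℂ, 0 < z.re → ∀ y : X,
      A (laplaceResolvent V z y) = z • laplaceResolvent V z y - y := fun z hz y =>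
    tendsto_nhds_unique (hA.2 _ (hmem z hz y)) (hV.tendsto_slope_laplaceResolvent hz y)
  refine ⟨hmem, fun z hz y => by rw [heq z hz]; abel, fun z hz x hx => ?_⟩
  have h1 := ((laplaceResolvent V z).continuous.tendsto _).comp (hA.2 x hx)
  have h2 := hV.tendsto_slope_laplaceResolvent hz x
  have h3 : laplaceResolvent V z (A x) = z • laplaceResolvent V z x - x := by
    refine tendsto_nhds_unique (h1.congr' ?_) h2
    filter_upwards [self_mem_nhdsWithin] with t ht
    rw [Function.comp_apply, ContinuousLinearMap.map_smul_of_tower, map_sub,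
      hV.commute_laplaceResolvent hz (le_of_lt ht)]
  rw [map_sub, map_smul, h3]
  abel

lemma dense_range_laplaceResolvent (hV : IsBoundedImmediatelyContinuous V C) {z : ℂ}
    (hz : 0 < z.re) : Dense (range (laplaceResolvent V z)) := by
  intro x
  obtain ⟨G, hG, hGd⟩ := hV.exists_primitive z x
  have h1 := (hGd 0 le_rfl).tendsto_slope_zero_right
  have hG0 : G 0 = 0 := by simp [hG 0 le_rfl]
  simp only [zero_add, hG0, sub_zero, Complex.ofReal_zero, mul_zero, neg_zero, Complex.exp_zero,
    one_smul, hV.isC0Semigroup.1, one_apply_eq_self] at h1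
  refine mem_closure_of_tendsto h1 ?_
  filter_upwards [self_mem_nhdsWithin] with t ht
  have ht0 : 0 ≤ t := le_of_lt ht
  have h2 := hV.apply_laplaceResolvent hz ht0 x
  rw [← hG t ht0] at h2
  refine ⟨t⁻¹ • (x - Complex.exp (-(z * t)) • V t x), ?_⟩
  rw [ContinuousLinearMap.map_smul_of_tower, map_sub, map_smul,
    hV.commute_laplaceResolvent hz ht0, h2, smul_smul, ← Complex.exp_add]
  simp

/-- The semigroup is recovered from its resolvent. -/
lemma laplaceSemigroup_laplaceResolvent (hV : IsBoundedImmediatelyContinuous V C) {M : ℝ}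
    (hF : IsSectorialResolvent (laplaceResolvent V) M)
    (hinj : Function.Injective (laplaceResolvent V 1)) {t : ℝ} (ht : 0 ≤ t) :
    laplaceSemigroup (laplaceResolvent V) t = V t := by
  have hre : 0 < (1 : ℂ).re := by simp
  ext x
  have := hF.eq_laplaceSemigroup_apply hinj (hV.isC0Semigroup.2.2 x) (fun t ht => ?_) ht
  · rw [this, hV.isC0Semigroup.1, one_apply_eq_self]
  · obtain ⟨G, hG, hGd⟩ := hV.exists_primitive 1 x
    have h1 := (hasDerivAt_exp_neg_mul_ofReal (-1) t).smul
      ((hGd t ht.le).const_sub (laplaceResolvent V 1 x))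
    have key : ∀ q : ℝ, 0 ≤ q → laplaceResolvent V 1 (V q x) =
        Complex.exp (-(-1 * q)) • (laplaceResolvent V 1 x - G q) := by
      intro q hq
      rw [hV.commute_laplaceResolvent hre hq, hV.apply_laplaceResolvent hre hq, hG q hq]
      simp
    have h2 := h1.congr_of_eventuallyEq
      (f₁ := fun t => laplaceResolvent V 1 (V t x)) (by
        filter_upwards [lt_mem_nhds ht] with q hq using key q hq.le)
    refine h2.congr_deriv ?_
    rw [key t ht.le, smul_neg, smul_smul, ← Complex.exp_add]
    simp
    abel

end IsBoundedImmediatelyContinuous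

end SemigroupResolvent

section Perturbation

variable [NormedAddCommGroup X] [NormedSpace ℂ X] [CompleteSpace X]

/-- After a shift, an analytic semigroup has a sectorial and bounded resolvent. -/
lemma IsAnalyticSG.exists_shift {T : ℝ → X →L[ℂ] X} {S : ℂ → X →L[ℂ] X} {δ : ℝ}
    (hδ : 0 < δ) (hT : IsC0Semigroup T) (hS : IsAnalyticSG T δ S) :
    ∃ a M : ℝ, 0 < M ∧
      IsBoundedImmediatelyContinuous (fun t : ℝ => Complex.exp (-(a * t)) • T t) M ∧
      ∀ z : ℂ, 0 < z.re →
        ‖laplaceResolvent (fun t : ℝ => Complex.exp (-(a * t)) • T t) z‖ ≤ M / ‖z‖ ∧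
        ‖laplaceResolvent (fun t : ℝ => Complex.exp (-(a * t)) • T t) z‖ ≤ M := by
  obtain ⟨w, C, R₁, R₂, hR⟩ := hS.exists_hasParabolicBounds hδ
  set R : ℝ → X →L[ℂ] X := fun t => Complex.exp (-(w * t)) • T t with hRdef
  have hC : 0 ≤ C := (norm_nonneg _).trans (hR.bound 1 one_pos)
  have hVR : ∀ t : ℝ, Complex.exp (-(((w + 1 : ℝ) : ℂ) * t)) • T t =
      Complex.exp (-(1 * t)) • R t := by
    intro t
    rw [hRdef, smul_smul, ← Complex.exp_add]
    congr 2
    push_cast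
    ring
  have hRc : ContinuousOn R (Ioi 0) :=
    fun t ht => (hR.hasDerivAt t ht).continuousAt.continuousWithinAt
  refine ⟨w + 1, 4 * C + 1, by linarith, ⟨hT.rescale _, ?_, fun t ht => ?_⟩, fun z hz => ?_⟩
  · simp only [hVR]
    exact (show Continuous fun t : ℝ => Complex.exp (-(1 * (t : ℂ))) by
      fun_prop).continuousOn.smul hRc
  · simp only [hVR, norm_smul]
    calc _ ≤ 1 * C := by
          gcongr
          · exact norm_exp_neg_mul_ofReal_le_one (by simp) ht
          · exact hR.bound t ht
      _ ≤ _ := by linarith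
  · have hz1 : (z + 1).re = z.re + 1 := by simp
    have hle : ‖laplaceResolvent (fun t : ℝ => Complex.exp (-(((w + 1 : ℝ) : ℂ) * t)) • T t) z‖ ≤
        4 * C / ‖z + 1‖ := by
      have := hR.norm_laplace_le (μ := z + 1) (by linarith)
      refine (congrArg norm (integral_congr_ae (Eventually.of_forall fun t => ?_))).trans_le this
      simp only [hVR, smul_smul, ← Complex.exp_add]
      congr 2
      ring
    have hz0 : 0 < ‖z‖ := norm_pos_iff.mpr fun h => by simp [h] at hz
    have hn1 : 1 ≤ ‖z + 1‖ := by
      have := Complex.re_le_norm (z + 1)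
      linarith
    have hn2 : ‖z‖ ≤ ‖z + 1‖ := by
      rw [← sq_le_sq₀ (norm_nonneg _) (norm_nonneg _), Complex.sq_norm, Complex.sq_norm,
        Complex.normSq_apply, Complex.normSq_apply, hz1, Complex.add_im, Complex.one_im]
      nlinarith
    refine ⟨hle.trans ?_, hle.trans ?_⟩
    · gcongr
      linarith
    · refine (div_le_self (by positivity) hn1).trans (by linarith)

/-- A Neumann series argument for relatively bounded perturbations. -/
lemma IsResolventOf.exists_perturbation {F : ℂ → X →L[ℂ] X} {domA : Set X} {A D : X → X}
    {M ε : ℝ} (hA : IsResolventOf F domA A) (hM : ∀ z : ℂ, 0 < z.re → ‖F z‖ ≤ M / ‖z‖)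
    (hadd : ∀ x ∈ domA, ∀ y ∈ domA, D (x + y) = D x + D y)
    (hsmul : ∀ (c : ℂ), ∀ x ∈ domA, D (c • x) = c • D x) (hε : ε ≤ 1 / 2)
    (hD : ∀ z : ℂ, 0 < z.re → ∀ y : X, ‖D (F z y)‖ ≤ ε * ‖y‖) (hε0 : 0 ≤ ε) :
    ∃ F' : ℂ → X →L[ℂ] X, IsResolventOf F' domA (fun x => A x + D x) ∧
      (∀ z : ℂ, 0 < z.re → ‖F' z‖ ≤ 2 * M / ‖z‖) ∧
      ∀ z : ℂ, 0 < z.re → ‖F z - F' z‖ ≤ 2 * M * ε / ‖z‖ := by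
  have hK : ∀ z : ℂ, ∃ K : X →L[ℂ] X, 0 < z.re → ‖K‖ ≤ ε ∧ ∀ y, K y = D (F z y) := by
    intro z
    by_cases hz : 0 < z.re
    · let L : X →ₗ[ℂ] X :=
        { toFun := fun y => D (F z y)
          map_add' := fun y y' => by
            rw [map_add, hadd _ (hA.mem_dom z hz y) _ (hA.mem_dom z hz y')]
          map_smul' := fun c y => by
            rw [map_smul, hsmul c _ (hA.mem_dom z hz y), RingHom.id_apply] }
      exact ⟨L.mkContinuous ε (hD z hz), fun _ => ⟨L.mkContinuous_norm_le hε0 _, fun y => rfl⟩⟩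
    · exact ⟨0, fun h => absurd h hz⟩
  choose K hK using hK
  set J : ℂ → X →L[ℂ] X := fun z => ∑' n : ℕ, K z ^ n with hJ
  have hK1 : ∀ z : ℂ, 0 < z.re → ‖K z‖ < 1 := fun z hz => (hK z hz).1.trans_lt (by linarith)
  have hJ1 : ∀ z : ℂ, 0 < z.re → J z * (1 - K z) = 1 := fun z hz =>
    geom_series_mul_neg _ (hK1 z hz)
  have hJ2 : ∀ z : ℂ, 0 < z.re → (1 - K z) * J z = 1 := fun z hz =>
    mul_neg_geom_series _ (hK1 z hz)
  have hJn : ∀ z : ℂ, 0 < z.re → ‖J z‖ ≤ 2 := by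
    intro z hz
    have h1 := tsum_geometric_le_of_norm_lt_one (K z) (hK1 z hz)
    have h2 : (1 - ‖K z‖)⁻¹ ≤ 2 := by
      rw [inv_le_comm₀ (by linarith [hK1 z hz]) (by norm_num)]
      linarith [(hK z hz).1]
    have h3 := norm_one_le_one (X := X)
    linarith
  refine ⟨fun z => F z * J z, ⟨fun z hz y => hA.mem_dom z hz _, fun z hz y => ?_,
    fun z hz x hx => ?_⟩, fun z hz => ?_, fun z hz => ?_⟩
  · have h1 := hA.right_inv z hz (J z y)
    have h2 := congrArg (fun S : X →L[ℂ] X => S y) (hJ2 z hz)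
    simp only [mul_apply_eq_comp, sub_apply, one_apply_eq_self, (hK z hz).2] at h2 ⊢
    rw [← sub_sub, h1, h2]
  · have h1 := hA.left_inv z hz x hx
    have h2 := congrArg (fun S : X →L[ℂ] X => S (z • x - A x)) (hJ1 z hz)
    simp only [mul_apply_eq_comp, sub_apply, one_apply_eq_self, (hK z hz).2, h1] at h2 ⊢
    rw [← sub_sub, h2, h1]
  · calc _ ≤ ‖F z‖ * ‖J z‖ := norm_mul_le _ _
      _ ≤ M / ‖z‖ * 2 := by
        gcongr
        · exact (norm_nonneg _).trans (hM z hz)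
        · exact hM z hz
        · exact hJn z hz
      _ = _ := by ring
  · have e : F z - F z * J z = -(F z * (K z * J z)) := by
      have := hJ2 z hz
      rw [sub_mul, one_mul] at this
      rw [← mul_neg, ← mul_one_sub, ← this]
      congr 1
      abel
    rw [e, norm_neg]
    calc _ ≤ ‖F z‖ * (‖K z‖ * ‖J z‖) :=
          (norm_mul_le _ _).trans (by gcongr; exact norm_mul_le _ _)
      _ ≤ M / ‖z‖ * (ε * 2) := by
        gcongr
        · exact (norm_nonneg _).trans (hM z hz)
        · exact hM z hz
        · exact (hK z hz).1
        · exact hJn z hz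
      _ = _ := by ring

/-- Small relatively bounded perturbations of the generator of an analytic semigroup generate
semigroups which are uniformly close on bounded time intervals. -/
lemma IsAnalyticSG.exists_perturbed_semigroup {T : ℝ → X →L[ℂ] X} {S : ℂ → X →L[ℂ] X} {δ : ℝ}
    (hδ : 0 < δ) (hT : IsC0Semigroup T) (hS : IsAnalyticSG T δ S) {domA : Set X} {A : X → X}
    (hA : IsGenerator T domA A) (τ : ℝ) {η : ℝ} (hη : 0 < η) :
    ∃ α : ℝ, 0 < α ∧ ∃ β : ℝ, 0 < β ∧
      ∀ (domD : Set X) (D : X → X), RelABounded domA A α β domD D →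
        ∃ T' : ℝ → X →L[ℂ] X, IsC0Semigroup T' ∧ IsGenerator T' domA (fun x => A x + D x) ∧
          ContinuousOn T' (Ioi 0) ∧ ∀ t ∈ Ioc 0 τ, ‖T t - T' t‖ ≤ η := by
  obtain ⟨a, M, hM0, hV, hF⟩ := hS.exists_shift hδ hT
  set V : ℝ → X →L[ℂ] X := fun t => Complex.exp (-(a * t)) • T t with hVdef
  set F := laplaceResolvent V
  have hres : IsResolventOf F domA (fun x => A x - (a : ℂ) • x) := hV.isResolventOf (hA.rescale a)
  have hsec : IsSectorialResolvent F (2 * M) := hres.isSectorialResolvent fun z hz =>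
    (hF z hz).1.trans (by gcongr; linarith)
  have hVF : ∀ t : ℝ, 0 ≤ t → laplaceSemigroup F t = V t := fun t ht =>
    hV.laplaceSemigroup_laplaceResolvent hsec (hres.injective (by simp)) ht
  have hdense : Dense domA := (hV.dense_range_laplaceResolvent (z := 1) (by simp)).mono
    (range_subset_iff.mpr (hres.mem_dom 1 (by simp)))
  set L : ℝ := M + 1 + |a| * M + M
  have hL : 0 < L := by positivity
  set Q : ℝ := Real.exp (|a| * τ) * (Real.exp 1 * (3 * (2 * M) ^ 2) * (2 * M))
  have hQ : 0 < Q := by positivity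
  set ε : ℝ := min (1 / 2) (η / Q)
  have hε0 : 0 < ε := by positivity
  refine ⟨ε / L, by positivity, ε / L, by positivity, fun domD D hD => ?_⟩
  obtain ⟨hdom, hadd, hsmul, hbd⟩ := hD
  have hDF : ∀ z : ℂ, 0 < z.re → ∀ y : X, ‖D (F z y)‖ ≤ ε * ‖y‖ := by
    intro z hz y
    have hz0 : 0 < ‖z‖ := norm_pos_iff.mpr fun h => by simp [h] at hz
    have h1 : ‖F z y‖ ≤ M * ‖y‖ := (F z).le_of_opNorm_le (hF z hz).2 y
    have h2 : ‖z • F z y‖ ≤ M * ‖y‖ := by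
      rw [norm_smul]
      calc _ ≤ ‖z‖ * (M / ‖z‖ * ‖y‖) := by
            gcongr
            exact (F z).le_of_opNorm_le (hF z hz).1 y
        _ = _ := by field_simp
    have h3 : A (F z y) = z • F z y - y + (a : ℂ) • F z y := by
      have := hres.right_inv z hz y
      linear_combination (norm := module) -this
    have h4 : ‖A (F z y)‖ ≤ M * ‖y‖ + ‖y‖ + |a| * (M * ‖y‖) := by
      rw [h3]
      refine (norm_add_le _ _).trans (add_le_add ((norm_sub_le _ _).trans (by gcongr)) ?_)
      rw [norm_smul, Complex.norm_real, Real.norm_eq_abs]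
      gcongr
    calc _ ≤ ε / L * ‖A (F z y)‖ + ε / L * ‖F z y‖ := hbd _ (hres.mem_dom z hz y)
      _ ≤ ε / L * (M * ‖y‖ + ‖y‖ + |a| * (M * ‖y‖)) + ε / L * (M * ‖y‖) := by gcongr
      _ = ε / L * L * ‖y‖ := by ring
      _ = _ := by rw [div_mul_cancel₀ _ hL.ne']
  obtain ⟨F', hres', hF', hFF'⟩ := hres.exists_perturbation (D := D) (fun z hz => (hF z hz).1)
    (fun x hx y hy => hadd x (hdom hx) y (hdom hy)) (fun c x hx => hsmul c x (hdom hx))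
    (min_le_left _ _) hDF hε0.le
  have hsec' : IsSectorialResolvent F' (2 * M) := hres'.isSectorialResolvent hF'
  obtain ⟨hC0, hgen⟩ := hsec'.isGenerator hres' hdense
  refine ⟨fun t => Complex.exp (-(-(a : ℂ) * t)) • laplaceSemigroup F' t, hC0.rescale _, ?_, ?_,
    fun t ht => ?_⟩
  · convert hgen.rescale (-(a : ℂ)) using 2 with x
    module
  · refine (show Continuous fun t : ℝ => Complex.exp (-(-(a : ℂ) * t)) by
      fun_prop).continuousOn.smul fun t ht => ?_
    exact (hsec'.continuousAt_laplaceSemigroup ht).continuousWithinAt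
  · have h1 := hsec.norm_laplaceSemigroup_sub_le hsec' hFF' ht.1
    have h2 : T t = Complex.exp (-(-(a : ℂ) * t)) • laplaceSemigroup F t := by
      rw [hVF t ht.1.le, hVdef, smul_smul, ← Complex.exp_add]
      simp
    rw [h2, ← smul_sub, norm_smul, norm_exp_neg_mul_ofReal]
    have h3 : -((-(a : ℂ)).re * t) ≤ |a| * τ := by
      rw [Complex.neg_re, Complex.ofReal_re, neg_mul, neg_neg]
      calc a * t ≤ |a| * t := by gcongr; exacts [ht.1.le, le_abs_self a]
        _ ≤ _ := by gcongr; exact ht.2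
    calc _ ≤ Real.exp (|a| * τ) * (Real.exp 1 * (3 * (2 * M) ^ 2) * (2 * M * ε)) := by gcongr
      _ = Q * ε := by ring
      _ ≤ Q * (η / Q) := by gcongr; exact min_le_right _ _
      _ = η := mul_div_cancel₀ _ hQ.ne'

end Perturbation

section SampledData

variable [NormedAddCommGroup X] [NormedSpace ℂ X]

/-- The operator propagating a sampled-data solution from a sampling instant over a time `t`. -/
noncomputable def sdFlow (T : ℝ → X →L[ℂ] X) (B : X →L[ℂ] X) (t : ℝ) : X →L[ℂ] X :=
  T t + (∫ s in (0 : ℝ)..t, T s).comp B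

lemma norm_sdFlow_le {T : ℝ → X →L[ℂ] X} (B : X →L[ℂ] X) {τ C : ℝ}
    (hC : ∀ t ∈ Ioc 0 τ, ‖T t‖ ≤ C) {t : ℝ} (ht : t ∈ Ioc 0 τ) :
    ‖sdFlow T B t‖ ≤ C * (1 + τ * ‖B‖) := by
  have hC0 : 0 ≤ C := (norm_nonneg _).trans (hC t ht)
  have h1 : ‖∫ s in (0 : ℝ)..t, T s‖ ≤ C * τ := by
    refine (intervalIntegral.norm_integral_le_of_norm_le_const (C := C) fun s hs => ?_).trans ?_
    · rw [uIoc_of_le ht.1.le] at hs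
      exact hC s ⟨hs.1, hs.2.trans ht.2⟩
    · rw [sub_zero, abs_of_pos ht.1]
      gcongr
      exact ht.2
  calc _ ≤ ‖T t‖ + ‖(∫ s in (0 : ℝ)..t, T s).comp B‖ := norm_add_le _ _
    _ ≤ C + C * τ * ‖B‖ := by
      gcongr
      · exact hC t ht
      · exact (ContinuousLinearMap.opNorm_comp_le _ _).trans (by gcongr)
    _ = _ := by ring

lemma intervalIntegrable_of_continuousOn_Ioi {T : ℝ → X →L[ℂ] X} (hc : ContinuousOn T (Ioi 0))
    {τ C : ℝ} (hC : ∀ t ∈ Ioc 0 τ, ‖T t‖ ≤ C) {t : ℝ} (ht : t ∈ Ioc 0 τ) :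
    IntervalIntegrable T volume 0 t := by
  rw [intervalIntegrable_iff_integrableOn_Ioc_of_le ht.1.le]
  refine Integrable.mono' (integrable_const C)
    ((hc.mono Ioc_subset_Ioi_self).aestronglyMeasurable measurableSet_Ioc) ?_
  filter_upwards [ae_restrict_mem measurableSet_Ioc] with s hs
  exact hC s ⟨hs.1, hs.2.trans ht.2⟩

lemma norm_sdFlow_sub_le {T T' : ℝ → X →L[ℂ] X} (B : X →L[ℂ] X) {τ η : ℝ} (hτ : 0 < τ)
    (hT : IntervalIntegrable T volume 0 τ) (hT' : IntervalIntegrable T' volume 0 τ)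
    (h : ∀ t ∈ Ioc 0 τ, ‖T t - T' t‖ ≤ η) :
    ‖sdFlow T B τ - sdFlow T' B τ‖ ≤ η * (1 + τ * ‖B‖) := by
  have e : sdFlow T B τ - sdFlow T' B τ = sdFlow (fun t => T t - T' t) B τ := by
    rw [sdFlow, sdFlow, sdFlow, intervalIntegral.integral_sub hT hT',
      ContinuousLinearMap.sub_comp]
    abel
  rw [e]
  exact norm_sdFlow_le B h ⟨hτ, le_rfl⟩

lemma IsSdSolution.apply_nat_mul_add [CompleteSpace X] {T : ℝ → X →L[ℂ] X} {B : X →L[ℂ] X}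
    {τ : ℝ} (hτ : 0 < τ) (hT : ∀ t ∈ Ioc 0 τ, IntervalIntegrable T volume 0 t) {x0 : X}
    {x : ℝ → X} (hx : IsSdSolution T B τ x0 x) (k : ℕ) {t : ℝ} (ht : t ∈ Ioc 0 τ) :
    x (k * τ + t) = sdFlow T B t ((sdFlow T B τ ^ k) x0) := by
  have step : ∀ (k : ℕ) (t : ℝ), t ∈ Ioc 0 τ →
      x (k * τ + t) = sdFlow T B t (x (k * τ)) := by
    intro k t ht
    rw [hx.2 k t ht.1 ht.2, sdFlow, add_apply, ContinuousLinearMap.comp_apply,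
      ContinuousLinearMap.intervalIntegral_apply (hT t ht)]
  have hk : ∀ k : ℕ, x (k * τ) = (sdFlow T B τ ^ k) x0 := by
    intro k
    induction k with
    | zero => simp [hx.1]
    | succ k ih =>
      rw [Nat.cast_succ, add_mul, one_mul, step k τ ⟨hτ, le_rfl⟩, ih, pow_succ']
      rfl
  rw [step k t ht, hk]

lemma exists_nat_mul_add {τ t : ℝ} (hτ : 0 < τ) (ht : 0 < t) :
    ∃ (k : ℕ) (s : ℝ), s ∈ Ioc 0 τ ∧ t = k * τ + s := by
  have h0 : 0 < ⌈t / τ⌉₊ := Nat.ceil_pos.mpr (by positivity)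
  obtain ⟨k, hk⟩ := Nat.exists_eq_succ_of_ne_zero h0.ne'
  obtain ⟨h1, h2⟩ := (Nat.ceil_eq_iff (Nat.succ_ne_zero k)).mp hk
  rw [Nat.succ_sub_one, lt_div_iff₀ hτ] at h1
  rw [div_le_iff₀ hτ, Nat.cast_succ, add_mul, one_mul] at h2
  exact ⟨k, t - k * τ, ⟨by linarith, by linarith⟩, by ring⟩

lemma exists_isSdSolution_s1 [CompleteSpace X] {T : ℝ → X →L[ℂ] X} (B : X →L[ℂ] X) {τ : ℝ}
    (hτ : 0 < τ) (hT : ∀ t ∈ Ioc 0 τ, IntervalIntegrable T volume 0 t) (x0 : X) :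
    ∃ x : ℝ → X, IsSdSolution T B τ x0 x ∧ ∀ k : ℕ, x (k * τ) = (sdFlow T B τ ^ k) x0 := by
  set x : ℝ → X := fun t => if t ≤ 0 then x0 else
    sdFlow T B (t - (⌈t / τ⌉₊ - 1 : ℕ) * τ) ((sdFlow T B τ ^ (⌈t / τ⌉₊ - 1)) x0) with hx
  have hxk : ∀ (k : ℕ) (t : ℝ), t ∈ Ioc 0 τ →
      x (k * τ + t) = sdFlow T B t ((sdFlow T B τ ^ k) x0) := by
    intro k t ht
    have hpos : 0 < k * τ + t := add_pos_of_nonneg_of_pos (by positivity) ht.1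
    have hceil : ⌈(k * τ + t) / τ⌉₊ = k + 1 := by
      rw [Nat.ceil_eq_iff (Nat.succ_ne_zero k), Nat.succ_sub_one,
         lt_div_iff₀ hτ, div_le_iff₀ hτ]
      push_cast
      exact ⟨by linarith [ht.1], by linarith [ht.2]⟩
    simp only [hx, not_le.mpr hpos, if_false, hceil, Nat.add_sub_cancel, add_sub_cancel_left]
  have hk : ∀ k : ℕ, x (k * τ) = (sdFlow T B τ ^ k) x0 := by
    intro k
    cases k with
    | zero => simp [hx]
    | succ k =>
      rw [Nat.cast_succ, add_mul, one_mul, hxk k τ ⟨hτ, le_rfl⟩, pow_succ']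
      rfl
  refine ⟨x, ⟨by simp [hx], fun k t ht0 ht => ?_⟩, hk⟩
  rw [hxk k t ⟨ht0, ht⟩, hk, sdFlow, add_apply, ContinuousLinearMap.comp_apply,
    ContinuousLinearMap.intervalIntegral_apply (hT t ⟨ht0, ht⟩)]

lemma SdExpStable.norm_sdFlow_pow_le [CompleteSpace X] {T : ℝ → X →L[ℂ] X} {B : X →L[ℂ] X}
    {τ ω : ℝ} (hτ : 0 < τ) (hT : ∀ t ∈ Ioc 0 τ, IntervalIntegrable T volume 0 t)
    (h : SdExpStable T B τ ω) :
    ∃ M : ℝ, 0 < M ∧ ∃ ω' : ℝ, ω < ω' ∧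
      ∀ k : ℕ, ‖sdFlow T B τ ^ k‖ ≤ M * Real.exp (-ω' * (k * τ)) := by
  obtain ⟨M, hM, ω', hω, hst⟩ := h
  refine ⟨M, by linarith, ω', hω, fun k => ContinuousLinearMap.opNorm_le_bound _ (by positivity)
    fun x0 => ?_⟩
  obtain ⟨x, hx, hxk⟩ := exists_isSdSolution_s1 B hτ hT x0
  rw [← hxk k]
  exact hst x0 x hx _ (by positivity)

lemma sdExpStable_of_norm_sdFlow_pow_le [CompleteSpace X] {T : ℝ → X →L[ℂ] X} {B : X →L[ℂ] X}
    {τ ω ω' C M : ℝ} (hτ : 0 < τ) (hT : ∀ t ∈ Ioc 0 τ, IntervalIntegrable T volume 0 t)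
    (hC : ∀ t ∈ Ioc 0 τ, ‖T t‖ ≤ C) (hω : ω < ω')
    (hM : ∀ k : ℕ, ‖sdFlow T B τ ^ k‖ ≤ M * Real.exp (-ω' * (k * τ))) :
    SdExpStable T B τ ω := by
  set K : ℝ := C * (1 + τ * ‖B‖) * M * Real.exp (|ω'| * τ)
  have hC0 : 0 ≤ C := (norm_nonneg _).trans (hC τ ⟨hτ, le_rfl⟩)
  have hM0 : 0 ≤ M := by
    have := (norm_nonneg _).trans (hM 0)
    simpa using this
  refine ⟨max 1 K, le_max_left _ _, ω', hω, fun x0 x hx t ht => ?_⟩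
  rcases ht.eq_or_lt with rfl | ht0
  · rw [hx.1, mul_zero, Real.exp_zero, mul_one]
    exact le_mul_of_one_le_left (norm_nonneg _) (le_max_left _ _)
  obtain ⟨k, s, hs, rfl⟩ := exists_nat_mul_add hτ ht0
  rw [hx.apply_nat_mul_add hτ hT k hs]
  have h1 : Real.exp (-ω' * (k * τ)) ≤ Real.exp (|ω'| * τ) * Real.exp (-ω' * (k * τ + s)) := by
    rw [← Real.exp_add, Real.exp_le_exp]
    have : ω' * s ≤ |ω'| * τ := by
      calc ω' * s ≤ |ω'| * s := mul_le_mul_of_nonneg_right (le_abs_self _) hs.1.le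
        _ ≤ _ := by gcongr; exact hs.2
    linarith
  calc ‖sdFlow T B s ((sdFlow T B τ ^ k) x0)‖
      ≤ C * (1 + τ * ‖B‖) * (M * Real.exp (-ω' * (k * τ)) * ‖x0‖) :=
        (sdFlow T B s).le_of_opNorm_le_of_le (norm_sdFlow_le B hC hs)
          ((sdFlow T B τ ^ k).le_of_opNorm_le (hM k) x0)
    _ ≤ C * (1 + τ * ‖B‖) *
        (M * (Real.exp (|ω'| * τ) * Real.exp (-ω' * (k * τ + s))) * ‖x0‖) := by gcongr
    _ = K * Real.exp (-ω' * (k * τ + s)) * ‖x0‖ := by ring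
    _ ≤ _ := by gcongr; exact le_max_right _ _

lemma norm_pow_mul_le_pow_mul {𝔸 : Type*} [NormedRing 𝔸] (a b : 𝔸) (n : ℕ) :
    ‖a ^ n * b‖ ≤ ‖a‖ ^ n * ‖b‖ := by
  induction n with
  | zero => simp
  | succ n ih =>
    rw [pow_succ', mul_assoc, pow_succ', mul_assoc]
    exact (norm_mul_le _ _).trans (by gcongr)

/-- Exponential bounds on the powers of an element are stable under small perturbations, up to
an arbitrarily small loss in the rate. -/
lemma exists_norm_pow_le_of_norm_sub_le {𝔸 : Type*} [NormedRing 𝔸] {a : 𝔸} {M τ ω ω' : ℝ}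
    (hτ : 0 < τ) (hω : ω < ω') (ha : ∀ k : ℕ, ‖a ^ k‖ ≤ M * Real.exp (-ω' * (k * τ))) :
    ∃ η : ℝ, 0 < η ∧ ∀ b : 𝔸, ‖a - b‖ ≤ η →
      ∃ C : ℝ, ∀ k : ℕ, ‖b ^ k‖ ≤ C * Real.exp (-ω * (k * τ)) := by
  obtain ⟨N, hN0, hN⟩ : ∃ N : ℕ, 0 < N ∧ M * Real.exp (-((ω' - ω) * τ * N)) < 1 := by
    have h1 : Tendsto (fun N : ℕ => M * Real.exp (-((ω' - ω) * τ * N))) atTop (𝓝 (M * 0)) :=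
      (Real.tendsto_exp_neg_atTop_nhds_zero.comp (tendsto_natCast_atTop_atTop.const_mul_atTop
        (mul_pos (sub_pos.mpr hω) hτ))).const_mul M
    rw [mul_zero] at h1
    obtain ⟨N, hN, hN'⟩ := ((h1.eventually_lt_const one_pos).and (eventually_gt_atTop 0)).exists
    exact ⟨N, hN', hN⟩
  have haN : ‖a ^ N‖ < Real.exp (-ω * (N * τ)) := by
    calc _ ≤ M * Real.exp (-ω' * (N * τ)) := ha N
      _ = M * Real.exp (-((ω' - ω) * τ * N)) * Real.exp (-ω * (N * τ)) := by
        rw [mul_assoc, ← Real.exp_add]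
        ring_nf
      _ < 1 * Real.exp (-ω * (N * τ)) := by gcongr
      _ = _ := one_mul _
  have hcont : ContinuousAt (fun b : 𝔸 => ‖b ^ N‖) a := (continuous_pow N).norm.continuousAt
  obtain ⟨η, hη, hηb⟩ := Metric.eventually_nhds_iff.mp (hcont.eventually_lt_const haN)
  refine ⟨η / 2, by positivity, fun b hb => ?_⟩
  have hbN : ‖b ^ N‖ < Real.exp (-ω * (N * τ)) := by
    refine hηb ?_
    rw [dist_comm, dist_eq_norm]
    linarith
  refine ⟨∑ r ∈ Finset.range N, ‖b ^ r‖ * Real.exp (ω * (r * τ)), fun k => ?_⟩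
  have hr : ‖b ^ (k % N)‖ * Real.exp (ω * ((k % N : ℕ) * τ)) ≤
      ∑ r ∈ Finset.range N, ‖b ^ r‖ * Real.exp (ω * (r * τ)) :=
    Finset.single_le_sum (f := fun r : ℕ => ‖b ^ r‖ * Real.exp (ω * (r * τ)))
      (fun r _ => by positivity) (Finset.mem_range.mpr (Nat.mod_lt k hN0))
  have hk : (k : ℝ) = N * (k / N : ℕ) + (k % N : ℕ) := by exact_mod_cast (Nat.div_add_mod k N).symm
  calc ‖b ^ k‖ = ‖(b ^ N) ^ (k / N) * b ^ (k % N)‖ := by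
        rw [← pow_mul, ← pow_add, Nat.div_add_mod]
    _ ≤ ‖b ^ N‖ ^ (k / N) * ‖b ^ (k % N)‖ := norm_pow_mul_le_pow_mul _ _ _
    _ ≤ Real.exp (-ω * (N * τ)) ^ (k / N) * ‖b ^ (k % N)‖ := by gcongr
    _ = ‖b ^ (k % N)‖ * Real.exp (ω * ((k % N : ℕ) * τ)) * Real.exp (-ω * (k * τ)) := by
      rw [← Real.exp_nat_mul, mul_assoc, ← Real.exp_add, mul_comm, hk]
      congr 2
      ring
    _ ≤ _ := by gcongr

lemma IsC0Semigroup.exists_norm_le [CompleteSpace X] {T : ℝ → X →L[ℂ] X} (hT : IsC0Semigroup T)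
    (τ : ℝ) : ∃ C : ℝ, ∀ t ∈ Ioc 0 τ, ‖T t‖ ≤ C := by
  obtain ⟨C, hC⟩ := banach_steinhaus (g := fun t : Icc (0 : ℝ) τ => T t) fun x => by
    obtain ⟨C, hC⟩ := isCompact_Icc.exists_bound_of_continuousOn
      ((hT.2.2 x).mono (Icc_subset_Ici_self : Icc (0 : ℝ) τ ⊆ Ici 0))
    exact ⟨C, fun t => hC t t.2⟩
  exact ⟨C, fun t ht => hC ⟨t, ht.1.le, ht.2⟩⟩

lemma IsAnalyticSG.continuousOn {T : ℝ → X →L[ℂ] X} {S : ℂ → X →L[ℂ] X} {δ : ℝ} (hδ : 0 < δ)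
    (hS : IsAnalyticSG T δ S) : ContinuousOn T (Ioi 0) := by
  have h : ContinuousOn (fun t : ℝ => S t) (Ioi 0) :=
    hS.2.1.continuousOn.comp Complex.continuous_ofReal.continuousOn fun t ht => by
      have ht0 : 0 < t := ht
      simp [ht0.ne', Complex.arg_ofReal_of_nonneg ht0.le, hδ]
  exact h.congr fun t ht => (hS.1 t (le_of_lt ht)).symm

end SampledData

/-- Robustness of exponential stability of sampled-data systems governed by an
analytic semigroup under relatively `A`-bounded perturbations. -/
theorem sd_stability_robust_relbounded
    [NormedAddCommGroup X] [NormedSpace ℂ X] [CompleteSpace X]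
    (T : ℝ → X →L[ℂ] X) (hT : IsC0Semigroup T)
    (domA : Set X) (A : X → X) (hA : IsGenerator T domA A)
    (B : X →L[ℂ] X) (τ ω : ℝ) (hτ : 0 < τ)
    (hstab : SdExpStable T B τ ω)
    (δ : ℝ) (hδ₀ : 0 < δ) (hδπ : δ ≤ π / 2)
    (S : ℂ → X →L[ℂ] X) (hS : IsAnalyticSG T δ S) :
    ∃ α : ℝ, 0 < α ∧ ∃ β : ℝ, 0 < β ∧
      ∀ (domD : Set X) (D : X → X), RelABounded domA A α β domD D →
        ∃ TD : ℝ → X →L[ℂ] X,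
          IsC0Semigroup TD ∧
          IsGenerator TD domA (fun x => A x + D x) ∧
          SdExpStable TD B τ ω := by
  have hτmem : τ ∈ Ioc 0 τ := ⟨hτ, le_rfl⟩
  obtain ⟨C, hC⟩ := hT.exists_norm_le τ
  have hInt : ∀ t ∈ Ioc 0 τ, IntervalIntegrable T volume 0 t := fun t ht =>
    intervalIntegrable_of_continuousOn_Ioi (hS.continuousOn hδ₀) hC ht
  obtain ⟨M, -, ω', hω, hM⟩ := hstab.norm_sdFlow_pow_le hτ hInt
  obtain ⟨ω'', hω₁, hω₂⟩ := exists_between hω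
  obtain ⟨η, hη, hpow⟩ := exists_norm_pow_le_of_norm_sub_le hτ hω₂ hM
  have hpos : 0 < 1 + τ * ‖B‖ := by positivity
  obtain ⟨α, hα, β, hβ, hpert⟩ :=
    hS.exists_perturbed_semigroup hδ₀ hT hA τ (div_pos hη hpos)
  refine ⟨α, hα, β, hβ, fun domD D hD => ?_⟩
  obtain ⟨TD, hTD, hgen, hcont, hclose⟩ := hpert domD D hD
  obtain ⟨C', hC'⟩ := hTD.exists_norm_le τ
  have hInt' : ∀ t ∈ Ioc 0 τ, IntervalIntegrable TD volume 0 t := fun t ht =>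
    intervalIntegrable_of_continuousOn_Ioi hcont hC' ht
  have hflow := norm_sdFlow_sub_le B hτ (hInt τ hτmem) (hInt' τ hτmem) hclose
  rw [div_mul_cancel₀ _ hpos.ne'] at hflow
  obtain ⟨K, hK⟩ := hpow _ hflow
  exact ⟨TD, hTD, hgen, sdExpStable_of_norm_sdFlow_pow_le hτ hInt' hC' hω₁ hK⟩
end
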